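/- arXiv:1307.5037 — 3 statements merged into one kernel-verified Lean document; each statement's English description precedes it below -/
import Mathlib

section
/- Fix s, t > 0 with s + t = 1, R > 1, and ℓ > 0. Then there exist ε > 0 and a partition of ℚ² into sets 𝒫_{n,k}^{(δ)} indexed by δ ∈ {1,2} and integers n ≥ k ≥ 1, with the following property. For m ≥ 0 put 𝒫_m = ⋃_{δ∈{1,2}} ⋃_{k=1}^{m} 𝒫_{m,k}^{(δ)}, and let ℬ_m be the collection of closed balls B ⊂ ℝ² of radius R^{−m}·ℓ/2 such that Δ_ε(P) ∩ B = ∅ for every m' ≤ m and every P ∈ 𝒫_{m'}. Then for all integers n ≥ k ≥ 1, all δ ∈ {1,2}, and every ball B ∈ ℬ_{n−k}, there exists an affine line L in ℝ² such that Δ_ε(P) ⊆ L^{((1/3)·ℓ·R^{−n})} for every P ∈ 𝒫_{n,k}^{(δ)} with Δ_ε(P) ∩ B ≠ ∅. -/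
open Metric Filter

/-- An affine line in ℝ²: a nonempty affine subspace whose direction has dimension 1. -/
def IsLine (L : AffineSubspace ℝ (ℝ × ℝ)) : Prop :=
  (L : Set (ℝ × ℝ)).Nonempty ∧ Module.finrank ℝ L.direction = 1

/-- The closed `γ`-thickening `L^(γ) = {p : dist(p, L) ≤ γ}` of a line `L`. -/
noncomputable def lineNbhd (L : AffineSubspace ℝ (ℝ × ℝ)) (γ : ℝ) : Set (ℝ × ℝ) :=
  {p | Metric.infDist p (L : Set (ℝ × ℝ)) ≤ γ}

/-- For `P = (p/q, r/q) ∈ ℚ²` in lowest terms (i.e. `gcd (p, r, q) = 1`), the positive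
integer `q`: it is the least common multiple of the denominators of the two coordinates. -/
def ratDen (P : ℚ × ℚ) : ℕ := Nat.lcm P.1.den P.2.den

/-- The rectangle `Δ_ε(P)` around a rational point `P = (p/q, r/q)` (in lowest terms):
`Δ_ε(P) = {(x,y) : |x - p/q| ≤ ε/q^(1+s) and |y - r/q| ≤ ε/q^(1+t)}`. -/
noncomputable def Delta (s t ε : ℝ) (P : ℚ × ℚ) : Set (ℝ × ℝ) :=
  {x | |x.1 - (P.1 : ℝ)| ≤ ε / (ratDen P : ℝ) ^ (1 + s) ∧
       |x.2 - (P.2 : ℝ)| ≤ ε / (ratDen P : ℝ) ^ (1 + t)}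

theorem ratDen_pos (P : ℚ × ℚ) : 0 < ratDen P := Nat.lcm_pos P.1.pos P.2.pos

theorem exists_ratDen_mul_eq_intCast (P : ℚ × ℚ) :
    ∃ p r : ℤ, (ratDen P : ℝ) * P.1 = p ∧ (ratDen P : ℝ) * P.2 = r := by
  have exists_num : ∀ (x : ℚ) (q : ℕ), x.den ∣ q → ∃ p : ℤ, (q : ℝ) * x = p := by
    rintro x _ ⟨u, rfl⟩
    refine ⟨x.num * u, ?_⟩
    have h : ((x.den * u : ℕ) : ℚ) * x = (x.num * u : ℤ) := by
      push_cast; rw [← Rat.mul_den_eq_num x]; ring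
    exact_mod_cast h
  obtain ⟨p, hp⟩ := exists_num P.1 (ratDen P) (Nat.dvd_lcm_left _ _)
  obtain ⟨r, hr⟩ := exists_num P.2 (ratDen P) (Nat.dvd_lcm_right _ _)
  exact ⟨p, r, hp, hr⟩

theorem exists_line_coeffs {s t : ℝ} (hst : s + t = 1) (P : ℚ × ℚ) :
    ∃ A B C : ℤ, (A ≠ 0 ∨ B ≠ 0) ∧ (A : ℝ) * P.1 + B * P.2 + C = 0 ∧
      |(A : ℝ)| ≤ (ratDen P : ℝ) ^ s ∧ |(B : ℝ)| ≤ (ratDen P : ℝ) ^ t := by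
  set q := ratDen P with hq
  have hq0 : 0 < q := ratDen_pos P
  have hqR : (0 : ℝ) < q := by exact_mod_cast hq0
  have : NeZero q := ⟨hq0.ne'⟩
  obtain ⟨p, r, hx, hy⟩ := exists_ratDen_mul_eq_intCast P
  rw [← hq] at hx hy
  set S := Finset.range (⌊(q : ℝ) ^ s⌋₊ + 1) ×ˢ Finset.range (⌊(q : ℝ) ^ t⌋₊ + 1)
  have hcard : (Finset.univ : Finset (ZMod q)).card < S.card := by
    rw [Finset.card_univ, ZMod.card, Finset.card_product, Finset.card_range, Finset.card_range]
    have h1 := Nat.lt_floor_add_one ((q : ℝ) ^ s)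
    have h2 := Nat.lt_floor_add_one ((q : ℝ) ^ t)
    have h3 : (q : ℝ) = (q : ℝ) ^ s * (q : ℝ) ^ t := by
      rw [← Real.rpow_add hqR, hst, Real.rpow_one]
    have h4 : (q : ℝ) < (⌊(q : ℝ) ^ s⌋₊ + 1) * (⌊(q : ℝ) ^ t⌋₊ + 1) := by
      nth_rewrite 1 [h3]
      exact mul_lt_mul'' h1 h2 (by positivity) (by positivity)
    exact_mod_cast h4
  obtain ⟨a, ha, b, hb, hab, hf⟩ := Finset.exists_ne_map_eq_of_card_lt_of_maps_to hcard
    (f := fun a : ℕ × ℕ => ((a.1 * p + a.2 * r : ℤ) : ZMod q))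
    (fun _ _ => Finset.mem_coe.2 (Finset.mem_univ _))
  simp only [S, Finset.mem_product, Finset.mem_range, Nat.lt_add_one_iff] at ha hb
  have hle : ∀ {m n : ℕ} {c : ℝ}, 0 ≤ c → m ≤ ⌊c⌋₊ → n ≤ ⌊c⌋₊ → |(((m : ℤ) - n : ℤ) : ℝ)| ≤ c := by
    intro m n c hc hm hn
    have hm' := (Nat.le_floor_iff hc).1 hm
    have hn' := (Nat.le_floor_iff hc).1 hn
    push_cast
    rw [abs_le]
    constructor <;> linarith [(Nat.cast_nonneg m : (0 : ℝ) ≤ m), (Nat.cast_nonneg n : (0 : ℝ) ≤ n)]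
  rw [ZMod.intCast_eq_intCast_iff, Int.modEq_iff_dvd] at hf
  obtain ⟨c, hc⟩ := hf
  refine ⟨(a.1 : ℤ) - b.1, (a.2 : ℤ) - b.2, c, ?_, ?_, hle (by positivity) ha.1 hb.1,
    hle (by positivity) ha.2 hb.2⟩
  · by_contra! h
    exact hab (Prod.ext (by lia) (by lia))
  · have hc' : (b.1 : ℝ) * p + b.2 * r - (a.1 * p + a.2 * r) = q * c := by exact_mod_cast hc
    have : (q : ℝ) * ((((a.1 : ℤ) - b.1 : ℤ) : ℝ) * P.1 + (((a.2 : ℤ) - b.2 : ℤ) : ℝ) * P.2 + c) = 0 := by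
      push_cast
      rw [mul_add, ← hc', ← hx, ← hy]
      ring
    exact (mul_eq_zero.1 this).resolve_left hqR.ne'

theorem ratDen_intCast_div_le (a b d : ℤ) (hd : d ≠ 0) :
    (ratDen ((a / d : ℚ), (b / d : ℚ)) : ℝ) ≤ |(d : ℝ)| := by
  have h : ratDen ((a / d : ℚ), (b / d : ℚ)) ∣ d.natAbs :=
    Nat.lcm_dvd (Int.natCast_dvd.1 (by simpa only [Rat.divInt_eq_div] using Rat.den_dvd a d))
      (Int.natCast_dvd.1 (by simpa only [Rat.divInt_eq_div] using Rat.den_dvd b d))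
  have h2 := Nat.le_of_dvd (Int.natAbs_pos.2 hd) h
  rw [← Int.cast_abs, Int.abs_eq_natAbs, Int.cast_natCast]
  exact_mod_cast h2

theorem proportional_or_exists_mem_Delta {s t ε α β φ : ℝ} (hs : 0 < s) (ht : 0 < t)
    (hst : s + t = 1) (hε : ε ≤ 1) (hα : 1 ≤ α) (hβ : 1 ≤ β)
    (z : ℝ × ℝ) {A₁ B₁ C₁ A₂ B₂ C₂ : ℤ}
    (hA₁ : |(A₁ : ℝ)| ≤ α) (hA₂ : |(A₂ : ℝ)| ≤ α) (hB₁ : |(B₁ : ℝ)| ≤ β) (hB₂ : |(B₂ : ℝ)| ≤ β)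
    (hF₁ : |A₁ * z.1 + B₁ * z.2 + C₁| ≤ φ) (hF₂ : |A₂ * z.1 + B₂ * z.2 + C₂| ≤ φ)
    (h₁ : 4 * ((α * β) ^ s * β) * φ ≤ ε) (h₂ : 4 * ((α * β) ^ t * α) * φ ≤ ε) :
    (A₁ * B₂ = A₂ * B₁ ∧ A₁ * C₂ = A₂ * C₁ ∧ B₁ * C₂ = B₂ * C₁) ∨
      ∃ P : ℚ × ℚ, (ratDen P : ℝ) ≤ 2 * (α * β) ∧ z ∈ Delta s t ε P := by
  set F₁ := A₁ * z.1 + B₁ * z.2 + C₁ with eF₁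
  set F₂ := A₂ * z.1 + B₂ * z.2 + C₂ with eF₂
  have hφ : 0 ≤ φ := (abs_nonneg _).trans hF₁
  have hαβ : 1 ≤ α * β := one_le_mul_of_one_le_of_one_le hα hβ
  have key : ∀ {u v γ : ℝ}, |u| ≤ γ → |v| ≤ γ → |u * F₂ - v * F₁| ≤ 2 * γ * φ := by
    intro u v γ hu hv
    have hγ := (abs_nonneg _).trans hu
    calc |u * F₂ - v * F₁| ≤ |u * F₂| + |v * F₁| := abs_sub _ _
      _ = |u| * |F₂| + |v| * |F₁| := by rw [abs_mul, abs_mul]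
      _ ≤ γ * φ + γ * φ := by gcongr
      _ = _ := by ring
  have hA := key hA₁ hA₂
  have hB := key hB₁ hB₂
  by_cases hd : A₁ * B₂ - A₂ * B₁ = 0
  · left
    have hd' : (A₁ : ℝ) * B₂ - A₂ * B₁ = 0 := by exact_mod_cast hd
    have small : ∀ {m : ℤ} {γ σ : ℝ}, 0 < σ → 1 ≤ γ → 4 * ((α * β) ^ σ * γ) * φ ≤ ε →
        |(m : ℝ)| ≤ 2 * γ * φ → m = 0 := by
      intro m γ σ hσ hγ h hm
      have h1 : 1 ≤ (α * β) ^ σ := Real.one_le_rpow hαβ hσ.le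
      have h2 : 4 * (1 * γ) * φ ≤ 4 * ((α * β) ^ σ * γ) * φ := by gcongr
      have h3 : |(m : ℝ)| < 1 := by linarith
      have h4 : |m| < 1 := by exact_mod_cast h3
      exact Int.abs_lt_one_iff.1 h4
    refine ⟨by linarith, ?_, ?_⟩
    · have := small (m := A₁ * C₂ - A₂ * C₁) ht hα h₂ (by
        convert hA using 2
        push_cast
        linear_combination (-z.2) * hd')
      linarith
    · have := small (m := B₁ * C₂ - B₂ * C₁) hs hβ h₁ (by
        convert hB using 2
        push_cast
        linear_combination (z.1) * hd')
      linarith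
  · right
    set d := A₁ * B₂ - A₂ * B₁ with ed
    have hdR : (d : ℝ) ≠ 0 := by exact_mod_cast hd
    have hdabs : |(d : ℝ)| ≤ 2 * (α * β) := by
      rw [ed]; push_cast
      calc |(A₁ : ℝ) * B₂ - A₂ * B₁| ≤ |(A₁ : ℝ)| * |(B₂ : ℝ)| + |(A₂ : ℝ)| * |(B₁ : ℝ)| := by
            rw [← abs_mul, ← abs_mul]; exact abs_sub _ _
        _ ≤ α * β + α * β := by gcongr
        _ = _ := by ring
    set P : ℚ × ℚ := (((B₁ * C₂ - B₂ * C₁ : ℤ) / d : ℚ), ((A₂ * C₁ - A₁ * C₂ : ℤ) / d : ℚ)) with eP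
    have hqd : (ratDen P : ℝ) ≤ |(d : ℝ)| := ratDen_intCast_div_le _ _ d hd
    have hq0 : (0 : ℝ) < ratDen P := by
      exact_mod_cast ratDen_pos P
    have abs_le_div : ∀ {w γ σ : ℝ}, 0 < σ → σ ≤ 1 → 1 ≤ γ → 4 * ((α * β) ^ σ * γ) * φ ≤ ε →
        |d * w| ≤ 2 * γ * φ → |w| ≤ ε / (ratDen P : ℝ) ^ (1 + σ) := by
      intro w γ σ hσ hσ1 hγ h hw
      rw [le_div_iff₀ (by positivity), Real.rpow_add hq0, Real.rpow_one]
      have h2 : (2 : ℝ) ^ σ ≤ 2 := by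
        calc (2 : ℝ) ^ σ ≤ 2 ^ (1 : ℝ) := Real.rpow_le_rpow_of_exponent_le (by norm_num) hσ1
          _ = 2 := Real.rpow_one _
      calc |w| * (ratDen P * (ratDen P : ℝ) ^ σ) ≤ |w| * (|(d : ℝ)| * (2 * (α * β)) ^ σ) := by
            gcongr; exact hqd.trans hdabs
        _ = |d * w| * (2 ^ σ * (α * β) ^ σ) := by
            rw [Real.mul_rpow (by norm_num) (by positivity), abs_mul]; ring
        _ ≤ (2 * γ * φ) * (2 * (α * β) ^ σ) := by gcongr
        _ = 4 * ((α * β) ^ σ * γ) * φ := by ring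
        _ ≤ ε := h
    refine ⟨P, hqd.trans hdabs, abs_le_div hs (by linarith) hβ h₁ ?_, abs_le_div ht (by linarith) hα h₂ ?_⟩
    · rw [← abs_neg]
      convert hB using 2
      simp only [eP]; push_cast
      rw [mul_sub, mul_div_cancel₀ _ hdR, ed]
      push_cast; ring
    · convert hA using 2
      simp only [eP]; push_cast
      rw [mul_sub, mul_div_cancel₀ _ hdR, ed]
      push_cast; ring

theorem rpow_mul_le_of_decay {s t R G Q α β : ℝ} (hs : 0 < s) (ht : 0 < t) (hst : s + t = 1)
    (hR : 1 < R) (hG : 1 ≤ G) (hGt : R ^ 2 ≤ G ^ t) (hQ : 0 < Q) (k : ℕ) (hα : 1 ≤ α) (hβ : 1 ≤ β)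
    (hα' : α ≤ (G * Q) ^ s) (hβ' : β ≤ R * G / G ^ k * Q ^ t) :
    (α * β) ^ s * β ≤ R ^ 2 * G ^ 4 * Q / R ^ (2 * k) ∧
      (α * β) ^ t * α ≤ R ^ 2 * G ^ 4 * Q / R ^ (2 * k) := by
  have hG0 : 0 < G := by linarith
  have hR0 : 0 < R := by linarith
  have hRG : 1 ≤ R * G := one_le_mul_of_one_le_of_one_le hR.le hG
  set D := R * G / G ^ k with hD
  have hD0 : 0 < D := by positivity
  rw [Real.mul_rpow hG0.le hQ.le] at hα'
  have hQst : Q ^ s * Q ^ t = Q := by rw [← Real.rpow_add hQ, hst, Real.rpow_one]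
  have hpow : ∀ {x σ : ℝ} {N : ℕ}, 1 ≤ x → σ ≤ N → x ^ σ ≤ x ^ N := by
    intro x σ N hx hσ
    rw [← Real.rpow_natCast]; exact Real.rpow_le_rpow_of_exponent_le hx hσ
  have hDσ : ∀ {σ : ℝ}, t ≤ σ → σ ≤ 2 → D ^ σ ≤ (R * G) ^ 2 / R ^ (2 * k) := by
    intro σ h1 h2
    rw [hD, Real.div_rpow (by positivity) (by positivity)]
    gcongr
    · exact hpow hRG (by exact_mod_cast h2)
    · calc R ^ (2 * k) = (R ^ 2) ^ k := by rw [pow_mul]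
        _ ≤ (G ^ t) ^ k := by gcongr
        _ ≤ (G ^ σ) ^ k := by gcongr
        _ = (G ^ k) ^ σ := by
          rw [← Real.rpow_natCast, ← Real.rpow_natCast, ← Real.rpow_mul hG0.le,
            ← Real.rpow_mul hG0.le, mul_comm]
  have hαβ : α * β ≤ G ^ s * D * Q := by
    calc α * β ≤ (G ^ s * Q ^ s) * (D * Q ^ t) := by gcongr
      _ = G ^ s * D * (Q ^ s * Q ^ t) := by ring
      _ = _ := by rw [hQst]
  constructor
  · calc (α * β) ^ s * β ≤ (G ^ s * D * Q) ^ s * (D * Q ^ t) := by gcongr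
      _ = (G ^ s) ^ s * D ^ (1 + s) * (Q ^ s * Q ^ t) := by
        rw [Real.mul_rpow (by positivity) hQ.le, Real.mul_rpow (by positivity) hD0.le,
          Real.rpow_add hD0, Real.rpow_one]; ring
      _ = G ^ (s * s) * D ^ (1 + s) * Q := by rw [hQst, Real.rpow_mul hG0.le]
      _ ≤ G ^ 2 * ((R * G) ^ 2 / R ^ (2 * k)) * Q := by
        gcongr
        · exact hpow hG (by push_cast; nlinarith)
        · exact hDσ (by linarith) (by linarith)
      _ = _ := by ring
  · calc (α * β) ^ t * α ≤ (G ^ s * D * Q) ^ t * (G ^ s * Q ^ s) := by gcongr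
      _ = ((G ^ s) ^ t * G ^ s) * D ^ t * (Q ^ s * Q ^ t) := by
        rw [Real.mul_rpow (by positivity) hQ.le, Real.mul_rpow (by positivity) hD0.le]; ring
      _ = G ^ (s * t + s) * D ^ t * Q := by rw [hQst, ← Real.rpow_mul hG0.le, ← Real.rpow_add hG0]
      _ ≤ G ^ 2 * ((R * G) ^ 2 / R ^ (2 * k)) * Q := by
        gcongr
        · exact hpow hG (by push_cast; nlinarith)
        · exact hDσ le_rfl (by linarith)
      _ = _ := by ring

theorem exists_line_of_point {A B C : ℝ} (hAB : A ≠ 0 ∨ B ≠ 0) {p : ℝ × ℝ}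
    (hp : A * p.1 + B * p.2 + C = 0) :
    ∃ L : AffineSubspace ℝ (ℝ × ℝ), IsLine L ∧ ∀ (γ : ℝ) (w : ℝ × ℝ),
      |A * w.1 + B * w.2 + C| ≤ γ * max |A| |B| → w ∈ lineNbhd L γ := by
  have hv : ((-B, A) : ℝ × ℝ) ≠ 0 := by
    intro h; rw [Prod.mk_eq_zero, neg_eq_zero] at h; tauto
  refine ⟨AffineSubspace.mk' p (ℝ ∙ ((-B, A) : ℝ × ℝ)), ⟨⟨p, AffineSubspace.self_mem_mk' _ _⟩, ?_⟩, ?_⟩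
  · rw [AffineSubspace.direction_mk']
    exact finrank_span_singleton hv
  · intro γ w hw
    have hmem : ∀ x : ℝ × ℝ, A * x.1 + B * x.2 + C = 0 →
        x ∈ AffineSubspace.mk' p (ℝ ∙ ((-B, A) : ℝ × ℝ)) := by
      intro x hx
      rw [AffineSubspace.mem_mk', Submodule.mem_span_singleton]
      rcases hAB with h | h
      · exact ⟨(x.2 - p.2) / A, Prod.ext (by simp; field_simp; linarith) (by simp; field_simp)⟩
      · exact ⟨-(x.1 - p.1) / B, Prod.ext (by simp; field_simp; ring) (by simp; field_simp; linarith)⟩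
    have near : ∀ x : ℝ × ℝ, A * x.1 + B * x.2 + C = 0 → dist w x ≤ γ → w ∈ lineNbhd _ γ :=
      fun x hx hd => (infDist_le_dist_of_mem (hmem x hx)).trans hd
    have hγ : ∀ c f : ℝ, c ≠ 0 → |f| ≤ γ * |c| → |f / c| ≤ γ := by
      intro c f hc h
      rwa [abs_div, div_le_iff₀ (abs_pos.2 hc)]
    rcases le_total |A| |B| with h | h
    · rw [max_eq_right h] at hw
      have hB : B ≠ 0 := by
        rintro rfl
        rcases hAB with h' | h'
        · simp at h; exact h' h
        · exact h' rfl
      have hg := hγ B _ hB hw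
      refine near (w.1, w.2 - (A * w.1 + B * w.2 + C) / B) (by dsimp only; field_simp; ring) ?_
      rw [Prod.dist_eq, Real.dist_eq, Real.dist_eq]
      simpa [(abs_nonneg _).trans hg] using hg
    · rw [max_eq_left h] at hw
      have hA : A ≠ 0 := by
        rintro rfl
        rcases hAB with h' | h'
        · exact h' rfl
        · simp at h; exact h' h
      have hg := hγ A _ hA hw
      refine near (w.1 - (A * w.1 + B * w.2 + C) / A, w.2) (by dsimp only; field_simp; ring) ?_
      rw [Prod.dist_eq, Real.dist_eq, Real.dist_eq]
      simpa [(abs_nonneg _).trans hg] using hg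

/-- The integer line `A x + B y + C = 0` passes through `P`, has coefficients bounded by
`ratDen P ^ s` and `ratDen P ^ t`, and `i = (δ, n, k)` records the size of the height
`ratDen P * max |A| |B|` (through `n`) and the size of `ratDen P` relative to it (through `k`);
`δ` tells which of `s` and `t` governs the latter comparison. -/
structure HasIndex (s t R G h : ℝ) (P : ℚ × ℚ) (A B C : ℤ) (i : Fin 2 × ℕ × ℕ) : Prop where
  ne_zero : A ≠ 0 ∨ B ≠ 0
  eq_zero : (A : ℝ) * P.1 + B * P.2 + C = 0
  abs_A_le : |(A : ℝ)| ≤ (ratDen P : ℝ) ^ s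
  abs_B_le : |(B : ℝ)| ≤ (ratDen P : ℝ) ^ t
  le_height : h * R ^ i.2.1 ≤ ratDen P * max |(A : ℝ)| |(B : ℝ)|
  height_lt : ratDen P * max |(A : ℝ)| |(B : ℝ)| < h * R ^ (i.2.1 + 1)
  one_le : 1 ≤ i.2.2
  le_level : i.2.2 ≤ i.2.1
  le_den : h * R ^ i.2.1 * G ^ (i.2.2 - 1) ≤ (ratDen P : ℝ) ^ (1 + if i.1 = 0 then t else s)
  den_lt : (ratDen P : ℝ) ^ (1 + if i.1 = 0 then t else s) < h * R ^ i.2.1 * G ^ i.2.2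

theorem one_le_max_abs_intCast {A B : ℤ} (h : A ≠ 0 ∨ B ≠ 0) :
    1 ≤ max |(A : ℝ)| |(B : ℝ)| := by
  rcases h with h | h
  · exact le_max_of_le_left (by exact_mod_cast Int.one_le_abs h)
  · exact le_max_of_le_right (by exact_mod_cast Int.one_le_abs h)

theorem exists_hasIndex {s t R G h : ℝ} (hs : 0 < s) (ht : 0 < t) (hst : s + t = 1) (hR : 1 < R)
    (hG : R ^ 2 ≤ G) (hh : 0 < h) (hhR : h * R ≤ 1) (P : ℚ × ℚ) :
    ∃ (i : Fin 2 × ℕ × ℕ) (A B C : ℤ), HasIndex s t R G h P A B C i := by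
  obtain ⟨A, B, C, hne, heq, hA, hB⟩ := exists_line_coeffs hst P
  have hq1 : (1 : ℝ) ≤ ratDen P := by exact_mod_cast ratDen_pos P
  set q : ℝ := (ratDen P : ℝ)
  have hM1 := one_le_max_abs_intCast hne
  have hR0 : 0 < R := by linarith
  have hG1 : 1 < G := by nlinarith
  have hδ : ∃ δ : Fin 2, max |(A : ℝ)| |(B : ℝ)| ≤ q ^ (if δ = 0 then t else s) := by
    rcases le_total |(A : ℝ)| |(B : ℝ)| with hAB | hAB
    · exact ⟨0, by simpa [max_eq_right hAB] using hB⟩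
    · exact ⟨1, by simpa [max_eq_left hAB] using hA⟩
  obtain ⟨δ, hδ⟩ := hδ
  set τ := if δ = 0 then t else s with hτ
  have hτ0 : 0 < τ := by rw [hτ]; split_ifs <;> assumption
  have hτ1 : τ ≤ 1 := by rw [hτ]; split_ifs <;> linarith
  set M := max |(A : ℝ)| |(B : ℝ)|
  have hqM : 1 ≤ q * M := one_le_mul_of_one_le_of_one_le hq1 hM1
  obtain ⟨n, hn, hn'⟩ := exists_nat_pow_near (x := q * M / (h * R)) (y := R)
    (by rw [one_le_div (by positivity)]; linarith) hR
  rw [le_div_iff₀ (by positivity)] at hn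
  rw [div_lt_iff₀ (by positivity)] at hn'
  have hqpow : q ^ (1 + τ) = q * q ^ τ := by rw [Real.rpow_add (by linarith), Real.rpow_one]
  have hle : h * R ^ (n + 1) ≤ q ^ (1 + τ) := by
    calc h * R ^ (n + 1) = R ^ n * (h * R) := by ring
      _ ≤ q * M := hn
      _ ≤ q ^ (1 + τ) := by rw [hqpow]; gcongr
  obtain ⟨k, hk, hk'⟩ := exists_nat_pow_near (x := q ^ (1 + τ) / (h * R ^ (n + 1))) (y := G)
    (by rwa [one_le_div (by positivity)]) hG1
  rw [le_div_iff₀ (by positivity)] at hk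
  rw [div_lt_iff₀ (by positivity)] at hk'
  have hkn : k ≤ n := by
    have hqn : q ≤ R ^ (n + 1) := by
      calc q ≤ q * M := le_mul_of_one_le_right (by linarith) hM1
        _ ≤ R ^ (n + 1) * (h * R) := hn'.le
        _ ≤ R ^ (n + 1) := mul_le_of_le_one_right (by positivity) hhR
    have h1 : q ^ (1 + τ) < h * R ^ (n + 1) * R ^ (2 * (n + 1)) := by
      have h2 : q ^ τ ≤ R ^ (n + 1) := by
        calc q ^ τ ≤ q ^ (1 : ℝ) := Real.rpow_le_rpow_of_exponent_le hq1 hτ1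
          _ = q := Real.rpow_one _
          _ ≤ _ := hqn
      have h3 : q < R ^ (n + 1) * (h * R) := lt_of_le_of_lt
        (le_mul_of_one_le_right (by linarith) hM1) hn'
      calc q ^ (1 + τ) = q * q ^ τ := hqpow
        _ < R ^ (n + 1) * (h * R) * R ^ (n + 1) :=
          mul_lt_mul h3 h2 (Real.rpow_pos_of_pos (by linarith) _) (by positivity)
        _ = h * R ^ (n + 1) * R ^ (n + 2) := by ring
        _ ≤ _ := by gcongr <;> first | exact hR.le | lia
    have h4 : R ^ (2 * k) * (h * R ^ (n + 1)) < R ^ (2 * (n + 1)) * (h * R ^ (n + 1)) := by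
      calc R ^ (2 * k) * (h * R ^ (n + 1)) = (R ^ 2) ^ k * (h * R ^ (n + 1)) := by rw [pow_mul]
        _ ≤ G ^ k * (h * R ^ (n + 1)) := by gcongr
        _ ≤ _ := hk
        _ < _ := by linarith
    have h5 := (pow_lt_pow_iff_right₀ hR).1 (lt_of_mul_lt_mul_right h4 (by positivity))
    lia
  refine ⟨(δ, n + 1, k + 1), A, B, C, hne, heq, hA, hB, ?_, ?_, by simp, by simpa using hkn, ?_, ?_⟩
  · dsimp only
    calc h * R ^ (n + 1) = R ^ n * (h * R) := by ring
      _ ≤ q * M := hn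
  · dsimp only
    calc q * M < R ^ (n + 1) * (h * R) := hn'
      _ = _ := by ring
  · dsimp only
    rw [Nat.add_sub_cancel]; linarith
  · dsimp only
    linarith

theorem HasIndex.abs_le_of_mem_Delta {s t R G h ε : ℝ} {P : ℚ × ℚ} {A B C : ℤ}
    {i : Fin 2 × ℕ × ℕ} (H : HasIndex s t R G h P A B C i) {w : ℝ × ℝ} (hw : w ∈ Delta s t ε P) :
    |A * w.1 + B * w.2 + C| ≤ 2 * ε / ratDen P := by
  have hq : (0 : ℝ) < ratDen P := by exact_mod_cast ratDen_pos P
  have bound : ∀ {a x σ : ℝ}, |a| ≤ (ratDen P : ℝ) ^ σ → |x| ≤ ε / (ratDen P : ℝ) ^ (1 + σ) →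
      |a * x| ≤ ε / ratDen P := by
    intro a x σ ha hx
    calc |a * x| = |a| * |x| := abs_mul _ _
      _ ≤ (ratDen P : ℝ) ^ σ * (ε / (ratDen P : ℝ) ^ (1 + σ)) := by gcongr
      _ = ε / ratDen P := by rw [Real.rpow_add hq, Real.rpow_one]; field_simp
  have e : A * w.1 + B * w.2 + C = A * (w.1 - P.1) + B * (w.2 - P.2) := by
    linear_combination H.eq_zero
  rw [e]
  calc _ ≤ |A * (w.1 - P.1)| + |B * (w.2 - P.2)| := abs_add_le _ _
    _ ≤ ε / ratDen P + ε / ratDen P := add_le_add (bound H.abs_A_le hw.1) (bound H.abs_B_le hw.2)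
    _ = _ := by ring

theorem rpow_inv_le_ratDen_lt {R G h τ x : ℝ} {n k : ℕ} (hh : 0 < h) (hR : 1 < R) (hG : 1 ≤ G)
    (hτ : 0 < τ) (hk : 1 ≤ k) (hx : 0 < x) (h1 : h * R ^ n * G ^ (k - 1) ≤ x ^ (1 + τ))
    (h2 : x ^ (1 + τ) < h * R ^ n * G ^ k) :
    (h * R ^ n * G ^ (k - 1)) ^ (1 + τ)⁻¹ ≤ x ∧
      x < G * (h * R ^ n * G ^ (k - 1)) ^ (1 + τ)⁻¹ := by
  have hR0 : 0 < R := by linarith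
  have hG0 : 0 < G := by linarith
  have h0 : 0 < h * R ^ n * G ^ (k - 1) := by positivity
  constructor
  · rwa [Real.rpow_inv_le_iff_of_pos h0.le hx.le (by linarith)]
  · rw [← Real.rpow_lt_rpow_iff hx.le (by positivity) (by linarith : 0 < 1 + τ),
      Real.mul_rpow hG0.le (by positivity), Real.rpow_inv_rpow h0.le (by linarith)]
    calc x ^ (1 + τ) < h * R ^ n * G ^ k := h2
      _ = G ^ (1 : ℝ) * (h * R ^ n * G ^ (k - 1)) := by
        obtain ⟨k, rfl⟩ := Nat.exists_eq_add_of_le' hk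
        rw [Real.rpow_one, Nat.add_sub_cancel]; ring
      _ ≤ _ := by gcongr; linarith

theorem proportional_of_common_points {P₁ P₂ : ℚ × ℚ} (hP : P₁ ≠ P₂) {A₁ B₁ C₁ A₂ B₂ C₂ : ℤ}
    (h₁₁ : (A₁ : ℝ) * P₁.1 + B₁ * P₁.2 + C₁ = 0) (h₁₂ : (A₁ : ℝ) * P₂.1 + B₁ * P₂.2 + C₁ = 0)
    (h₂₁ : (A₂ : ℝ) * P₁.1 + B₂ * P₁.2 + C₂ = 0) (h₂₂ : (A₂ : ℝ) * P₂.1 + B₂ * P₂.2 + C₂ = 0) :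
    A₁ * B₂ = A₂ * B₁ ∧ A₁ * C₂ = A₂ * C₁ ∧ B₁ * C₂ = B₂ * C₁ := by
  have hx : ((A₁ : ℝ) * B₂ - A₂ * B₁) * (P₁.1 - P₂.1) = 0 := by
    linear_combination B₂ * (h₁₁ - h₁₂) - B₁ * (h₂₁ - h₂₂)
  have hy : ((A₁ : ℝ) * B₂ - A₂ * B₁) * (P₁.2 - P₂.2) = 0 := by
    linear_combination A₁ * (h₂₁ - h₂₂) - A₂ * (h₁₁ - h₁₂)
  have hd : (A₁ : ℝ) * B₂ - A₂ * B₁ = 0 := by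
    by_contra hne
    have h1 := sub_eq_zero.1 ((mul_eq_zero.1 hx).resolve_left hne)
    have h2 := sub_eq_zero.1 ((mul_eq_zero.1 hy).resolve_left hne)
    exact hP (Prod.ext (by exact_mod_cast h1) (by exact_mod_cast h2))
  have hAC : (A₁ : ℝ) * C₂ = A₂ * C₁ := by
    linear_combination A₁ * h₂₁ - A₂ * h₁₁ - P₁.2 * hd
  have hBC : (B₁ : ℝ) * C₂ = B₂ * C₁ := by
    linear_combination B₁ * h₂₁ - B₂ * h₁₁ + P₁.1 * hd
  exact ⟨by exact_mod_cast sub_eq_zero.1 hd, by exact_mod_cast hAC, by exact_mod_cast hBC⟩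

theorem level_bound_eq {R G h Q : ℝ} (hR : 0 < R) (hQ : 0 < Q) {n k : ℕ} (hkn : k ≤ n) :
    4 * (h * R ^ (n + 1) / Q * (R ^ 2 * G ^ 4 * Q / R ^ (2 * k))) =
      4 * (R ^ 2 * G ^ 4) / R ^ k * (h * R ^ (n - k + 1)) := by
  obtain ⟨m, rfl⟩ := Nat.exists_eq_add_of_le hkn
  rw [Nat.add_sub_cancel_left]
  field_simp
  ring

theorem HasIndex.proportional_or_exists {s t R G h ε ρ : ℝ} (hs : 0 < s) (ht : 0 < t)
    (hst : s + t = 1) (hR : 1 < R) (hGs : R ^ 2 ≤ G ^ s) (hGt : R ^ 2 ≤ G ^ t) (hG : 1 ≤ G)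
    (hh : 0 < h) (hε : 0 < ε) (hε' : 512 * R ^ 4 * G ^ 5 * ε < 1) {δ : Fin 2} {n k : ℕ}
    (hρ : h * R ^ (n + 1) * ρ ≤ 3 * ε * R ^ (k + 1)) {z : ℝ × ℝ}
    {P₁ P₂ : ℚ × ℚ} (hP : P₁ ≠ P₂) {A₁ B₁ C₁ A₂ B₂ C₂ : ℤ}
    (H₁ : HasIndex s t R G h P₁ A₁ B₁ C₁ (δ, n, k))
    (H₂ : HasIndex s t R G h P₂ A₂ B₂ C₂ (δ, n, k))
    (hz₁ : (Delta s t ε P₁ ∩ closedBall z ρ).Nonempty)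
    (hz₂ : (Delta s t ε P₂ ∩ closedBall z ρ).Nonempty) :
    (A₁ * B₂ = A₂ * B₁ ∧ A₁ * C₂ = A₂ * C₁ ∧ B₁ * C₂ = B₂ * C₁) ∨
      ∃ P : ℚ × ℚ, (ratDen P : ℝ) ^ (1 + s) < h * R ^ (n - k + 1) ∧
        (ratDen P : ℝ) ^ (1 + t) < h * R ^ (n - k + 1) ∧ z ∈ Delta s t ε P := by
  have hR0 : 0 < R := by linarith
  have hG0 : 0 < G := by linarith
  have hs1 : s ≤ 1 := by linarith
  have ht1 : t ≤ 1 := by linarith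
  have hk1 : 1 ≤ k := H₁.one_le
  have hkn : k ≤ n := H₁.le_level
  have hq₁ : (0 : ℝ) < ratDen P₁ := by exact_mod_cast ratDen_pos P₁
  have hq₂ : (0 : ℝ) < ratDen P₂ := by exact_mod_cast ratDen_pos P₂
  set τ := if δ = 0 then t else s with hτ
  have hτ0 : 0 < τ := by rw [hτ]; split_ifs <;> assumption
  have hρ0 : 0 ≤ ρ := by
    obtain ⟨w, -, hw⟩ := hz₁
    exact dist_nonneg.trans hw
  have hQ₁ := rpow_inv_le_ratDen_lt hh hR hG hτ0 hk1 hq₁ H₁.le_den H₁.den_lt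
  have hQ₂ := rpow_inv_le_ratDen_lt hh hR hG hτ0 hk1 hq₂ H₂.le_den H₂.den_lt
  set Q := (h * R ^ n * G ^ (k - 1)) ^ (1 + τ)⁻¹ with hQdef
  have hQ : 0 < Q := by positivity
  have hQpow : Q * Q ^ τ = h * R ^ n * G ^ (k - 1) := by
    have := Real.rpow_inv_rpow (show 0 ≤ h * R ^ n * G ^ (k - 1) by positivity)
      (show 1 + τ ≠ 0 by linarith)
    rwa [← hQdef, Real.rpow_add hQ, Real.rpow_one] at this
  set N := h * R ^ (n + 1) / Q with hN
  have hN0 : 0 < N := by positivity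
  have hNQ : N = R * G / G ^ k * Q ^ τ := by
    rw [hN, div_eq_iff hQ.ne']
    calc h * R ^ (n + 1) = R * G / G ^ k * (h * R ^ n * G ^ (k - 1)) := by
          obtain ⟨k, rfl⟩ := Nat.exists_eq_add_of_le' hk1
          rw [Nat.add_sub_cancel]; field_simp; ring
      _ = _ := by rw [← hQpow]; ring
  have hMN : ∀ {P : ℚ × ℚ} {A B C : ℤ}, HasIndex s t R G h P A B C (δ, n, k) → Q ≤ ratDen P →
      max |(A : ℝ)| |(B : ℝ)| ≤ N := by
    intro P A B C H hQP
    rw [hN, le_div_iff₀ hQ]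
    calc _ ≤ max |(A : ℝ)| |(B : ℝ)| * ratDen P := by gcongr
      _ = ratDen P * max |(A : ℝ)| |(B : ℝ)| := mul_comm _ _
      _ ≤ _ := H.height_lt.le
  have hM₁ := hMN H₁ hQ₁.1
  have hM₂ := hMN H₂ hQ₂.1
  have hN1 : 1 ≤ N := (one_le_max_abs_intCast H₁.ne_zero).trans hM₁
  have hNρ : N * ρ ≤ 3 * ε * R ^ (k + 1) / Q := by
    rw [hN, div_mul_eq_mul_div]; gcongr
  have hRk : 1 ≤ R ^ (k + 1) := one_le_pow₀ hR.le
  set φ := 8 * ε * R ^ (k + 1) / Q with hφ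
  have hF : ∀ {P : ℚ × ℚ} {A B C : ℤ}, HasIndex s t R G h P A B C (δ, n, k) → Q ≤ ratDen P →
      (Delta s t ε P ∩ closedBall z ρ).Nonempty → |A * z.1 + B * z.2 + C| ≤ φ := by
    rintro P A B C H hQP ⟨w, hw, hwz⟩
    have hM := hMN H hQP
    rw [mem_closedBall, Prod.dist_eq, max_le_iff, Real.dist_eq, Real.dist_eq] at hwz
    have e : A * z.1 + B * z.2 + C =
        (A * w.1 + B * w.2 + C) - A * (w.1 - z.1) - B * (w.2 - z.2) := by ring
    rw [e]
    calc _ ≤ |A * w.1 + B * w.2 + C| + |A * (w.1 - z.1)| + |B * (w.2 - z.2)| :=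
          (abs_sub _ _).trans (add_le_add_left (abs_sub _ _) _)
      _ ≤ 2 * ε / Q + N * ρ + N * ρ := by
        rw [abs_mul, abs_mul]
        gcongr
        · exact (H.abs_le_of_mem_Delta hw).trans (by gcongr)
        · exact (le_max_left _ _).trans hM
        · exact hwz.1
        · exact (le_max_right _ _).trans hM
        · exact hwz.2
      _ ≤ 2 * ε * R ^ (k + 1) / Q + 3 * ε * R ^ (k + 1) / Q + 3 * ε * R ^ (k + 1) / Q := by
        refine add_le_add (add_le_add (div_le_div_of_nonneg_right ?_ hQ.le) hNρ) hNρ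
        exact le_mul_of_one_le_right (show 0 ≤ 2 * ε by positivity) hRk
      _ = φ := by rw [hφ]; ring
  rcases lt_or_ge (R ^ k) (32 * R ^ 3 * G ^ 4) with hsmall | hlarge
  · left
    have cross : ∀ {P P' : ℚ × ℚ} {A B C A' B' C' : ℤ},
        HasIndex s t R G h P A B C (δ, n, k) → HasIndex s t R G h P' A' B' C' (δ, n, k) →
        Q ≤ ratDen P → ratDen P < G * Q → Q ≤ ratDen P' → ratDen P' < G * Q →
        (Delta s t ε P ∩ closedBall z ρ).Nonempty → (Delta s t ε P' ∩ closedBall z ρ).Nonempty →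
        (A' : ℝ) * P.1 + B' * P.2 + C' = 0 := by
      intro P P' A B C A' B' C' H H' hQP hPQ hQP' hPQ' hP hP'
      have hF' := hF H' hQP' hP'
      have hM' := hMN H' hQP'
      obtain ⟨w, hw, hwz⟩ := hP
      rw [mem_closedBall, Prod.dist_eq, max_le_iff, Real.dist_eq, Real.dist_eq] at hwz
      have hq : (0 : ℝ) < ratDen P := hQ.trans_le hQP
      set q : ℝ := (ratDen P : ℝ)
      have diff_le : ∀ {a x y c σ : ℝ}, 0 < σ → σ ≤ 1 → |a| ≤ (ratDen P' : ℝ) ^ σ → |a| ≤ N →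
          |x - c| ≤ ε / q ^ (1 + σ) → |x - y| ≤ ρ →
          |a * (c - y)| ≤ G * ε / q + 3 * ε * R ^ (k + 1) / Q := by
        intro a x y c σ hσ hσ1 ha haN hxc hxy
        have h1 : |a| * |x - c| ≤ G * ε / q := by
          calc |a| * |x - c| ≤ (G * q) ^ σ * (ε / q ^ (1 + σ)) := by
                gcongr
                refine ha.trans ?_
                gcongr
                exact hPQ'.le.trans (by gcongr)
            _ = G ^ σ * ε / q := by
              rw [Real.mul_rpow hG0.le hq.le, Real.rpow_add hq, Real.rpow_one]; field_simp
            _ ≤ G ^ (1 : ℝ) * ε / q := by gcongr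
            _ = _ := by rw [Real.rpow_one]
        have h2 : |a| * |x - y| ≤ 3 * ε * R ^ (k + 1) / Q :=
          (mul_le_mul haN hxy (abs_nonneg _) hN0.le).trans hNρ
        calc |a * (c - y)| = |a * (x - y) - a * (x - c)| := by ring_nf
          _ ≤ |a * (x - y)| + |a * (x - c)| := abs_sub _ _
          _ ≤ _ := by rw [abs_mul, abs_mul]; linarith
      have hx := diff_le hs hs1 H'.abs_A_le ((le_max_left _ _).trans hM') hw.1 hwz.1
      have hy := diff_le ht ht1 H'.abs_B_le ((le_max_right _ _).trans hM') hw.2 hwz.2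
      have hv : |(A' : ℝ) * P.1 + B' * P.2 + C'| ≤
          14 * ε * R ^ (k + 1) / Q + 2 * G * ε / q := by
        calc |(A' : ℝ) * P.1 + B' * P.2 + C'| = |(A' * z.1 + B' * z.2 + C') +
              A' * (P.1 - z.1) + B' * (P.2 - z.2)| := by ring_nf
          _ ≤ φ + (G * ε / q + 3 * ε * R ^ (k + 1) / Q) +
              (G * ε / q + 3 * ε * R ^ (k + 1) / Q) := by
            refine (abs_add_le _ _).trans (add_le_add ((abs_add_le _ _).trans ?_) hy)
            exact add_le_add hF' hx
          _ = _ := by rw [hφ]; ring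
      have hqv : |q * ((A' : ℝ) * P.1 + B' * P.2 + C')| < 1 := by
        rw [abs_mul, abs_of_pos hq]
        calc q * |(A' : ℝ) * P.1 + B' * P.2 + C'|
            ≤ q * (14 * ε * R ^ (k + 1) / Q + 2 * G * ε / q) := by gcongr
          _ = 14 * ε * R ^ (k + 1) * (q / Q) + 2 * G * ε := by field_simp
          _ ≤ 14 * ε * R ^ (k + 1) * G + 2 * G * ε * R ^ (k + 1) := by
            refine add_le_add (mul_le_mul_of_nonneg_left ?_ (by positivity))
              (le_mul_of_one_le_right (by positivity) hRk)
            rw [div_le_iff₀ hQ]; exact hPQ.le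
          _ = 16 * ε * R * G * R ^ k := by ring
          _ ≤ 16 * ε * R * G * (32 * R ^ 3 * G ^ 4) := by gcongr
          _ = 512 * R ^ 4 * G ^ 5 * ε := by ring
          _ < 1 := hε'
      obtain ⟨p, r, hp, hr⟩ := exists_ratDen_mul_eq_intCast P
      have h_int : q * ((A' : ℝ) * P.1 + B' * P.2 + C') =
          ((A' * p + B' * r + C' * ratDen P : ℤ) : ℝ) := by
        push_cast
        rw [← hp, ← hr]; ring
      rw [h_int] at hqv
      have h0 := Int.abs_lt_one_iff.1 (by exact_mod_cast hqv)
      rw [h0, Int.cast_zero, mul_eq_zero] at h_int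
      exact h_int.resolve_left hq.ne'
    have e₁ := H₁.eq_zero
    have e₂ := H₂.eq_zero
    have e₁₂ := cross H₁ H₂ hQ₁.1 hQ₁.2 hQ₂.1 hQ₂.2 hz₁ hz₂
    have e₂₁ := cross H₂ H₁ hQ₂.1 hQ₂.2 hQ₁.1 hQ₁.2 hz₂ hz₁
    exact proportional_of_common_points hP e₁ e₂₁ e₁₂ e₂
  · have hRk0 : 0 < R ^ k := by positivity
    set α := max 1 (max |(A₁ : ℝ)| |(A₂ : ℝ)|) with hα
    set β := max 1 (max |(B₁ : ℝ)| |(B₂ : ℝ)|) with hβ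
    have hα1 : 1 ≤ α := le_max_left _ _
    have hβ1 : 1 ≤ β := le_max_left _ _
    have hαN : α ≤ N := max_le hN1 (max_le ((le_max_left _ _).trans hM₁) ((le_max_left _ _).trans hM₂))
    have hβN : β ≤ N :=
      max_le hN1 (max_le ((le_max_right _ _).trans hM₁) ((le_max_right _ _).trans hM₂))
    have hGQ : 1 ≤ G * Q := by
      have : (1 : ℝ) ≤ ratDen P₁ := by exact_mod_cast ratDen_pos P₁
      exact this.trans hQ₁.2.le
    have hαs : α ≤ (G * Q) ^ s := max_le (Real.one_le_rpow hGQ hs.le)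
      (max_le (H₁.abs_A_le.trans (by gcongr; exact hQ₁.2.le))
        (H₂.abs_A_le.trans (by gcongr; exact hQ₂.2.le)))
    have hβt : β ≤ (G * Q) ^ t := max_le (Real.one_le_rpow hGQ ht.le)
      (max_le (H₁.abs_B_le.trans (by gcongr; exact hQ₁.2.le))
        (H₂.abs_B_le.trans (by gcongr; exact hQ₂.2.le)))
    have hdecay : (α * β) ^ s * β ≤ R ^ 2 * G ^ 4 * Q / R ^ (2 * k) ∧
        (α * β) ^ t * α ≤ R ^ 2 * G ^ 4 * Q / R ^ (2 * k) := by
      by_cases hδ : δ = 0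
      · rw [if_pos hδ] at hτ
        exact rpow_mul_le_of_decay hs ht hst hR hG hGt hQ k hα1 hβ1 hαs
          (by rw [hNQ, hτ] at hβN; exact hβN)
      · rw [if_neg hδ] at hτ
        rw [mul_comm α β]
        exact (rpow_mul_le_of_decay ht hs (by linarith) hR hG hGs hQ k hβ1 hα1 hβt
          (by rw [hNQ, hτ] at hαN; exact hαN)).symm
    have hcond : ∀ {x : ℝ}, x ≤ R ^ 2 * G ^ 4 * Q / R ^ (2 * k) → 4 * x * φ ≤ ε := by
      intro x hx
      calc 4 * x * φ ≤ 4 * (R ^ 2 * G ^ 4 * Q / R ^ (2 * k)) * φ := by gcongr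
        _ = 32 * R ^ 3 * G ^ 4 / R ^ k * ε := by
          rw [hφ, two_mul, pow_add, pow_add]; field_simp; ring
        _ ≤ 1 * ε := by gcongr; rwa [div_le_one hRk0]
        _ = ε := one_mul _
    have hε1 : ε ≤ 1 := by
      have h1 : 1 ≤ R ^ 4 * G ^ 5 :=
        one_le_mul_of_one_le_of_one_le (one_le_pow₀ hR.le) (one_le_pow₀ hG)
      nlinarith
    refine (proportional_or_exists_mem_Delta hs ht hst hε1 hα1 hβ1 z
      ((le_max_left _ _).trans (le_max_right _ _)) ((le_max_right _ _).trans (le_max_right _ _))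
      ((le_max_left _ _).trans (le_max_right _ _)) ((le_max_right _ _).trans (le_max_right _ _))
      (hF H₁ hQ₁.1 hz₁) (hF H₂ hQ₂.1 hz₂) (hcond hdecay.1) (hcond hdecay.2)).imp id ?_
    rintro ⟨P, hP, hzP⟩
    have hαβ : 0 < α * β := by positivity
    have hlev : ∀ {σ γ γ' : ℝ}, 0 < σ → σ ≤ 1 → 0 ≤ γ → γ ≤ N → γ * γ' = α * β →
        (α * β) ^ σ * γ' ≤ R ^ 2 * G ^ 4 * Q / R ^ (2 * k) →
        (ratDen P : ℝ) ^ (1 + σ) < h * R ^ (n - k + 1) := by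
      intro σ γ γ' hσ hσ1 hγ0 hγ hγγ' hx
      have h2 : (2 : ℝ) ^ (1 + σ) ≤ 2 ^ (2 : ℝ) :=
        Real.rpow_le_rpow_of_exponent_le (by norm_num) (by linarith)
      have h4 : (2 : ℝ) ^ (2 : ℝ) = 4 := by norm_num
      rw [h4] at h2
      calc (ratDen P : ℝ) ^ (1 + σ) ≤ (2 * (α * β)) ^ (1 + σ) := by gcongr
        _ = 2 ^ (1 + σ) * ((α * β) * (α * β) ^ σ) := by
          rw [Real.mul_rpow (by norm_num) hαβ.le, Real.rpow_add hαβ, Real.rpow_one]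
        _ ≤ 4 * ((α * β) * (α * β) ^ σ) := by gcongr
        _ = 4 * (γ * ((α * β) ^ σ * γ')) := by
          nth_rewrite 1 [← hγγ']; ring
        _ ≤ 4 * (N * (R ^ 2 * G ^ 4 * Q / R ^ (2 * k))) := by
          refine mul_le_mul_of_nonneg_left ?_ (by norm_num)
          exact (mul_le_mul_of_nonneg_left hx hγ0).trans
            (mul_le_mul_of_nonneg_right hγ (by positivity))
        _ = 4 * (R ^ 2 * G ^ 4) / R ^ k * (h * R ^ (n - k + 1)) := level_bound_eq hR0 hQ hkn
        _ < 1 * (h * R ^ (n - k + 1)) := by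
          refine mul_lt_mul_of_pos_right ?_ (by positivity)
          rw [div_lt_one hRk0]
          refine lt_of_lt_of_le ?_ hlarge
          calc 4 * (R ^ 2 * G ^ 4) < 32 * R * (R ^ 2 * G ^ 4) :=
                mul_lt_mul_of_pos_right (by linarith) (by positivity)
            _ = _ := by ring
        _ = _ := one_mul _
    exact ⟨P, hlev hs hs1 (by linarith) hαN rfl hdecay.1,
      hlev ht ht1 (by linarith) hβN (mul_comm _ _) hdecay.2, hzP⟩

theorem HasIndex.level_le {s t R G h : ℝ} (hR : 1 < R) (hh : 0 < h) {P : ℚ × ℚ} {A B C : ℤ}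
    {i : Fin 2 × ℕ × ℕ} (H : HasIndex s t R G h P A B C i) {m : ℕ}
    (h₁ : (ratDen P : ℝ) ^ (1 + s) < h * R ^ (m + 1))
    (h₂ : (ratDen P : ℝ) ^ (1 + t) < h * R ^ (m + 1)) : i.2.1 ≤ m := by
  have hq : (0 : ℝ) < ratDen P := by exact_mod_cast ratDen_pos P
  rw [Real.rpow_add hq, Real.rpow_one] at h₁ h₂
  have h3 : h * R ^ i.2.1 < h * R ^ (m + 1) := by
    refine H.le_height.trans_lt ?_
    rcases max_choice |(A : ℝ)| |(B : ℝ)| with e | e <;> rw [e]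
    · exact (mul_le_mul_of_nonneg_left H.abs_A_le hq.le).trans_lt h₁
    · exact (mul_le_mul_of_nonneg_left H.abs_B_le hq.le).trans_lt h₂
  exact Nat.lt_succ_iff.1 ((pow_lt_pow_iff_right₀ hR).1 (lt_of_mul_lt_mul_left h3 hh.le))

theorem abs_mul_max_le_of_proportional {A B C A' B' C' : ℤ}
    (h : A * B' = A' * B ∧ A * C' = A' * C ∧ B * C' = B' * C) (w : ℝ × ℝ) :
    max |(A' : ℝ)| |(B' : ℝ)| * |A * w.1 + B * w.2 + C| ≤
      max |(A : ℝ)| |(B : ℝ)| * |A' * w.1 + B' * w.2 + C'| := by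
  obtain ⟨h1, h2, h3⟩ := h
  have h1' : (A : ℝ) * B' = A' * B := by exact_mod_cast h1
  have h2' : (A : ℝ) * C' = A' * C := by exact_mod_cast h2
  have h3' : (B : ℝ) * C' = B' * C := by exact_mod_cast h3
  have eA : (A' : ℝ) * (A * w.1 + B * w.2 + C) = A * (A' * w.1 + B' * w.2 + C') := by
    linear_combination -w.2 * h1' - h2'
  have eB : (B' : ℝ) * (A * w.1 + B * w.2 + C) = B * (A' * w.1 + B' * w.2 + C') := by
    linear_combination w.1 * h1' - h3'
  rcases max_choice |(A' : ℝ)| |(B' : ℝ)| with e | e <;> rw [e, ← abs_mul]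
  · rw [eA, abs_mul]; gcongr; exact le_max_left _ _
  · rw [eB, abs_mul]; gcongr; exact le_max_right _ _

/-- **An's main lemma.**  Fix `s, t > 0` with `s + t = 1`, `R > 1` and `ℓ > 0`.  Then there
exist `ε > 0` and a partition of `ℚ²` into pieces `𝒫_{n,k}^{(δ)}` indexed by `δ ∈ {1,2}` and
integers `n ≥ k ≥ 1` (encoded as a function `idx` assigning to each rational point the index
`(δ, n, k)` of the unique piece containing it, so that `𝒫_{n,k}^{(δ)} = idx⁻¹ {(δ,n,k)}`),
with the following property.  For `m ≥ 0` put `𝒫_m = ⋃_{δ} ⋃_{k=1}^m 𝒫_{m,k}^{(δ)}`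
(equivalently, `𝒫_m = {P : (idx P).2.1 = m}`), and say that a closed ball of radius
`R⁻ᵐ ℓ/2` with center `z` belongs to `ℬ_m` if `Δ_ε(P) ∩ B = ∅` for all `m' ≤ m` and all
`P ∈ 𝒫_{m'}`.  Then for all `n ≥ k ≥ 1`, all `δ`, and every ball `B ∈ ℬ_{n-k}`, there is an
affine line `L` such that every `P ∈ 𝒫_{n,k}^{(δ)}` with `Δ_ε(P) ∩ B ≠ ∅` satisfies
`Δ_ε(P) ⊆ L^{(ℓ R⁻ⁿ / 3)}`. -/
theorem an_main_lemma (s t : ℝ) (hs : 0 < s) (ht : 0 < t) (hst : s + t = 1)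
    (R : ℝ) (hR : 1 < R) (ℓ : ℝ) (hℓ : 0 < ℓ) :
    ∃ ε : ℝ, 0 < ε ∧ ∃ idx : ℚ × ℚ → Fin 2 × ℕ × ℕ,
      (∀ P : ℚ × ℚ, 1 ≤ (idx P).2.2 ∧ (idx P).2.2 ≤ (idx P).2.1) ∧
      ∀ n k : ℕ, 1 ≤ k → k ≤ n → ∀ δ : Fin 2, ∀ z : ℝ × ℝ,
        (∀ m' : ℕ, m' ≤ n - k → ∀ P : ℚ × ℚ, (idx P).2.1 = m' →
          Delta s t ε P ∩ closedBall z (R ^ (-((n - k : ℕ) : ℤ)) * ℓ / 2) = ∅) →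
        ∃ L : AffineSubspace ℝ (ℝ × ℝ), IsLine L ∧
          ∀ P : ℚ × ℚ, idx P = (δ, n, k) →
            (Delta s t ε P ∩ closedBall z (R ^ (-((n - k : ℕ) : ℤ)) * ℓ / 2)).Nonempty →
            Delta s t ε P ⊆ lineNbhd L (ℓ * R ^ (-(n : ℤ)) / 3) := by
  have hs1 : s ≤ 1 := by linarith
  have ht1 : t ≤ 1 := by linarith
  have hR0 : 0 < R := by linarith
  have hst0 : 0 < s * t := mul_pos hs ht
  obtain ⟨G, hGs, hGt⟩ : ∃ G : ℝ, R ^ 2 ≤ G ^ s ∧ R ^ 2 ≤ G ^ t ∧ 0 < G := by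
    refine ⟨R ^ (2 / (s * t)), ?_, ?_, by positivity⟩ <;>
      rw [← Real.rpow_mul hR0.le, ← Real.rpow_natCast] <;>
      refine Real.rpow_le_rpow_of_exponent_le hR.le ?_ <;>
      rw [div_mul_eq_mul_div, le_div_iff₀ hst0] <;> push_cast <;> nlinarith
  obtain ⟨hGt, hG0⟩ := hGt
  have hG1 : 1 ≤ G := by
    by_contra! hlt
    have h1 : G ^ t ≤ 1 := Real.rpow_le_one hG0.le hlt.le ht.le
    nlinarith
  have hG : R ^ 2 ≤ G := hGt.trans (by
    calc G ^ t ≤ G ^ (1 : ℝ) := Real.rpow_le_rpow_of_exponent_le hG1 ht1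
      _ = G := Real.rpow_one _)
  obtain ⟨ε, hε, hε₁, hε₂⟩ : ∃ ε : ℝ, 0 < ε ∧ 512 * R ^ 4 * G ^ 5 * ε < 1 ∧ 6 * ε / ℓ * R ≤ 1 := by
    refine ⟨min (1 / (1024 * R ^ 4 * G ^ 5)) (ℓ / (6 * R)), by positivity, ?_, ?_⟩
    · calc 512 * R ^ 4 * G ^ 5 * min (1 / (1024 * R ^ 4 * G ^ 5)) (ℓ / (6 * R))
          ≤ 512 * R ^ 4 * G ^ 5 * (1 / (1024 * R ^ 4 * G ^ 5)) := by gcongr; exact min_le_left _ _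
        _ = 1 / 2 := by field_simp; norm_num
        _ < 1 := by norm_num
    · calc 6 * min (1 / (1024 * R ^ 4 * G ^ 5)) (ℓ / (6 * R)) / ℓ * R
          ≤ 6 * (ℓ / (6 * R)) / ℓ * R := by gcongr; exact min_le_right _ _
        _ = 1 := by field_simp
  have hh : 0 < 6 * ε / ℓ := by positivity
  choose idx A B C H using exists_hasIndex (s := s) (t := t) hs ht hst hR hG hh hε₂
  refine ⟨ε, hε, idx, fun P => ⟨(H P).one_le, (H P).le_level⟩, ?_⟩
  intro n k hk hkn δ z hB
  set ρ := R ^ (-((n - k : ℕ) : ℤ)) * ℓ / 2 with hρ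
  have hρ0 : 0 ≤ ρ := by positivity
  have hρ' : 6 * ε / ℓ * R ^ (n + 1) * ρ ≤ 3 * ε * R ^ (k + 1) := by
    obtain ⟨m, rfl⟩ := Nat.exists_eq_add_of_le hkn
    rw [hρ, Nat.add_sub_cancel_left, zpow_neg, zpow_natCast]
    refine le_of_eq ?_
    field_simp
    ring
  by_cases hne : ∃ P, idx P = (δ, n, k) ∧ (Delta s t ε P ∩ closedBall z ρ).Nonempty
  · obtain ⟨P₀, hP₀, hz₀⟩ := hne
    obtain ⟨L, hL, hLw⟩ := exists_line_of_point (A := A P₀) (B := B P₀) (C := C P₀)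
      (p := ((P₀.1 : ℝ), (P₀.2 : ℝ)))
      (by simpa using (H P₀).ne_zero) (H P₀).eq_zero
    refine ⟨L, hL, fun P hP hz w hw => hLw _ w ?_⟩
    have hprop : A P₀ * B P = A P * B P₀ ∧ A P₀ * C P = A P * C P₀ ∧ B P₀ * C P = B P * C P₀ := by
      by_cases hPP : P₀ = P
      · subst hPP; exact ⟨rfl, rfl, rfl⟩
      · refine (HasIndex.proportional_or_exists hs ht hst hR hGs hGt hG1 hh hε hε₁ hρ' hPP
          (hP₀ ▸ H P₀) (hP ▸ H P) hz₀ hz).resolve_right ?_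
        rintro ⟨P', h₁, h₂, hzP'⟩
        have hmem : z ∈ Delta s t ε P' ∩ closedBall z ρ := ⟨hzP', mem_closedBall_self hρ0⟩
        rw [hB _ ((H P').level_le hR hh h₁ h₂) P' rfl] at hmem
        exact hmem
    have hq : (0 : ℝ) < ratDen P := by exact_mod_cast ratDen_pos P
    have hM : 0 < max |(A P : ℝ)| |(B P : ℝ)| :=
      zero_lt_one.trans_le (one_le_max_abs_intCast (H P).ne_zero)
    have hle := (H P).le_height
    rw [hP] at hle
    have hF := (H P).abs_le_of_mem_Delta hw
    have hγ : 2 * ε / ratDen P ≤ ℓ * R ^ (-(n : ℤ)) / 3 * max |(A P : ℝ)| |(B P : ℝ)| := by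
      rw [div_le_iff₀ hq, zpow_neg, zpow_natCast]
      calc 2 * ε = ℓ * (R ^ n)⁻¹ / 3 * (6 * ε / ℓ * R ^ n) := by field_simp; norm_num
        _ ≤ ℓ * (R ^ n)⁻¹ / 3 * (ratDen P * max |(A P : ℝ)| |(B P : ℝ)|) := by gcongr
        _ = _ := by ring
    refine le_of_mul_le_mul_left ?_ hM
    calc _ ≤ _ := abs_mul_max_le_of_proportional hprop w
      _ ≤ max |(A P₀ : ℝ)| |(B P₀ : ℝ)| *
          (ℓ * R ^ (-(n : ℤ)) / 3 * max |(A P : ℝ)| |(B P : ℝ)|) := by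
        gcongr; exact hF.trans hγ
      _ = _ := by ring
  · obtain ⟨L, hL, -⟩ := exists_line_of_point (A := 1) (B := 0) (C := 0) (p := (0, 0))
      (Or.inl one_ne_zero) (by simp)
    exact ⟨L, hL, fun P hP hz => absurd ⟨P, hP, hz⟩ hne⟩
end

section
/- For any countable collection of pairs of real numbers (sₙ, tₙ), n ∈ ℕ, with sₙ, tₙ ≥ 0 and sₙ + tₙ = 1 for every n, the intersection ⋂_{n∈ℕ} Bad(sₙ,tₙ) is nonempty. -/
open Metric Filter

/-- Distance from a real number to the nearest integer. -/
noncomputable def distNearestInt (x : ℝ) : ℝ := |x - ((round x : ℤ) : ℝ)|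

/-- The set `Bad(s,t) ⊆ ℝ²` of pairs `(x,y)` such that
`inf_{q ∈ ℕ⁺} max (q^s ‖qx‖) (q^t ‖qy‖) > 0`. -/
noncomputable def badPair (s t : ℝ) : Set (ℝ × ℝ) :=
  {p | 0 < ⨅ q : ℕ+, max (((q : ℕ) : ℝ) ^ s * distNearestInt (((q : ℕ) : ℝ) * p.1))
      (((q : ℕ) : ℝ) ^ t * distNearestInt (((q : ℕ) : ℝ) * p.2))}

/-- The closed 16-adic interval `[a / 16 ^ m, (a + 1) / 16 ^ m]` meets the closed interval of
radius `16 ^ (-r)` about `x`. -/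
def MeetsCell (m : ℕ) (a : ℤ) (x : ℝ) (r : ℕ) : Prop :=
  (a : ℝ) / 16 ^ m - 1 / 16 ^ r ≤ x ∧ x ≤ (a + 1) / 16 ^ m + 1 / 16 ^ r

open Classical in
/-- The weight, seen from a 16-adic interval of level `m`, of the obstacle of radius `16 ^ (-r)`
about `x`: the square root of the ratio of lengths if the two meet, and `0` otherwise. -/
noncomputable def obstacleWeight (m : ℕ) (a : ℤ) (x : ℝ) (r : ℕ) : ENNReal :=
  if MeetsCell m a x r then 4 ^ m / 4 ^ r else 0

/-- The total weight, seen from a 16-adic interval, of the obstacles `x j b i` attached to that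
interval and to its ancestors. -/
noncomputable def obstaclePotential {ι : Type*} (d : ι → ℕ) (x : ℕ → ℤ → ι → ℝ) (m : ℕ) (a : ℤ) :
    ENNReal :=
  ∑ j ∈ Finset.range (m + 1), ∑' i, obstacleWeight m a (x j (a / 16 ^ (m - j)) i) (j + d i)

theorem MeetsCell.parent {m : ℕ} {a : ℤ} {h : ℕ} (hh : h < 16) {x : ℝ} {r : ℕ}
    (H : MeetsCell (m + 1) (16 * a + h) x r) : MeetsCell m a x r := by
  obtain ⟨h1, h2⟩ := H
  have hh' : (h : ℝ) + 1 ≤ 16 := by exact_mod_cast hh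
  have h0 : (0 : ℝ) ≤ h := Nat.cast_nonneg h
  have e1 : (a : ℝ) / 16 ^ m ≤ ((16 * a + h : ℤ) : ℝ) / 16 ^ (m + 1) := by
    rw [pow_succ, div_le_div_iff₀ (by positivity) (by positivity)]
    push_cast
    nlinarith [pow_pos (by norm_num : (0 : ℝ) < 16) m,
      mul_nonneg h0 (pow_pos (by norm_num : (0 : ℝ) < 16) m).le]
  have e2 : (((16 * a + h : ℤ) : ℝ) + 1) / 16 ^ (m + 1) ≤ ((a : ℝ) + 1) / 16 ^ m := by
    rw [pow_succ, div_le_div_iff₀ (by positivity) (by positivity)]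
    push_cast
    nlinarith [pow_pos (by norm_num : (0 : ℝ) < 16) m,
      mul_nonneg (sub_nonneg.2 hh') (pow_pos (by norm_num : (0 : ℝ) < 16) m).le]
  exact ⟨by linarith, by linarith⟩

theorem MeetsCell.le_add_one {m : ℕ} {a b : ℤ} {x : ℝ} {r : ℕ} (hr : m + 1 ≤ r)
    (Ha : MeetsCell m a x r) (Hb : MeetsCell m b x r) : b ≤ a + 1 := by
  by_contra! hlt
  have hlt' : (a : ℝ) + 1 + 1 ≤ b := by exact_mod_cast Int.add_one_le_iff.2 hlt
  have hm : (0 : ℝ) < 1 / 16 ^ m := by positivity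
  have h16 : (1 : ℝ) / 16 ^ r ≤ 1 / 16 ^ m / 16 := by
    rw [div_div, ← pow_succ]
    exact one_div_le_one_div_of_le (by positivity) (pow_le_pow_right₀ (by norm_num) hr)
  have h1 := Hb.1
  have h2 := Ha.2
  rw [div_eq_mul_one_div] at h1 h2
  nlinarith

theorem card_meetsCell_le_two {m : ℕ} {a : ℤ} {x : ℝ} {r : ℕ} (hr : m + 2 ≤ r)
    [DecidablePred fun h : ℕ => MeetsCell (m + 1) (16 * a + h) x r] :
    ((Finset.range 16).filter fun h : ℕ => MeetsCell (m + 1) (16 * a + h) x r).card ≤ 2 := by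
  set S := (Finset.range 16).filter fun h : ℕ => MeetsCell (m + 1) (16 * a + h) x r with hS
  rcases S.eq_empty_or_nonempty with h0 | hne
  · simp [h0]
  · have hsub : S ⊆ {S.min' hne, S.min' hne + 1} := by
      intro h hh
      have h1 := S.min'_le h hh
      have h2 := (Finset.mem_filter.1 (S.min'_mem hne)).2
      have h3 := MeetsCell.le_add_one hr h2 (Finset.mem_filter.1 hh).2
      simp only [Finset.mem_insert, Finset.mem_singleton]
      omega
    exact (Finset.card_le_card hsub).trans Finset.card_le_two

theorem pow_div_pow_add (m d : ℕ) : (4 ^ m / 4 ^ (m + d) : ENNReal) = (4 ^ d)⁻¹ := by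
  rw [pow_add, ENNReal.div_eq_inv_mul, ENNReal.mul_inv (by simp) (by simp), mul_right_comm,
    ENNReal.inv_mul_cancel (by simp) (by simp), one_mul]

theorem sum_obstacleWeight_le {m : ℕ} {a : ℤ} {x : ℝ} {r : ℕ}
    (hw : obstacleWeight m a x r < 1 / 4) :
    ∑ h ∈ Finset.range 16, obstacleWeight (m + 1) (16 * a + (h : ℕ)) x r
      ≤ 8 * obstacleWeight m a x r := by
  classical
  by_cases hM : MeetsCell m a x r
  · have hr : m + 2 ≤ r := by
      by_contra! hlt
      refine hw.not_ge ?_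
      have h4 : (4 : ENNReal) ^ r ≤ 4 ^ (m + 1) := pow_le_pow_right₀ (by norm_num) (by omega)
      calc (1 / 4 : ENNReal) = 4 ^ m / 4 ^ (m + 1) := by rw [pow_div_pow_add, pow_one, one_div]
        _ ≤ 4 ^ m / 4 ^ r := ENNReal.div_le_div_left h4 _
        _ = obstacleWeight m a x r := by rw [obstacleWeight, if_pos hM]
    calc ∑ h ∈ Finset.range 16, obstacleWeight (m + 1) (16 * a + (h : ℕ)) x r
        = ∑ h ∈ (Finset.range 16).filter fun h : ℕ => MeetsCell (m + 1) (16 * a + h) x r,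
          (4 ^ (m + 1) / 4 ^ r : ENNReal) := by
          rw [Finset.sum_filter]
          exact Finset.sum_congr rfl fun h _ => by simp [obstacleWeight]
      _ ≤ 2 * (4 ^ (m + 1) / 4 ^ r) := by
          rw [Finset.sum_const, nsmul_eq_mul]
          gcongr
          exact_mod_cast card_meetsCell_le_two hr
      _ = 8 * obstacleWeight m a x r := by
          rw [obstacleWeight, if_pos hM, pow_succ, mul_comm (4 ^ m : ENNReal) 4, mul_div_assoc,
            ← mul_assoc]
          norm_num
  · refine (Finset.sum_eq_zero fun h hh => ?_).trans_le zero_le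
    rw [obstacleWeight, if_neg fun H => hM (H.parent (Finset.mem_range.1 hh))]

theorem tsum_obstacleWeight_self_le {ι : Type*} (d : ι → ℕ) (x : ι → ℝ) (m : ℕ) (a : ℤ) :
    ∑' i, obstacleWeight m a (x i) (m + d i) ≤ ∑' i, ((4 : ENNReal) ^ d i)⁻¹ := by
  refine ENNReal.tsum_le_tsum fun i => ?_
  rw [obstacleWeight]
  split_ifs
  · exact (pow_div_pow_add m (d i)).le
  · exact zero_le

theorem exists_child_obstaclePotential_le {ι : Type*} (d : ι → ℕ) (x : ℕ → ℤ → ι → ℝ)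
    (hd : ∑' i, ((4 : ENNReal) ^ d i)⁻¹ ≤ 1 / 16) (m : ℕ) (a : ℤ)
    (ha : obstaclePotential d x m a ≤ 1 / 8) :
    ∃ h : ℕ, h < 16 ∧ obstaclePotential d x (m + 1) (16 * a + h) ≤ 1 / 8 := by
  set old : ℕ → ENNReal := fun h => ∑ j ∈ Finset.range (m + 1), ∑' i,
    obstacleWeight (m + 1) (16 * a + h) (x j (a / 16 ^ (m - j)) i) (j + d i) with hold
  have hw : ∀ j ∈ Finset.range (m + 1), ∀ i,
      obstacleWeight m a (x j (a / 16 ^ (m - j)) i) (j + d i) < 1 / 4 := by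
    intro j hj i
    refine lt_of_le_of_lt ?_ (lt_of_le_of_lt ha (by
      rw [one_div, one_div, ENNReal.inv_lt_inv]; norm_num))
    exact (ENNReal.le_tsum i).trans (Finset.single_le_sum
      (f := fun j => ∑' i, obstacleWeight m a (x j (a / 16 ^ (m - j)) i) (j + d i))
      (fun _ _ => zero_le) hj)
  have hsum : ∑ h ∈ Finset.range 16, old h ≤ 8 * obstaclePotential d x m a := by
    rw [hold, Finset.sum_comm, obstaclePotential, Finset.mul_sum]
    refine Finset.sum_le_sum fun j hj => ?_
    rw [← ENNReal.tsum_mul_left, ← Summable.tsum_finsetSum fun _ _ => ENNReal.summable]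
    exact ENNReal.tsum_le_tsum fun i => sum_obstacleWeight_le (hw j hj i)
  obtain ⟨h, hh, hle⟩ : ∃ h ∈ Finset.range 16, old h ≤ 1 / 16 := by
    by_contra! hlt
    refine (ENNReal.sum_lt_sum_of_nonempty (by simp) hlt).not_ge (hsum.trans ?_)
    calc 8 * obstaclePotential d x m a ≤ 8 * (1 / 8) := by gcongr
      _ = 1 := by rw [one_div, ENNReal.mul_inv_cancel] <;> norm_num
      _ = ∑ h ∈ Finset.range 16, (1 / 16 : ENNReal) := by
        rw [Finset.sum_const, Finset.card_range, nsmul_eq_mul, one_div]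
        exact (ENNReal.mul_inv_cancel (by norm_num) (by norm_num)).symm
  have hh' := Finset.mem_range.1 hh
  refine ⟨h, hh', ?_⟩
  have hanc : ∀ j ∈ Finset.range (m + 1),
      (16 * a + (h : ℤ)) / 16 ^ (m + 1 - j) = a / 16 ^ (m - j) := by
    intro j hj
    have : m + 1 - j = (m - j) + 1 := by have := Finset.mem_range.1 hj; omega
    rw [this, pow_succ', Int.ediv_ediv_of_nonneg (by norm_num) |>.symm]
    congr 1
    omega
  rw [obstaclePotential, Finset.sum_range_succ]
  calc _ ≤ old h + 1 / 16 := by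
        refine add_le_add (Finset.sum_le_sum fun j hj => ?_)
          ((tsum_obstacleWeight_self_le d _ (m + 1) _).trans hd)
        rw [hanc j hj]
    _ ≤ 1 / 16 + 1 / 16 := by gcongr
    _ = 1 / 8 := by
        rw [← ENNReal.toReal_eq_toReal_iff' (by simp) (by simp),
          ENNReal.toReal_add (by simp) (by simp)]
        norm_num

theorem exists_avoids_obstacles {ι : Type*} (d : ι → ℕ) (x : ℕ → ℤ → ι → ℝ)
    (hd : ∑' i, ((4 : ENNReal) ^ d i)⁻¹ ≤ 1 / 16) :
    ∃ (y : ℝ) (a : ℕ → ℤ), ∀ m, ((a m : ℝ) / 16 ^ m ≤ y ∧ y ≤ (a m + 1) / 16 ^ m) ∧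
      ∀ i, 1 / 16 ^ (m + d i) < |y - x m (a m) i| := by
  have h0 : obstaclePotential d x 0 0 ≤ 1 / 8 := by
    rw [obstaclePotential, zero_add, Finset.sum_range_one]
    refine ((tsum_obstacleWeight_self_le d _ 0 0).trans hd).trans ?_
    rw [one_div, one_div, ENNReal.inv_le_inv]
    norm_num
  choose! f hf16 hf using exists_child_obstaclePotential_le d x hd
  obtain ⟨a, ha_zero, hsucc⟩ : ∃ a : ℕ → ℤ, a 0 = 0 ∧
      ∀ m, a (m + 1) = 16 * a m + (f m (a m) : ℕ) :=
    ⟨fun m => Nat.rec 0 (fun m b => 16 * b + (f m b : ℕ)) m, rfl, fun _ => rfl⟩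
  have ha : ∀ m, obstaclePotential d x m (a m) ≤ 1 / 8 := by
    intro m
    induction m with
    | zero => rwa [ha_zero]
    | succ m ih => rw [hsucc]; exact hf m (a m) ih
  have hdiv : ∀ j k, a (j + k) / 16 ^ k = a j := by
    intro j k
    induction k with
    | zero => simp
    | succ k ih =>
      rw [← ih, ← add_assoc, hsucc, pow_succ', Int.ediv_ediv_of_nonneg (by norm_num) |>.symm]
      congr 1
      have := hf16 (j + k) (a (j + k)) (ha _)
      omega
  let I : ℕ → Set ℝ := fun m => Set.Icc ((a m : ℝ) / 16 ^ m) (((a m : ℝ) + 1) / 16 ^ m)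
  have hIne : ∀ m, (I m).Nonempty := fun m => Set.nonempty_Icc.2
    (div_le_div_of_nonneg_right (by linarith) (by positivity))
  have hImono : ∀ m, I (m + 1) ⊆ I m := by
    intro m
    have hlt := hf16 m (a m) (ha m)
    have h1 : ((f m (a m) : ℕ) : ℝ) + 1 ≤ 16 := by exact_mod_cast hlt
    have h2 : (0 : ℝ) ≤ ((f m (a m) : ℕ) : ℝ) := Nat.cast_nonneg _
    have h3 : (0 : ℝ) < 16 ^ m := by positivity
    refine Set.Icc_subset_Icc ?_ ?_
    · rw [hsucc, pow_succ, div_le_div_iff₀ (by positivity) (by positivity)]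
      push_cast
      nlinarith [mul_nonneg h2 h3.le]
    · rw [hsucc, pow_succ, div_le_div_iff₀ (by positivity) (by positivity)]
      push_cast
      nlinarith [mul_nonneg (sub_nonneg.2 h1) h3.le]
  obtain ⟨y, hy⟩ := IsCompact.nonempty_iInter_of_sequence_nonempty_isCompact_isClosed I hImono
    hIne isCompact_Icc fun _ => isClosed_Icc
  have hy' : ∀ m, y ∈ I m := Set.mem_iInter.1 hy
  refine ⟨y, a, fun m => ⟨hy' m, fun i => ?_⟩⟩
  by_contra! hle
  set M := m + d i with hM
  have hmeet : MeetsCell M (a M) (x m (a M / 16 ^ (M - m)) i) M := by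
    have : M - m = d i := by omega
    rw [this, hM, hdiv, ← hM]
    have h1 := abs_le.1 hle
    exact ⟨by linarith [(hy' M).1], by linarith [(hy' M).2]⟩
  have h1 : (1 : ENNReal) ≤ obstaclePotential d x M (a M) := by
    calc (1 : ENNReal) = obstacleWeight M (a M) (x m (a M / 16 ^ (M - m)) i) (m + d i) := by
          rw [← hM, obstacleWeight, if_pos hmeet, ENNReal.div_self (by simp) (by simp)]
      _ ≤ ∑' i, obstacleWeight M (a M) (x m (a M / 16 ^ (M - m)) i) (m + d i) :=
          ENNReal.le_tsum i
      _ ≤ _ := Finset.single_le_sum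
          (f := fun j => ∑' i, obstacleWeight M (a M) (x j (a M / 16 ^ (M - j)) i) (j + d i))
          (fun _ _ => zero_le) (Finset.mem_range.2 (by omega))
  refine absurd (h1.trans (ha M)) (not_le.2 ?_)
  rw [one_div, ENNReal.inv_lt_one]
  norm_num

/-- The rational point `(p / q, r / q)` is `c`-close to `(θ, y)`, and no rational point with a
smaller denominator is. -/
structure IsMinimalApprox (s t θ c : ℝ) (q : ℕ) (p r : ℤ) (y : ℝ) : Prop where
  pos : 0 < q
  fst_lt : (q : ℝ) ^ s * |q * θ - p| < c
  snd_lt : (q : ℝ) ^ t * |q * y - r| < c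
  minimal : ∀ q' : ℕ, 0 < q' → q' < q → ∀ p' r' : ℤ,
    (q' : ℝ) ^ s * |q' * θ - p'| < c → c ≤ (q' : ℝ) ^ t * |q' * y - r'|

/-- A line `A x + B y + C = 0` of small height through the rational point `(p / q, r / q)`. -/
structure IsLineThrough (s t : ℝ) (q : ℕ) (p r A B C : ℤ) : Prop where
  abs_fst_le : |(A : ℝ)| ≤ (q : ℝ) ^ s
  one_le : 1 ≤ B
  snd_le : (B : ℝ) ≤ (q : ℝ) ^ t
  eq_zero : A * p + B * r + C * q = 0

/-- The denominator `q` and the coefficient `B` have logarithmic size prescribed by `n`, `k`. -/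
structure HasSize (t b : ℝ) (n k q : ℕ) (B : ℤ) : Prop where
  pow_le : (16 : ℝ) ^ n ≤ q * B
  lt_pow : (q * B : ℝ) < 16 ^ (n + 1)
  pow_mul_le : b ^ k * B ≤ (q : ℝ) ^ t
  lt_pow_mul : (q : ℝ) ^ t < b ^ (k + 1) * B

theorem rpow_le_mul_rpow {x y w s : ℝ} (hx : 0 ≤ x) (hy : 0 ≤ y) (hw : 1 ≤ w) (h : x ≤ w * y)
    (hs : 0 ≤ s) (hs1 : s ≤ 1) : x ^ s ≤ w * y ^ s :=
  calc x ^ s ≤ (w * y) ^ s := Real.rpow_le_rpow hx h hs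
    _ = w ^ s * y ^ s := Real.mul_rpow (by linarith) hy
    _ ≤ w * y ^ s := by
      gcongr
      simpa using Real.rpow_le_rpow_of_exponent_le hw hs1

theorem exists_small_dual_vector {s t : ℝ} (hst : s + t = 1) {q : ℕ} (hq : 0 < q) (p r : ℤ) :
    ∃ A B C : ℤ, (A ≠ 0 ∨ B ≠ 0) ∧ |(A : ℝ)| ≤ (q : ℝ) ^ s ∧ |(B : ℝ)| ≤ (q : ℝ) ^ t ∧
      A * p + B * r + C * q = 0 := by
  have hq' : (0 : ℝ) < q := by exact_mod_cast hq
  set u := ⌊(q : ℝ) ^ s⌋₊ with hu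
  set v := ⌊(q : ℝ) ^ t⌋₊ with hv
  have : NeZero q := ⟨hq.ne'⟩
  have hcard : (Finset.univ : Finset (ZMod q)).card <
      (Finset.range (u + 1) ×ˢ Finset.range (v + 1)).card := by
    rw [Finset.card_univ, ZMod.card, Finset.card_product, Finset.card_range, Finset.card_range]
    have h1 : (q : ℝ) ^ s < u + 1 := Nat.lt_floor_add_one _
    have h2 : (q : ℝ) ^ t < v + 1 := Nat.lt_floor_add_one _
    have h3 : (q : ℝ) = (q : ℝ) ^ s * (q : ℝ) ^ t := by
      rw [← Real.rpow_add hq', hst, Real.rpow_one]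
    have h4 : (q : ℝ) < (u + 1) * (v + 1) := by
      rw [h3]
      exact mul_lt_mul'' h1 h2 (by positivity) (by positivity)
    exact_mod_cast h4
  obtain ⟨⟨a, b⟩, hab, ⟨a', b'⟩, hab', hne, heq⟩ := Finset.exists_ne_map_eq_of_card_lt_of_maps_to
    hcard (f := fun z => (z.1 : ZMod q) * p + z.2 * r)
    (fun _ _ => Finset.mem_coe.2 (Finset.mem_univ _))
  simp only [Finset.mem_product, Finset.mem_range, Nat.lt_succ_iff] at hab hab'
  have bound : ∀ {i j : ℕ} {z : ℝ}, 0 ≤ z → i ≤ ⌊z⌋₊ → j ≤ ⌊z⌋₊ →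
      |(((i : ℤ) - (j : ℤ) : ℤ) : ℝ)| ≤ z := by
    intro i j z hz hi hj
    have hi' := (Nat.le_floor_iff hz).1 hi
    have hj' := (Nat.le_floor_iff hz).1 hj
    have hi0 : (0 : ℝ) ≤ i := Nat.cast_nonneg i
    have hj0 : (0 : ℝ) ≤ j := Nat.cast_nonneg j
    push_cast
    rw [abs_le]
    constructor <;> linarith
  have hdvd : (q : ℤ) ∣ ((a : ℤ) - a') * p + ((b : ℤ) - b') * r := by
    rw [← ZMod.intCast_zmod_eq_zero_iff_dvd]
    push_cast
    linear_combination heq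
  obtain ⟨C, hC⟩ := hdvd
  refine ⟨a - a', b - b', -C, ?_, bound (by positivity) hab.1 hab'.1,
    bound (by positivity) hab.2 hab'.2, by linear_combination hC⟩
  by_contra! h
  exact hne (Prod.ext (by simpa [sub_eq_zero] using h.1) (by simpa [sub_eq_zero] using h.2))

theorem exists_isLineThrough {s t θ : ℝ} (ht : 0 ≤ t) (hst : s + t = 1)
    (hθ : ∀ A C : ℤ, A ≠ 0 → 1 / 4 ≤ |(A : ℝ)| * |A * θ + C|) {q : ℕ} (hq : 0 < q) {p : ℤ}
    (r : ℤ) (hp : (q : ℝ) ^ s * |q * θ - p| < 1 / 4) :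
    ∃ A B C : ℤ, IsLineThrough s t q p r A B C := by
  obtain ⟨A, B, C, hne, hA, hB, h0⟩ := exists_small_dual_vector hst hq p r
  have hq1 : (1 : ℝ) ≤ q := by exact_mod_cast hq
  have hB0 : B ≠ 0 := by
    rintro rfl
    have hA0 : A ≠ 0 := by simpa using hne
    have h1 := hθ A C hA0
    have h0' : (A : ℝ) * p + C * q = 0 := by exact_mod_cast (by simpa using h0 : A * p + C * q = 0)
    have h2 : (q : ℝ) * |A * θ + C| = |(A : ℝ)| * |q * θ - p| := by
      rw [← abs_mul, ← abs_of_pos (show (0 : ℝ) < q by linarith), ← abs_mul,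
        abs_of_pos (show (0 : ℝ) < q by linarith)]
      congr 1
      linear_combination h0'
    have h3 : |(A : ℝ)| ≤ q := hA.trans (by
      simpa using Real.rpow_le_rpow_of_exponent_le hq1 (show s ≤ 1 by linarith))
    have h4 : |(A : ℝ)| * |q * θ - p| ≤ (q : ℝ) ^ s * |q * θ - p| := by gcongr
    have h5 : |(A : ℝ)| * |A * θ + C| ≤ q * |A * θ + C| := by gcongr
    linarith
  rcases lt_or_gt_of_ne hB0 with hlt | hgt
  · refine ⟨-A, -B, -C, by simpa using hA, by omega, ?_, by linear_combination -h0⟩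
    push_cast
    exact (neg_le_abs _).trans hB
  · exact ⟨A, B, C, hA, by omega, (le_abs_self _).trans hB, h0⟩

theorem HasSize.le_mul {t b : ℝ} (ht : 0 ≤ t) (hb : 1 ≤ b) {n k q₁ q₂ : ℕ} {B₁ B₂ : ℤ}
    (hq₁ : 0 < q₁) (hB₁ : 1 ≤ B₁) (hB₂ : 1 ≤ B₂) (h₁ : HasSize t b n k q₁ B₁)
    (h₂ : HasSize t b n k q₂ B₂) : (q₁ : ℝ) ≤ 16 * b * q₂ := by
  have hq : (0 : ℝ) < q₁ := by exact_mod_cast hq₁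
  have hB₁' : (0 : ℝ) < B₁ := by exact_mod_cast hB₁
  have hB₂' : (0 : ℝ) < B₂ := by exact_mod_cast hB₂
  have hq2 : (0 : ℝ) ≤ q₂ := Nat.cast_nonneg _
  have hbk : 0 < b ^ k := by positivity
  by_contra! hlt
  have h3 : (q₁ : ℝ) ^ t * q₁ < 16 * b * (b ^ k * 16 ^ n) :=
    calc (q₁ : ℝ) ^ t * q₁ < b ^ (k + 1) * B₁ * q₁ := by gcongr; exact h₁.lt_pow_mul
      _ = b ^ (k + 1) * (q₁ * B₁) := by ring
      _ ≤ b ^ (k + 1) * 16 ^ (n + 1) := by gcongr; exact h₁.lt_pow.le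
      _ = _ := by ring
  have h4 : b ^ k * 16 ^ n ≤ (q₂ : ℝ) ^ t * q₂ := by
    refine le_of_mul_le_mul_right ?_ hB₂'
    calc b ^ k * 16 ^ n * B₂ = b ^ k * B₂ * 16 ^ n := by ring
      _ ≤ (q₂ : ℝ) ^ t * (q₂ * B₂) := by
        gcongr
        exacts [h₂.pow_mul_le, h₂.pow_le]
      _ = _ := by ring
  have h5 : (q₂ : ℝ) ^ t ≤ (q₁ : ℝ) ^ t := Real.rpow_le_rpow hq2 (by nlinarith) ht
  have h6 : (q₂ : ℝ) ^ t * (16 * b * q₂) ≤ (q₁ : ℝ) ^ t * q₁ := by gcongr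
  nlinarith

theorem IsLineThrough.mul_abs_le {s t θ c X δ : ℝ} {q : ℕ} {p r A B C : ℤ} {y z : ℝ}
    (hL : IsLineThrough s t q p r A B C) (hP : IsMinimalApprox s t θ c q p r y)
    (hz : |z - y| ≤ δ) (hδ : q * B * δ ≤ X) (hc : 2 * c ≤ X) :
    q * |A * θ + B * z + C| ≤ 2 * X := by
  have hq : (0 : ℝ) < q := by exact_mod_cast hP.pos
  have hB : (0 : ℝ) < B := by exact_mod_cast hL.one_le
  have h0 : (A : ℝ) * p + B * r + C * q = 0 := by exact_mod_cast hL.eq_zero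
  have hsum : (q : ℝ) * (A * θ + B * z + C) =
      A * (q * θ - p) + B * (q * y - r) + q * B * (z - y) := by linear_combination h0
  calc (q : ℝ) * |A * θ + B * z + C| = |(q : ℝ) * (A * θ + B * z + C)| := by
        rw [abs_mul, abs_of_pos hq]
    _ ≤ |(A : ℝ)| * |q * θ - p| + B * |q * y - r| + q * B * |z - y| := by
        rw [hsum]
        refine (abs_add_three _ _ _).trans_eq ?_
        rw [abs_mul, abs_mul, abs_mul ((q : ℝ) * B), abs_of_pos hB,
          abs_of_pos (show (0 : ℝ) < q * B by positivity)]
    _ ≤ (q : ℝ) ^ s * |q * θ - p| + (q : ℝ) ^ t * |q * y - r| + q * B * δ := by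
        gcongr
        exacts [hL.abs_fst_le, hL.snd_le]
    _ ≤ 2 * X := by linarith [hP.fst_lt, hP.snd_lt]

theorem IsLineThrough.eq_zero_of_close {s t θ c X W δ : ℝ} (hs : 0 ≤ s) (ht : 0 ≤ t)
    (hst : s + t = 1) {q₁ q₂ : ℕ} {p₁ r₁ A B C p₂ r₂ : ℤ} {y₁ y₂ : ℝ}
    (hL : IsLineThrough s t q₁ p₁ r₁ A B C) (hP₁ : IsMinimalApprox s t θ c q₁ p₁ r₁ y₁)
    (hP₂ : IsMinimalApprox s t θ c q₂ p₂ r₂ y₂) (hy : |y₂ - y₁| ≤ δ) (hδ : q₁ * B * δ ≤ X)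
    (hc : 2 * c ≤ X) (hW : 1 ≤ W) (h₁₂ : (q₁ : ℝ) ≤ W * q₂) (h₂₁ : (q₂ : ℝ) ≤ W * q₁)
    (hWX : 3 * W * X < 1) : A * p₂ + B * r₂ + C * q₂ = 0 := by
  have hq₁ : (0 : ℝ) < q₁ := by exact_mod_cast hP₁.pos
  have hq₂ : (0 : ℝ) < q₂ := by exact_mod_cast hP₂.pos
  have hB : (0 : ℝ) < B := by exact_mod_cast hL.one_le
  have hF := hL.mul_abs_le hP₁ hy hδ hc
  have h1 : (q₂ : ℝ) * |A * θ + B * y₂ + C| ≤ W * (2 * X) := by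
    calc (q₂ : ℝ) * |A * θ + B * y₂ + C| ≤ W * q₁ * |A * θ + B * y₂ + C| := by gcongr
      _ = W * (q₁ * |A * θ + B * y₂ + C|) := by ring
      _ ≤ _ := by gcongr
  have h2 : |(A : ℝ)| * |q₂ * θ - p₂| ≤ W * c :=
    calc |(A : ℝ)| * |q₂ * θ - p₂| ≤ (W * (q₂ : ℝ) ^ s) * |q₂ * θ - p₂| := by
          gcongr
          exact hL.abs_fst_le.trans
            (rpow_le_mul_rpow hq₁.le hq₂.le hW h₁₂ hs (by linarith))
      _ = W * ((q₂ : ℝ) ^ s * |q₂ * θ - p₂|) := by ring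
      _ ≤ W * c := by gcongr; exact hP₂.fst_lt.le
  have h3 : B * |q₂ * y₂ - r₂| ≤ W * c :=
    calc B * |q₂ * y₂ - r₂| ≤ (W * (q₂ : ℝ) ^ t) * |q₂ * y₂ - r₂| := by
          gcongr
          exact hL.snd_le.trans
            (rpow_le_mul_rpow hq₁.le hq₂.le hW h₁₂ ht (by linarith))
      _ = W * ((q₂ : ℝ) ^ t * |q₂ * y₂ - r₂|) := by ring
      _ ≤ W * c := by gcongr; exact hP₂.snd_lt.le
  have h4 : |(A * p₂ + B * r₂ + C * q₂ : ℝ)| < 1 :=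
    calc |(A * p₂ + B * r₂ + C * q₂ : ℝ)|
        = |q₂ * (A * θ + B * y₂ + C) + -(A * (q₂ * θ - p₂)) + -(B * (q₂ * y₂ - r₂))| := by
          congr 1; ring
      _ ≤ q₂ * |A * θ + B * y₂ + C| + |(A : ℝ)| * |q₂ * θ - p₂| + B * |q₂ * y₂ - r₂| := by
          refine (abs_add_three _ _ _).trans_eq ?_
          rw [abs_neg, abs_neg, abs_mul, abs_mul, abs_mul, abs_of_pos hB, abs_of_pos hq₂]
      _ ≤ W * (2 * X) + W * c + W * c := by gcongr
      _ ≤ 3 * W * X := by nlinarith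
      _ < 1 := hWX
  exact Int.abs_lt_one_iff.1 (by exact_mod_cast h4)

theorem IsMinimalApprox.le_of_proportional {s t θ c : ℝ} (hs : 0 ≤ s) (ht : 0 ≤ t) {q₁ q₂ : ℕ}
    {p₁ r₁ p₂ r₂ : ℤ} {y : ℝ} (hq₁ : 0 < q₁) (hP : IsMinimalApprox s t θ c q₂ p₂ r₂ y)
    (hp : q₁ * p₂ = q₂ * p₁) (hr : q₁ * r₂ = q₂ * r₁) : q₂ ≤ q₁ := by
  by_contra! hlt
  have hq₁' : (0 : ℝ) < q₁ := by exact_mod_cast hq₁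
  have hle : (q₁ : ℝ) ≤ q₂ := by exact_mod_cast hlt.le
  have key : ∀ {u z : ℝ} {a₁ a₂ : ℤ}, 0 ≤ u → q₁ * a₂ = q₂ * a₁ →
      (q₁ : ℝ) ^ u * |q₁ * z - a₁| ≤ (q₂ : ℝ) ^ u * |q₂ * z - a₂| := by
    intro u z a₁ a₂ hu ha
    have ha' : (q₁ : ℝ) * a₂ = q₂ * a₁ := by exact_mod_cast ha
    have h1 : (q₂ : ℝ) * |q₁ * z - a₁| = q₁ * |q₂ * z - a₂| := by
      rw [← abs_of_pos hq₁', ← abs_mul, ← abs_of_pos (hq₁'.trans_le hle), ← abs_mul,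
        abs_of_pos hq₁', abs_of_pos (hq₁'.trans_le hle)]
      congr 1
      linear_combination ha'
    have h2 : |q₁ * z - a₁| ≤ |q₂ * z - a₂| := by
      refine le_of_mul_le_mul_left ?_ (hq₁'.trans_le hle)
      rw [h1]
      gcongr
    gcongr
  have h1 := hP.minimal q₁ hq₁ hlt p₁ r₁ ((key hs hp).trans_lt hP.fst_lt)
  exact absurd ((key ht hr).trans_lt hP.snd_lt) h1.not_gt

theorem eq_or_eq_of_mem_both {s t θ c : ℝ} (hs : 0 ≤ s) (ht : 0 ≤ t) {q₁ q₂ : ℕ}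
    {p₁ r₁ A₁ B₁ C₁ p₂ r₂ A₂ B₂ C₂ : ℤ} {y₁ y₂ : ℝ}
    (hP₁ : IsMinimalApprox s t θ c q₁ p₁ r₁ y₁) (hP₂ : IsMinimalApprox s t θ c q₂ p₂ r₂ y₂)
    (h₁₁ : A₁ * p₁ + B₁ * r₁ + C₁ * q₁ = 0) (h₁₂ : A₁ * p₂ + B₁ * r₂ + C₁ * q₂ = 0)
    (h₂₁ : A₂ * p₁ + B₂ * r₁ + C₂ * q₁ = 0) (h₂₂ : A₂ * p₂ + B₂ * r₂ + C₂ * q₂ = 0) :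
    B₂ * (A₁ * θ + C₁) = B₁ * (A₂ * θ + C₂) ∨ (q₁ = q₂ ∧ p₁ = p₂ ∧ r₁ = r₂) := by
  have hq₁ : (q₁ : ℤ) ≠ 0 := by exact_mod_cast hP₁.pos.ne'
  by_cases h0 : A₁ * B₂ - A₂ * B₁ = 0
  · left
    have h1 : B₂ * C₁ - B₁ * C₂ = 0 := by
      refine (mul_eq_zero.1 (?_ : (B₂ * C₁ - B₁ * C₂) * q₁ = 0)).resolve_right hq₁
      linear_combination B₂ * h₁₁ - B₁ * h₂₁ - p₁ * h0
    have h0' : (A₁ * B₂ - A₂ * B₁ : ℝ) = 0 := by exact_mod_cast h0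
    have h1' : (B₂ * C₁ - B₁ * C₂ : ℝ) = 0 := by exact_mod_cast h1
    linear_combination θ * h0' + h1'
  · right
    have hp : q₁ * p₂ = q₂ * p₁ := by
      refine sub_eq_zero.1
        ((mul_eq_zero.1 (?_ : (A₁ * B₂ - A₂ * B₁) * (q₁ * p₂ - q₂ * p₁) = 0)).resolve_left h0)
      linear_combination q₁ * B₂ * h₁₂ - q₁ * B₁ * h₂₂ - q₂ * B₂ * h₁₁ + q₂ * B₁ * h₂₁
    have hr : q₁ * r₂ = q₂ * r₁ := by
      refine sub_eq_zero.1
        ((mul_eq_zero.1 (?_ : (A₁ * B₂ - A₂ * B₁) * (q₁ * r₂ - q₂ * r₁) = 0)).resolve_left h0)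
      linear_combination -q₁ * A₂ * h₁₂ + q₁ * A₁ * h₂₂ + q₂ * A₂ * h₁₁ - q₂ * A₁ * h₂₁
    have hq : q₁ = q₂ := le_antisymm
      (hP₁.le_of_proportional hs ht hP₂.pos hp.symm hr.symm)
      (hP₂.le_of_proportional hs ht hP₁.pos hp hr)
    subst hq
    exact ⟨rfl, (mul_left_cancel₀ hq₁ hp).symm, (mul_left_cancel₀ hq₁ hr).symm⟩

theorem eq_of_large_excess {s t θ c X W δ β : ℝ} (hs : 0 ≤ s) (ht : 0 ≤ t) (hst : s + t = 1)
    {q₁ q₂ : ℕ} {p₁ r₁ A₁ B₁ C₁ p₂ r₂ A₂ B₂ C₂ : ℤ} {y₁ y₂ : ℝ}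
    (hP₁ : IsMinimalApprox s t θ c q₁ p₁ r₁ y₁) (hP₂ : IsMinimalApprox s t θ c q₂ p₂ r₂ y₂)
    (hL₁ : IsLineThrough s t q₁ p₁ r₁ A₁ B₁ C₁) (hL₂ : IsLineThrough s t q₂ p₂ r₂ A₂ B₂ C₂)
    (hB₁ : β * B₁ ≤ (q₁ : ℝ) ^ t) (hB₂ : β * B₂ ≤ (q₂ : ℝ) ^ t)
    (hδ₀ : 0 ≤ δ) (hy : |y₁ - y₂| ≤ δ) (hδ₁ : q₁ * B₁ * δ ≤ X) (hδ₂ : q₂ * B₂ * δ ≤ X)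
    (hc : 2 * c ≤ X) (hW : 1 ≤ W) (h₁₂ : (q₁ : ℝ) ≤ W * q₂) (h₂₁ : (q₂ : ℝ) ≤ W * q₁)
    (hβ : 2 * W < β) (hc₁ : 4 * W * X / β < c) (hc₂ : 8 * W ^ 2 * X / β ^ t < c) (hc1 : c ≤ 1) :
    B₂ * (A₁ * θ + C₁) = B₁ * (A₂ * θ + C₂) := by
  have hq₁ : (0 : ℝ) < q₁ := by exact_mod_cast hP₁.pos
  have hq₁1 : (1 : ℝ) ≤ q₁ := by exact_mod_cast hP₁.pos
  have hq₂ : (0 : ℝ) < q₂ := by exact_mod_cast hP₂.pos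
  have hB₁' : (0 : ℝ) < B₁ := by exact_mod_cast hL₁.one_le
  have hB₂' : (0 : ℝ) < B₂ := by exact_mod_cast hL₂.one_le
  have hW0 : 0 < W := by linarith
  have hβ0 : 0 < β := by linarith
  have hX : 0 ≤ X := le_trans (by positivity) hδ₁
  have hF₁ := hL₁.mul_abs_le hP₁ (by simpa using hδ₀ : |y₁ - y₁| ≤ δ) hδ₁ hc
  have hF₂ := hL₂.mul_abs_le hP₂ hy hδ₂ hc
  set F₁ := A₁ * θ + B₁ * y₁ + C₁ with hF₁def
  set F₂ := A₂ * θ + B₂ * y₁ + C₂ with hF₂def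
  have hae : (q₁ : ℝ) ^ s * (q₁ : ℝ) ^ t = q₁ := by
    rw [← Real.rpow_add hq₁, hst, Real.rpow_one]
  have ha₂ : (q₂ : ℝ) ^ s ≤ W * (q₁ : ℝ) ^ s :=
    rpow_le_mul_rpow hq₂.le hq₁.le hW h₂₁ hs (by linarith)
  have he₂ : (q₂ : ℝ) ^ t ≤ W * (q₁ : ℝ) ^ t :=
    rpow_le_mul_rpow hq₂.le hq₁.le hW h₂₁ ht (by linarith)
  set a := (q₁ : ℝ) ^ s with ha
  set e := (q₁ : ℝ) ^ t with he
  have ha0 : 0 < a := Real.rpow_pos_of_pos hq₁ s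
  have he0 : 0 < e := Real.rpow_pos_of_pos hq₁ t
  have ha1 : 1 ≤ a := Real.one_le_rpow hq₁1 hs
  have hA₁ : |(A₁ : ℝ)| ≤ a := hL₁.abs_fst_le
  have hA₂ : |(A₂ : ℝ)| ≤ W * a := hL₂.abs_fst_le.trans ha₂
  have hB₁e : (B₁ : ℝ) ≤ e / β := by rw [le_div_iff₀ hβ0]; linarith
  have hB₂e : (B₂ : ℝ) ≤ W * e / β := by rw [le_div_iff₀ hβ0]; linarith
  have hF₁e : |F₁| ≤ 2 * X / q₁ := by rw [le_div_iff₀ hq₁]; linarith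
  have hF₂e : |F₂| ≤ 2 * W * X / q₁ := by
    rw [le_div_iff₀ hq₁]
    calc |F₂| * q₁ ≤ |F₂| * (W * q₂) := by gcongr
      _ = W * (q₂ * |F₂|) := by ring
      _ ≤ W * (2 * X) := by gcongr
      _ = _ := by ring
  set q₀ : ℤ := A₁ * B₂ - A₂ * B₁ with hq₀
  set p₀ : ℤ := B₁ * C₂ - B₂ * C₁ with hp₀
  set r₀ : ℤ := C₁ * A₂ - C₂ * A₁ with hr₀
  have hq₀θ : (q₀ : ℝ) * θ - p₀ = B₂ * F₁ - B₁ * F₂ := by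
    rw [hq₀, hp₀, hF₁def, hF₂def]; push_cast; ring
  have hq₀y : (q₀ : ℝ) * y₁ - r₀ = A₁ * F₂ - A₂ * F₁ := by
    rw [hq₀, hr₀, hF₁def, hF₂def]; push_cast; ring
  have bq : |(q₀ : ℝ)| ≤ 2 * W / β * q₁ :=
    calc |(q₀ : ℝ)| = |(A₁ : ℝ) * B₂ - A₂ * B₁| := by rw [hq₀]; push_cast; rfl
      _ ≤ |(A₁ : ℝ)| * B₂ + |(A₂ : ℝ)| * B₁ := by
        refine (abs_sub _ _).trans_eq ?_
        rw [abs_mul, abs_mul, abs_of_pos hB₁', abs_of_pos hB₂']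
      _ ≤ a * (W * e / β) + W * a * (e / β) := by gcongr
      _ = 2 * W / β * (a * e) := by ring
      _ = _ := by rw [hae]
  have bθ : |(q₀ : ℝ) * θ - p₀| ≤ 4 * W * X / β / a :=
    calc |(q₀ : ℝ) * θ - p₀| ≤ B₂ * |F₁| + B₁ * |F₂| := by
          rw [hq₀θ]
          refine (abs_sub _ _).trans_eq ?_
          rw [abs_mul, abs_mul, abs_of_pos hB₁', abs_of_pos hB₂']
      _ ≤ W * e / β * (2 * X / q₁) + e / β * (2 * W * X / q₁) := by gcongr
      _ = 4 * W * X / β * (e / q₁) := by ring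
      _ = 4 * W * X / β / a := by rw [← hae]; field_simp
  have by₁ : |(q₀ : ℝ) * y₁ - r₀| ≤ 4 * W * X / e :=
    calc |(q₀ : ℝ) * y₁ - r₀| ≤ |(A₁ : ℝ)| * |F₂| + |(A₂ : ℝ)| * |F₁| := by
          rw [hq₀y]
          refine (abs_sub _ _).trans_eq ?_
          rw [abs_mul, abs_mul]
      _ ≤ a * (2 * W * X / q₁) + W * a * (2 * X / q₁) := by gcongr
      _ = 4 * W * X * (a / q₁) := by ring
      _ = 4 * W * X / e := by rw [← hae]; field_simp
  have hzero : (q₀ : ℝ) * θ - p₀ = 0 := by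
    rcases eq_or_ne q₀ 0 with h0 | h0
    · have h1 : |(p₀ : ℝ)| < 1 :=
        calc |(p₀ : ℝ)| = |(q₀ : ℝ) * θ - p₀| := by simp [h0]
          _ ≤ 4 * W * X / β / a := bθ
          _ ≤ 4 * W * X / β := div_le_self (by positivity) ha1
          _ < 1 := hc₁.trans_le hc1
      have h2 : p₀ = 0 := Int.abs_lt_one_iff.1 (by exact_mod_cast h1)
      simp [h0, h2]
    · exfalso
      obtain ⟨Q, σ, hσ, hQ⟩ : ∃ (Q : ℕ) (σ : ℤ), |(σ : ℝ)| = 1 ∧ (Q : ℤ) = σ * q₀ := by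
        rcases lt_or_gt_of_ne h0 with h | h
        · exact ⟨q₀.natAbs, -1, by simp, by omega⟩
        · exact ⟨q₀.natAbs, 1, by simp, by omega⟩
      have hQ' : (Q : ℝ) = σ * q₀ := by exact_mod_cast hQ
      have hQabs : (Q : ℝ) = |(q₀ : ℝ)| := by
        rw [← abs_of_nonneg (Nat.cast_nonneg (α := ℝ) Q), hQ', abs_mul, hσ, one_mul]
      have hQpos : 0 < Q := by
        have : (0 : ℝ) < Q := by rw [hQabs]; exact abs_pos.2 (by exact_mod_cast h0)
        exact_mod_cast this
      have hQle : (Q : ℝ) ≤ 2 * W / β * q₁ := hQabs ▸ bq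
      have hQlt : (Q : ℝ) < q₁ := hQle.trans_lt (by
        exact mul_lt_of_lt_one_left hq₁ ((div_lt_one hβ0).2 hβ))
      have hθ' : |(Q : ℝ) * θ - (σ * p₀ : ℤ)| = |(q₀ : ℝ) * θ - p₀| := by
        rw [← one_mul |(q₀ : ℝ) * θ - p₀|, ← hσ, ← abs_mul, hQ']
        push_cast
        congr 1
        ring
      have hy' : |(Q : ℝ) * y₁ - (σ * r₀ : ℤ)| = |(q₀ : ℝ) * y₁ - r₀| := by
        rw [← one_mul |(q₀ : ℝ) * y₁ - r₀|, ← hσ, ← abs_mul, hQ']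
        push_cast
        congr 1
        ring
      have hfst : (Q : ℝ) ^ s * |(Q : ℝ) * θ - (σ * p₀ : ℤ)| < c := by
        rw [hθ']
        calc (Q : ℝ) ^ s * |(q₀ : ℝ) * θ - p₀| ≤ a * (4 * W * X / β / a) := by
              gcongr
              exact Real.rpow_le_rpow (Nat.cast_nonneg Q) hQlt.le hs
          _ = 4 * W * X / β := by field_simp
          _ < c := hc₁
      have hsnd := hP₁.minimal Q hQpos (by exact_mod_cast hQlt) _ (σ * r₀) hfst
      rw [hy'] at hsnd
      refine hsnd.not_gt ?_
      calc (Q : ℝ) ^ t * |(q₀ : ℝ) * y₁ - r₀| ≤ (2 * W / β ^ t * e) * (4 * W * X / e) := by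
            gcongr
            calc (Q : ℝ) ^ t ≤ (2 * W / β * q₁) ^ t := Real.rpow_le_rpow (by positivity) hQle ht
              _ = (2 * W) ^ t / β ^ t * e := by
                rw [Real.mul_rpow (by positivity) hq₁.le, Real.div_rpow (by positivity) hβ0.le]
              _ ≤ 2 * W / β ^ t * e := by
                gcongr
                simpa using Real.rpow_le_rpow_of_exponent_le (by linarith : 1 ≤ 2 * W)
                  (show t ≤ 1 by linarith)
        _ = 8 * W ^ 2 * X / β ^ t := by field_simp; ring
        _ < c := hc₂
  rw [hq₀, hp₀] at hzero
  push_cast at hzero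
  linear_combination hzero

theorem eq_or_eq_of_hasSize {s t θ : ℝ} (hs : 0 ≤ s) (ht : 0 ≤ t) (hst : s + t = 1) {κ E : ℕ}
    (hκ : 2 ≤ κ * t) {m n k : ℕ} (hn : n + (E + 3 * κ + 8) = m + k)
    {q₁ q₂ : ℕ} {p₁ r₁ A₁ B₁ C₁ p₂ r₂ A₂ B₂ C₂ : ℤ} {y₁ y₂ : ℝ}
    (hP₁ : IsMinimalApprox s t θ (1 / (4 * 16 ^ (E + 3 * κ + 8 + E))) q₁ p₁ r₁ y₁)
    (hP₂ : IsMinimalApprox s t θ (1 / (4 * 16 ^ (E + 3 * κ + 8 + E))) q₂ p₂ r₂ y₂)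
    (hL₁ : IsLineThrough s t q₁ p₁ r₁ A₁ B₁ C₁) (hL₂ : IsLineThrough s t q₂ p₂ r₂ A₂ B₂ C₂)
    (hS₁ : HasSize t (16 ^ κ) n k q₁ B₁) (hS₂ : HasSize t (16 ^ κ) n k q₂ B₂)
    (hy : |y₁ - y₂| ≤ 1 / 16 ^ m) :
    B₂ * (A₁ * θ + C₁) = B₁ * (A₂ * θ + C₂) ∨ (q₁ = q₂ ∧ p₁ = p₂ ∧ r₁ = r₂) := by
  have hb : (1 : ℝ) ≤ 16 ^ κ := one_le_pow₀ (by norm_num)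
  have h₁₂ := hS₁.le_mul ht hb hP₁.pos hL₁.one_le hL₂.one_le hS₂
  have h₂₁ := hS₂.le_mul ht hb hP₂.pos hL₂.one_le hL₁.one_le hS₁
  have hX : ∀ {q : ℕ} {B : ℤ}, HasSize t (16 ^ κ) n k q B →
      (q : ℝ) * B * (1 / 16 ^ m) ≤ 16 ^ (k + 1) / 16 ^ (E + 3 * κ + 8) := by
    intro q B hS
    calc (q : ℝ) * B * (1 / 16 ^ m) ≤ 16 ^ (n + 1) * (1 / 16 ^ m) := by
          gcongr
          exact hS.lt_pow.le
      _ = 16 ^ (k + 1) / 16 ^ (E + 3 * κ + 8) := by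
          rw [mul_one_div, div_eq_div_iff (by positivity) (by positivity), ← pow_add, ← pow_add]
          congr 1
          omega
  have hc : 2 * (1 / (4 * 16 ^ (E + 3 * κ + 8 + E)) : ℝ) ≤
      16 ^ (k + 1) / 16 ^ (E + 3 * κ + 8) := by
    rw [mul_one_div, div_le_div_iff₀ (by positivity) (by positivity)]
    have h1 : (16 : ℝ) ^ (E + 3 * κ + 8) ≤ 16 ^ (k + 1) * 16 ^ (E + 3 * κ + 8 + E) := by
      rw [← pow_add]
      exact pow_le_pow_right₀ (by norm_num) (by omega)
    have h2 : (0 : ℝ) < 16 ^ (E + 3 * κ + 8) := by positivity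
    linarith
  have hW : (1 : ℝ) ≤ 16 * 16 ^ κ := by linarith
  have hκ2 : 2 ≤ κ := by
    have : (2 : ℝ) ≤ κ := hκ.trans (mul_le_of_le_one_right (Nat.cast_nonneg κ) (by linarith))
    exact_mod_cast this
  rcases le_or_gt k (E + 2 * κ + 4) with hk | hk
  · have hWX : 3 * (16 * 16 ^ κ) * (16 ^ (k + 1) / 16 ^ (E + 3 * κ + 8)) < (1 : ℝ) := by
      rw [← mul_div_assoc, div_lt_one (by positivity)]
      calc (3 * (16 * 16 ^ κ) * 16 ^ (k + 1) : ℝ) < 16 * (16 * 16 ^ κ) * 16 ^ (k + 1) := by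
            gcongr
            norm_num
        _ = 16 ^ (κ + k + 3) := by ring
        _ ≤ 16 ^ (E + 3 * κ + 8) := pow_le_pow_right₀ (by norm_num) (by omega)
    exact eq_or_eq_of_mem_both hs ht hP₁ hP₂ hL₁.eq_zero
      (hL₁.eq_zero_of_close hs ht hst hP₁ hP₂ (abs_sub_comm y₁ y₂ ▸ hy) (hX hS₁) hc hW h₁₂ h₂₁ hWX)
      (hL₂.eq_zero_of_close hs ht hst hP₂ hP₁ hy (hX hS₂) hc hW h₂₁ h₁₂ hWX)
      hL₂.eq_zero
  · left
    have hβ : (2 * (16 * 16 ^ κ) : ℝ) < (16 ^ κ) ^ k :=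
      calc (2 * (16 * 16 ^ κ) : ℝ) < 16 * (16 * 16 ^ κ) := by gcongr; norm_num
        _ = 16 ^ (κ + 2) := by ring
        _ ≤ 16 ^ (κ * k) := pow_le_pow_right₀ (by norm_num) (by nlinarith)
        _ = _ := pow_mul _ _ _
    have hβt : (16 : ℝ) ^ (2 * k) ≤ ((16 ^ κ) ^ k : ℝ) ^ t := by
      rw [← pow_mul, ← Real.rpow_natCast, ← Real.rpow_natCast, ← Real.rpow_mul (by norm_num)]
      refine Real.rpow_le_rpow_of_exponent_le (by norm_num) ?_
      push_cast
      nlinarith [(Nat.cast_nonneg k : (0 : ℝ) ≤ k)]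
    have hβ1 : (16 : ℝ) ^ (2 * k) ≤ (16 ^ κ) ^ k := by
      rw [← pow_mul]
      exact pow_le_pow_right₀ (by norm_num) (Nat.mul_le_mul_right k hκ2)
    have key : 8 * (16 * 16 ^ κ) ^ 2 * (16 ^ (k + 1) / 16 ^ (E + 3 * κ + 8)) / 16 ^ (2 * k) <
        (1 / (4 * 16 ^ (E + 3 * κ + 8 + E)) : ℝ) := by
      rw [← mul_div_assoc, div_div, div_lt_div_iff₀ (by positivity) (by positivity)]
      calc (8 * (16 * 16 ^ κ) ^ 2 * 16 ^ (k + 1) * (4 * 16 ^ (E + 3 * κ + 8 + E)) : ℝ)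
          = 2 * 16 ^ (2 * κ + k + 4 + (E + 3 * κ + 8 + E)) := by ring
        _ < 16 * 16 ^ (2 * κ + k + 4 + (E + 3 * κ + 8 + E)) := by gcongr; norm_num
        _ = 16 ^ (2 * κ + k + 5 + (E + 3 * κ + 8 + E)) := by ring
        _ ≤ 16 ^ (E + 3 * κ + 8 + 2 * k) := pow_le_pow_right₀ (by norm_num) (by omega)
        _ = 1 * (16 ^ (E + 3 * κ + 8) * 16 ^ (2 * k)) := by rw [one_mul, pow_add]
    refine eq_of_large_excess hs ht hst hP₁ hP₂ hL₁ hL₂ hS₁.pow_mul_le hS₂.pow_mul_le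
      (by positivity) hy (hX hS₁) (hX hS₂) hc hW h₁₂ h₂₁ hβ (lt_of_le_of_lt ?_ key)
      (lt_of_le_of_lt ?_ key) ?_
    · gcongr
      · norm_num
      · exact le_self_pow₀ hW two_ne_zero
    · gcongr
    · rw [div_le_one (by positivity)]
      have : (1 : ℝ) ≤ 16 ^ (E + 3 * κ + 8 + E) := one_le_pow₀ (by norm_num)
      linarith

theorem mem_badPair_of_le {s t c : ℝ} {z : ℝ × ℝ} (hc : 0 < c)
    (h : ∀ q : ℕ, 0 < q → ∀ p r : ℤ, (q : ℝ) ^ s * |q * z.1 - p| < c →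
      c ≤ (q : ℝ) ^ t * |q * z.2 - r|) : z ∈ badPair s t := by
  refine hc.trans_le (le_ciInf fun q => ?_)
  rw [le_max_iff]
  by_contra! hlt
  exact (h q q.pos _ _ hlt.1).not_gt hlt.2

theorem exists_isMinimalApprox {s t θ c y : ℝ} (hc : 0 < c) (h : (θ, y) ∉ badPair s t) :
    ∃ (q : ℕ) (p r : ℤ), IsMinimalApprox s t θ c q p r y := by
  classical
  have hex : ∃ q : ℕ, 0 < q ∧ ∃ p r : ℤ, (q : ℝ) ^ s * |q * θ - p| < c ∧
      (q : ℝ) ^ t * |q * y - r| < c := by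
    by_contra! hno
    exact h (mem_badPair_of_le hc hno)
  obtain ⟨hpos, p, r, hp, hr⟩ := Nat.find_spec hex
  refine ⟨Nat.find hex, p, r, hpos, hp, hr, fun q' hq' hlt p' r' hp' => ?_⟩
  by_contra! hr'
  exact Nat.find_min hex hlt ⟨hq', p', r', hp', hr'⟩

theorem IsLineThrough.exists_hasSize {s t : ℝ} (ht1 : t ≤ 1) {κ q : ℕ} (hκ : 1 ≤ κ)
    (hq : 0 < q) {p r A B C : ℤ} (hL : IsLineThrough s t q p r A B C) :
    ∃ n k : ℕ, k ≤ n ∧ HasSize t (16 ^ κ) n k q B := by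
  have hq1 : (1 : ℝ) ≤ q := by exact_mod_cast hq
  have hB1 : (1 : ℝ) ≤ B := by exact_mod_cast hL.one_le
  have hB0 : (0 : ℝ) < B := by linarith
  obtain ⟨n, hn, hn'⟩ := exists_nat_pow_near (show (1 : ℝ) ≤ q * B by nlinarith)
    (show (1 : ℝ) < 16 by norm_num)
  obtain ⟨k, hk, hk'⟩ := exists_nat_pow_near ((one_le_div hB0).2 hL.snd_le)
    (show (1 : ℝ) < 16 ^ κ from one_lt_pow₀ (by norm_num) (by omega))
  refine ⟨n, k, ?_, hn, hn', (le_div_iff₀ hB0).1 hk, (div_lt_iff₀ hB0).1 hk'⟩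
  have h1 : (16 : ℝ) ^ k < 16 ^ (n + 1) :=
    calc (16 : ℝ) ^ k ≤ 16 ^ (κ * k) :=
          pow_le_pow_right₀ (by norm_num) (Nat.le_mul_of_pos_left k hκ)
      _ = (16 ^ κ) ^ k := pow_mul _ _ _
      _ ≤ (q : ℝ) ^ t / B := hk
      _ ≤ (q : ℝ) ^ t := div_le_self (by positivity) hB1
      _ ≤ q := by simpa using Real.rpow_le_rpow_of_exponent_le hq1 ht1
      _ ≤ q * B := le_mul_of_one_le_right (by linarith) hB1
      _ < 16 ^ (n + 1) := hn'
  exact Nat.lt_succ_iff.1 ((pow_lt_pow_iff_right₀ (by norm_num)).1 h1)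

theorem exists_obstacles_of_pos {s t θ : ℝ} (hs : 0 ≤ s) (ht : 0 < t) (hst : s + t = 1)
    (hθ : ∀ A C : ℤ, A ≠ 0 → 1 / 4 ≤ |(A : ℝ)| * |A * θ + C|) (E : ℕ) :
    ∃ x : ℕ → ℤ → ℕ → ℝ, ∀ (y : ℝ) (a : ℕ → ℤ),
      (∀ m, (a m : ℝ) / 16 ^ m ≤ y ∧ y ≤ (a m + 1) / 16 ^ m) →
      (∀ m k, 1 / 16 ^ (m + (E + k)) < |y - x m (a m) k|) → (θ, y) ∈ badPair s t := by
  obtain ⟨κ, hκ⟩ := exists_nat_ge (2 / t)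
  rw [div_le_iff₀ ht] at hκ
  have hκ1 : 1 ≤ κ := by
    by_contra! h
    obtain rfl : κ = 0 := by omega
    norm_num at hκ
  set g := E + 3 * κ + 8 with hg
  set c : ℝ := 1 / (4 * 16 ^ (g + E)) with hc
  have hc0 : 0 < c := by positivity
  have hc4 : c ≤ 1 / 4 := one_div_le_one_div_of_le (by norm_num)
    (le_mul_of_one_le_right (by norm_num) (one_le_pow₀ (by norm_num)))
  have hex : ∀ (q : ℕ) (p r : ℤ), ∃ L : ℤ × ℤ × ℤ, 0 < q → (q : ℝ) ^ s * |q * θ - p| < c →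
      IsLineThrough s t q p r L.1 L.2.1 L.2.2 := by
    intro q p r
    by_cases h : 0 < q ∧ (q : ℝ) ^ s * |q * θ - p| < c
    · obtain ⟨A, B, C, hL⟩ := exists_isLineThrough ht.le hst hθ h.1 r (h.2.trans_le hc4)
      exact ⟨(A, B, C), fun _ _ => hL⟩
    · exact ⟨0, fun h1 h2 => absurd ⟨h1, h2⟩ h⟩
  choose L hL using hex
  have hobs : ∀ (m : ℕ) (a : ℤ) (k : ℕ), ∃ x : ℝ, ∀ (y : ℝ) (q : ℕ) (p r : ℤ) (n : ℕ),
      (a : ℝ) / 16 ^ m ≤ y → y ≤ (a + 1) / 16 ^ m → n + g = m + k →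
      IsMinimalApprox s t θ c q p r y → HasSize t (16 ^ κ) n k q (L q p r).2.1 →
      |y - x| ≤ 1 / 16 ^ (m + (E + k)) := by
    intro m a k
    by_cases h : ∃ (y : ℝ) (q : ℕ) (p r : ℤ) (n : ℕ), (a : ℝ) / 16 ^ m ≤ y ∧
      y ≤ (a + 1) / 16 ^ m ∧ n + g = m + k ∧ IsMinimalApprox s t θ c q p r y ∧
      HasSize t (16 ^ κ) n k q (L q p r).2.1
    · obtain ⟨y₂, q₂, p₂, r₂, n₂, hy₂, hy₂', hn₂, hP₂, hS₂⟩ := h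
      refine ⟨-((L q₂ p₂ r₂).1 * θ + (L q₂ p₂ r₂).2.2) / (L q₂ p₂ r₂).2.1, ?_⟩
      intro y q p r n hy hy' hn hP hS
      obtain rfl : n = n₂ := by omega
      have hL₁ := hL q p r hP.pos hP.fst_lt
      have hL₂ := hL q₂ p₂ r₂ hP₂.pos hP₂.fst_lt
      have hdist : |y - y₂| ≤ 1 / 16 ^ m := by
        rw [add_div] at hy' hy₂'
        rw [abs_le]
        constructor <;> linarith
      have heq : (L q₂ p₂ r₂).2.1 * ((L q p r).1 * θ + (L q p r).2.2) =
          (L q p r).2.1 * ((L q₂ p₂ r₂).1 * θ + (L q₂ p₂ r₂).2.2) := by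
        rcases eq_or_eq_of_hasSize hs ht.le hst hκ hn hP hP₂ hL₁ hL₂ hS hS₂ hdist with h | h
        · exact h
        · obtain ⟨rfl, rfl, rfl⟩ := h
          rfl
      have hB₁ : (0 : ℝ) < (L q p r).2.1 := by exact_mod_cast hL₁.one_le
      have hB₂ : (0 : ℝ) < (L q₂ p₂ r₂).2.1 := by exact_mod_cast hL₂.one_le
      have hq : (0 : ℝ) < q := by exact_mod_cast hP.pos
      have hF := hL₁.mul_abs_le (X := 2 * c) (δ := 0) hP (z := y) (by simp)
        (by rw [mul_zero]; positivity) le_rfl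
      have hrepr : ((L q p r).1 * θ + (L q p r).2.1 * y + (L q p r).2.2 : ℝ) =
          (L q p r).2.1 *
            (y - -((L q₂ p₂ r₂).1 * θ + (L q₂ p₂ r₂).2.2) / (L q₂ p₂ r₂).2.1) := by
        field_simp
        linear_combination heq
      rw [hrepr, abs_mul, abs_of_pos hB₁, ← mul_assoc] at hF
      set D := |y - -((L q₂ p₂ r₂).1 * θ + (L q₂ p₂ r₂).2.2) / (L q₂ p₂ r₂).2.1| with hD
      have h1 : 16 ^ n * D ≤ 2 * (2 * c) :=
        (mul_le_mul_of_nonneg_right hS.pow_le (abs_nonneg _)).trans hF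
      have h2 : m + (E + k) = n + (g + E) := by omega
      rw [h2, pow_add, le_div_iff₀ (by positivity)]
      calc D * (16 ^ n * 16 ^ (g + E)) = 16 ^ n * D * 16 ^ (g + E) := by ring
        _ ≤ 2 * (2 * c) * 16 ^ (g + E) := by gcongr
        _ = 1 := by rw [hc]; field_simp; norm_num
    · refine ⟨0, fun y q p r n h1 h2 h3 h4 h5 => absurd ?_ h⟩
      exact ⟨y, q, p, r, n, h1, h2, h3, h4, h5⟩
  choose x hx using hobs
  refine ⟨x, fun y a hy hav => ?_⟩
  by_contra hbad
  obtain ⟨q, p, r, hP⟩ := exists_isMinimalApprox hc0 hbad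
  obtain ⟨n, k, hkn, hS⟩ := (hL q p r hP.pos hP.fst_lt).exists_hasSize (by linarith) hκ1 hP.pos
  have hm : n + g = (n + g - k) + k := by omega
  exact (hx _ _ k y q p r n (hy _).1 (hy _).2 hm hP hS).not_gt (hav _ k)

theorem exists_obstacles {s t θ : ℝ} (hs : 0 ≤ s) (ht : 0 ≤ t) (hst : s + t = 1)
    (hθ : ∀ A C : ℤ, A ≠ 0 → 1 / 4 ≤ |(A : ℝ)| * |A * θ + C|) (E : ℕ) :
    ∃ x : ℕ → ℤ → ℕ → ℝ, ∀ (y : ℝ) (a : ℕ → ℤ),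
      (∀ m, (a m : ℝ) / 16 ^ m ≤ y ∧ y ≤ (a m + 1) / 16 ^ m) →
      (∀ m k, 1 / 16 ^ (m + (E + k)) < |y - x m (a m) k|) → (θ, y) ∈ badPair s t := by
  rcases ht.eq_or_lt with rfl | ht'
  · obtain rfl : s = 1 := by linarith
    refine ⟨0, fun y a _ _ => mem_badPair_of_le (c := 1 / 4) (by norm_num) ?_⟩
    intro q hq p r hlt
    have h1 := hθ q (-p) (by exact_mod_cast hq.ne')
    push_cast at h1
    rw [abs_of_nonneg (Nat.cast_nonneg q), ← sub_eq_add_neg] at h1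
    rw [Real.rpow_one] at hlt
    exact absurd hlt h1.not_gt
  · exact exists_obstacles_of_pos hs ht' hst hθ E

theorem one_div_four_le_mul_abs_sqrt_two (A C : ℤ) (hA : A ≠ 0) :
    1 / 4 ≤ |(A : ℝ)| * |A * √2 + C| := by
  have hA1 : (1 : ℝ) ≤ |(A : ℝ)| := by exact_mod_cast Int.one_le_abs hA
  have h2 : √2 ^ 2 = 2 := Real.sq_sqrt (by norm_num)
  have h3 : √2 ≤ 3 / 2 := Real.sqrt_le_iff.2 (by norm_num)
  rcases le_or_gt 1 |A * √2 + C| with h | h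
  · nlinarith
  · have hne : 2 * A ^ 2 - C ^ 2 ≠ 0 := by
      intro h0
      have h0' : 2 * (A : ℝ) ^ 2 = C ^ 2 := by exact_mod_cast sub_eq_zero.1 h0
      have hA0 : (A : ℝ) ≠ 0 := by exact_mod_cast hA
      refine irrational_sqrt_two ⟨|(C : ℚ) / A|, ?_⟩
      push_cast
      symm
      rw [Real.sqrt_eq_iff_mul_self_eq (by norm_num) (abs_nonneg _), abs_mul_abs_self]
      field_simp
      linarith
    have h4 : (1 : ℝ) ≤ |2 * (A : ℝ) ^ 2 - C ^ 2| := by exact_mod_cast Int.one_le_abs hne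
    have h5 : 2 * (A : ℝ) ^ 2 - C ^ 2 = (A * √2 + C) * (2 * (A * √2) - (A * √2 + C)) := by
      linear_combination -(A : ℝ) ^ 2 * h2
    have h6 : |2 * (A * √2) - (A * √2 + C)| ≤ 4 * |(A : ℝ)| :=
      calc |2 * (A * √2) - (A * √2 + C)| ≤ |2 * (A * √2)| + |A * √2 + C| := abs_sub _ _
        _ ≤ 2 * (|(A : ℝ)| * (3 / 2)) + |(A : ℝ)| := by
          rw [abs_mul, abs_mul, abs_two, abs_of_nonneg (Real.sqrt_nonneg 2)]
          exact add_le_add (by gcongr) (h.le.trans hA1)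
        _ = 4 * |(A : ℝ)| := by ring
    rw [h5, abs_mul] at h4
    nlinarith [abs_nonneg (A * √2 + C)]

theorem tsum_inv_four_pow_le :
    ∑' i : ℕ × ℕ, ((4 : ENNReal) ^ (i.1 + 3 + i.2))⁻¹ ≤ 1 / 16 := by
  have h : ∑' k : ℕ, ((4 : ENNReal)⁻¹) ^ k ≤ 2 := by
    rw [ENNReal.tsum_geometric]
    rw [ENNReal.inv_le_iff_inv_le]
    refine ENNReal.le_sub_of_add_le_right (by simp) ?_
    rw [← ENNReal.toReal_le_toReal (by finiteness) (by finiteness),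
      ENNReal.toReal_add (by finiteness) (by finiteness)]
    norm_num
  calc ∑' i : ℕ × ℕ, ((4 : ENNReal) ^ (i.1 + 3 + i.2))⁻¹
      = ∑' i : ℕ × ℕ, (4⁻¹ ^ 3) * (4⁻¹ ^ i.1 * (4 : ENNReal)⁻¹ ^ i.2) := by
        refine tsum_congr fun i => ?_
        rw [ENNReal.inv_pow, pow_add, pow_add]
        ring
    _ = 4⁻¹ ^ 3 * ((∑' k : ℕ, ((4 : ENNReal)⁻¹) ^ k) * ∑' k : ℕ, ((4 : ENNReal)⁻¹) ^ k) := by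
        rw [ENNReal.tsum_mul_left, ENNReal.tsum_prod (f := fun i j => 4⁻¹ ^ i * 4⁻¹ ^ j)]
        simp_rw [ENNReal.tsum_mul_left, ENNReal.tsum_mul_right]
    _ ≤ 4⁻¹ ^ 3 * (2 * 2) := by gcongr
    _ = 1 / 16 := by
        rw [← ENNReal.toReal_eq_toReal_iff' (by finiteness) (by finiteness)]
        norm_num

/-- For any countable collection of pairs `(sₙ, tₙ)` with `sₙ, tₙ ≥ 0` and `sₙ + tₙ = 1`,
the intersection `⋂ₙ Bad(sₙ, tₙ)` is nonempty. -/
theorem iInter_badPair_nonempty (st : ℕ → ℝ × ℝ)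
    (h : ∀ n : ℕ, 0 ≤ (st n).1 ∧ 0 ≤ (st n).2 ∧ (st n).1 + (st n).2 = 1) :
    (⋂ n : ℕ, badPair (st n).1 (st n).2).Nonempty := by
  choose x hx using fun n => exists_obstacles (h n).1 (h n).2.1 (h n).2.2
    one_div_four_le_mul_abs_sqrt_two (n + 3)
  obtain ⟨y, a, hy⟩ := exists_avoids_obstacles (fun i : ℕ × ℕ => i.1 + 3 + i.2)
    (fun m b i => x i.1 m b i.2) tsum_inv_four_pow_le
  exact ⟨(√2, y), Set.mem_iInter.2 fun n =>
    hx n y a (fun m => (hy m).1) fun m k => (hy m).2 (n, k)⟩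
end

section
/- For any countable collection of pairs of real numbers (sₙ, tₙ), n ∈ ℕ, with sₙ, tₙ ≥ 0 and sₙ + tₙ = 1 for every n, the intersection ⋂_{n∈ℕ} Bad(sₙ,tₙ) has full Hausdorff dimension in ℝ²; that is, dim_H( ⋂_{n∈ℕ} Bad(sₙ,tₙ) ) = 2. -/
open Metric Filter

/-- By the pigeonhole principle, every rational point `(p / q, r / q)` lies on a line
`A x + B y + C = 0` with integer coefficients satisfying `|A| ≤ q ^ s` and `|B| ≤ q ^ t`. -/
lemma exists_int_line {s t : ℝ} (hst : s + t = 1) (p r : ℤ) {q : ℕ} (hq : 0 < q) :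
    ∃ A B C : ℤ, (A ≠ 0 ∨ B ≠ 0) ∧ A * p + B * r + C * q = 0 ∧
      |(A : ℝ)| ≤ (q : ℝ) ^ s ∧ |(B : ℝ)| ≤ (q : ℝ) ^ t := by
  have hq0 : (0 : ℝ) < q := by exact_mod_cast hq
  set a := ⌊(q : ℝ) ^ s⌋₊
  set b := ⌊(q : ℝ) ^ t⌋₊
  have ha : (a : ℝ) ≤ (q : ℝ) ^ s := Nat.floor_le (by positivity)
  have hb : (b : ℝ) ≤ (q : ℝ) ^ t := Nat.floor_le (by positivity)
  have hcard : q < (a + 1) * (b + 1) := by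
    have h1 : (q : ℝ) ^ s < a + 1 := Nat.lt_floor_add_one _
    have h2 : (q : ℝ) ^ t < b + 1 := Nat.lt_floor_add_one _
    have h3 : (q : ℝ) ^ s * (q : ℝ) ^ t = q := by
      rw [← Real.rpow_add hq0, hst, Real.rpow_one]
    have h4 : (q : ℝ) < (a + 1) * (b + 1) := by
      calc (q : ℝ) = (q : ℝ) ^ s * (q : ℝ) ^ t := h3.symm
        _ < _ := by gcongr
    exact_mod_cast h4
  have hcard' : (Finset.Ico (0 : ℤ) q).card <
      (Finset.range (a + 1) ×ˢ Finset.range (b + 1)).card := by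
    simpa using hcard
  obtain ⟨⟨u, v⟩, huv, ⟨u', v'⟩, huv', hne, heq⟩ :=
    Finset.exists_ne_map_eq_of_card_lt_of_maps_to hcard'
      (f := fun z : ℕ × ℕ => ((z.1 : ℤ) * p + z.2 * r) % q) (by
        intro z _
        have : (0 : ℤ) < q := by exact_mod_cast hq
        simp only [Finset.coe_Ico, Set.mem_Ico]
        exact ⟨Int.emod_nonneg _ this.ne', Int.emod_lt_of_pos _ this⟩)
  simp only [Finset.mem_product, Finset.mem_range] at huv huv'
  obtain ⟨k, hk⟩ := Int.ModEq.dvd (show _ ≡ _ [ZMOD q] from heq)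
  have key : ∀ {m m' n : ℕ} {w : ℝ}, m < n + 1 → m' < n + 1 → (n : ℝ) ≤ w →
      |(((m' : ℤ) - m : ℤ) : ℝ)| ≤ w := by
    intro m m' n w hm hm' hw
    have h1 : (m : ℝ) ≤ n := by exact_mod_cast Nat.lt_succ_iff.mp hm
    have h2 : (m' : ℝ) ≤ n := by exact_mod_cast Nat.lt_succ_iff.mp hm'
    have h3 : (0 : ℝ) ≤ m := by positivity
    have h4 : (0 : ℝ) ≤ m' := by positivity
    push_cast
    rw [abs_le]
    constructor <;> linarith
  refine ⟨u' - u, v' - v, -k, ?_, ?_, key huv.1 huv'.1 ha, key huv.2 huv'.2 hb⟩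
  · by_contra! hcon
    apply hne
    ext <;> simp <;> omega
  · simp only at hk
    linear_combination hk

/-- The box around `(p / q, r / q)` in which `max (q ^ s ‖q x‖) (q ^ t ‖q y‖) < c` is
witnessed by the integers `p` and `r`. -/
def dangerBox (s t c : ℝ) (p r : ℤ) (q : ℕ) : Set (ℝ × ℝ) :=
  {z | (q : ℝ) ^ s * |q * z.1 - p| < c ∧ (q : ℝ) ^ t * |q * z.2 - r| < c}

lemma mem_badPair_of_forall_notMem_dangerBox {s t c : ℝ} (hc : 0 < c) {z : ℝ × ℝ}
    (h : ∀ (p r : ℤ) (q : ℕ), 0 < q → z ∉ dangerBox s t c p r q) : z ∈ badPair s t := by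
  refine hc.trans_le (le_ciInf fun q => ?_)
  by_contra! hlt
  exact h (round ((q : ℕ) * z.1)) (round ((q : ℕ) * z.2)) q q.pos
    ⟨(le_max_left _ _).trans_lt hlt, (le_max_right _ _).trans_lt hlt⟩

lemma abs_mul_sub_mul_le_rpow {R a b a' b' u v u' v' w : ℝ} (hR : 2 ≤ R)
    (ha : |a| ≤ R ^ u) (hb : |b| ≤ R ^ v) (ha' : |a'| ≤ R ^ u') (hb' : |b'| ≤ R ^ v')
    (h : u + v + 1 ≤ w) (h' : u' + v' + 1 ≤ w) : |a * b - a' * b'| ≤ R ^ w := by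
  have hR0 : 0 < R := by linarith
  have aux : ∀ {a b u v : ℝ}, |a| ≤ R ^ u → |b| ≤ R ^ v → u + v + 1 ≤ w →
      |a * b| ≤ R ^ (w - 1) := by
    intro a b u v ha hb h
    rw [abs_mul]
    calc |a| * |b| ≤ R ^ u * R ^ v := by gcongr
      _ = R ^ (u + v) := (Real.rpow_add hR0 _ _).symm
      _ ≤ R ^ (w - 1) := Real.rpow_le_rpow_of_exponent_le (by linarith) (by linarith)
  calc |a * b - a' * b'| ≤ |a * b| + |a' * b'| := abs_sub _ _
    _ ≤ R ^ (w - 1) + R ^ (w - 1) := add_le_add (aux ha hb h) (aux ha' hb' h')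
    _ = 2 * R ^ (w - 1) := by ring
    _ ≤ R * R ^ (w - 1) := by gcongr
    _ = R ^ w := by
      nth_rewrite 1 [← Real.rpow_one R]
      rw [← Real.rpow_add hR0]
      congr 1; ring

/-- The inequalities between exponents behind `cross_eq_zero`. -/
lemma cross_exponents {s t γ n ℓ m x₁ x₂ y₁ : ℝ} (hs : 1 / 2 ≤ s) (ht : 0 ≤ t)
    (hst : s + t = 1) (hγ : 0 ≤ γ) (hm : ℓ + 16 ≤ m) (hℓ : 0 ≤ ℓ)
    (hx₁ : 0 ≤ x₁) (hy₁ : 0 ≤ y₁) (hn₁ : x₁ + y₁ ≤ n - γ + 1)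
    (hl₁ : m ≤ s * ((1 + s) * x₁ - (n - γ))) (hu₁ : s * ((1 + s) * x₁ - (n - γ)) < m + 1)
    (hl₂ : m ≤ s * ((1 + s) * x₂ - (n - γ))) (hu₂ : s * ((1 + s) * x₂ - (n - γ)) < m + 1) :
    (x₁ - x₂ < 2 ∧ x₂ - x₁ < 2) ∧ t * x₂ ≤ t * x₁ + 2 ∧ t * x₁ = x₁ - s * x₁ ∧
    ℓ - γ + 6 - s * x₁ < 0 ∧ 2 * (n - γ) - 2 * x₁ + ℓ - n + 7 < 0 ∧
    (n - γ + 4 - s * x₁) * s + (ℓ - γ + 6 - s * x₁) < -γ - 1 ∧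
    (n - γ + 4 - s * x₁) * t + (2 * (n - γ) - 2 * x₁ + ℓ - n + 7) < -γ - 1 ∧
    (n - γ + 4 - s * x₁) * (1 + s) ≤ n - ℓ - γ := by
  have hs0 : 0 < s := by linarith
  have hss : 3 / 4 ≤ s * (1 + s) := by nlinarith
  obtain ⟨k, hk⟩ : ∃ k, k = s * (1 + s) := ⟨_, rfl⟩
  have hdiff : s * ((1 + s) * x₁ - (n - γ)) - s * ((1 + s) * x₂ - (n - γ)) = k * (x₁ - x₂) := by
    rw [hk]; ring
  rw [← hk] at hss
  have hd₁ : x₁ - x₂ < 2 := by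
    by_contra! hcon
    nlinarith
  have hd₂ : x₂ - x₁ < 2 := by
    by_contra! hcon
    nlinarith
  have htd₂ : t * x₂ ≤ t * x₁ + 2 := by
    have : t * (x₂ - x₁) ≤ 1 * 2 := by
      calc t * (x₂ - x₁) ≤ t * 2 := by gcongr
        _ ≤ 1 * 2 := by gcongr; linarith
    linarith
  have hts : t = 1 - s := by linarith
  have htx : t * x₁ = x₁ - s * x₁ := by rw [hts]; ring
  obtain ⟨e, he⟩ : ∃ e, e = (1 + s) * x₁ - (n - γ) := ⟨_, rfl⟩
  obtain ⟨P, hP⟩ : ∃ P, P = s * x₁ := ⟨_, rfl⟩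
  obtain ⟨E, hE⟩ : ∃ E, E = s * e := ⟨_, rfl⟩
  rw [← he, ← hE] at hl₁ hu₁
  have he0 : 0 ≤ e := by
    by_contra! hcon
    nlinarith
  have hEe : E ≤ e := by rw [hE]; nlinarith
  have heP : e = x₁ + P - (n - γ) := by rw [he, hP]; ring
  have hEP : E = P + s * P - s * (n - γ) := by rw [hE, heP, hP]; ring
  have hPx : P ≤ x₁ := by rw [hP]; nlinarith
  have hP0 : 0 ≤ P := by rw [hP]; positivity
  have hEP' : E ≤ P + 1 := by
    have h1 : E = s * P + s * (x₁ - (n - γ)) := by rw [hE, heP]; ring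
    have h2 : s * P ≤ 1 * P := by gcongr; linarith
    have h3 : s * (x₁ - (n - γ)) ≤ s * 1 := by gcongr; linarith
    linarith
  have h1 : (n - γ + 4 - P) * s = 4 * s + P - E := by rw [hEP]; ring
  rw [← hP] at htx ⊢
  refine ⟨⟨hd₁, hd₂⟩, htd₂, htx, by linarith, by linarith, by linarith, ?_, ?_⟩
  · rw [hts, mul_sub, h1]; linarith
  · rw [mul_add, h1]; linarith

/-- Two lines attached to dangerous points of comparable, large denominators which both come
close to a point `z` coincide, provided that `z` avoids the boxes around the rational points of
small denominator. Here `R ^ x₁, R ^ x₂` are the denominators and `R ^ y₁, R ^ y₂` the sizes of the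
coefficients. -/
lemma cross_eq_zero {R s t γ n ℓ m x₁ x₂ y₁ y₂ : ℝ} (hR : 2 ≤ R) (hs : 1 / 2 ≤ s) (ht : 0 ≤ t)
    (hst : s + t = 1) (hγ : 0 ≤ γ) (hm : ℓ + 16 ≤ m) (hℓ : 0 ≤ ℓ)
    (hx₁ : 0 ≤ x₁) (hy₁ : 0 ≤ y₁) (hn₁ : x₁ + y₁ ≤ n - γ + 1) (hn₂ : x₂ + y₂ ≤ n - γ + 1)
    (hl₁ : m ≤ s * ((1 + s) * x₁ - (n - γ))) (hu₁ : s * ((1 + s) * x₁ - (n - γ)) < m + 1)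
    (hl₂ : m ≤ s * ((1 + s) * x₂ - (n - γ))) (hu₂ : s * ((1 + s) * x₂ - (n - γ)) < m + 1)
    {A₁ B₁ C₁ A₂ B₂ C₂ : ℤ} (hA₁ : |(A₁ : ℝ)| ≤ R ^ y₁) (hA₂ : |(A₂ : ℝ)| ≤ R ^ y₂)
    (hB₁ : |(B₁ : ℝ)| ≤ R ^ (t * x₁)) (hB₂ : |(B₂ : ℝ)| ≤ R ^ (t * x₂)) {z : ℝ × ℝ}
    (hL₁ : |A₁ * z.1 + B₁ * z.2 + C₁| ≤ R ^ (y₁ + 2 + ℓ - n))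
    (hL₂ : |A₂ * z.1 + B₂ * z.2 + C₂| ≤ R ^ (y₂ + 2 + ℓ - n))
    (hz : ∀ (p r : ℤ) (q : ℕ), 0 < q → (q : ℝ) ^ (1 + s) ≤ R ^ (n - ℓ - γ) →
      z ∉ dangerBox s t (R ^ (-γ) / 2) p r q) :
    A₁ * B₂ - A₂ * B₁ = 0 ∧ B₁ * C₂ - C₁ * B₂ = 0 ∧ C₁ * A₂ - A₁ * C₂ = 0 := by
  have hR0 : 0 < R := by linarith
  have hR1 : 1 < R := by linarith
  obtain ⟨⟨hd₁, hd₂⟩, htd₂, htx, hwX, hwY, hb₁, hb₂, hb₃⟩ :=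
    cross_exponents hs ht hst hγ hm hℓ hx₁ hy₁ hn₁ hl₁ hu₁ hl₂ hu₂
  obtain ⟨wZ, hwZ'⟩ : ∃ w, w = n - γ + 4 - s * x₁ := ⟨_, rfl⟩
  obtain ⟨wX, hwX'⟩ : ∃ w, w = ℓ - γ + 6 - s * x₁ := ⟨_, rfl⟩
  obtain ⟨wY, hwY'⟩ : ∃ w, w = 2 * (n - γ) - 2 * x₁ + ℓ - n + 7 := ⟨_, rfl⟩
  have hZ : |(A₁ : ℝ) * B₂ - A₂ * B₁| ≤ R ^ wZ :=
    abs_mul_sub_mul_le_rpow hR hA₁ hB₂ hA₂ hB₁ (by linarith) (by linarith)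
  have hX : |(B₂ : ℝ) * (A₁ * z.1 + B₁ * z.2 + C₁) - B₁ * (A₂ * z.1 + B₂ * z.2 + C₂)| ≤ R ^ wX :=
    abs_mul_sub_mul_le_rpow hR hB₂ hL₁ hB₁ hL₂ (by linarith) (by linarith)
  have hY : |(A₁ : ℝ) * (A₂ * z.1 + B₂ * z.2 + C₂) - A₂ * (A₁ * z.1 + B₁ * z.2 + C₁)| ≤ R ^ wY :=
    abs_mul_sub_mul_le_rpow hR hA₁ hL₂ hA₂ hL₁ (by linarith) (by linarith)
  have hX' : |((A₁ : ℝ) * B₂ - A₂ * B₁) * z.1 - (B₁ * C₂ - C₁ * B₂)| ≤ R ^ wX := by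
    convert hX using 2; ring
  have hY' : |((A₁ : ℝ) * B₂ - A₂ * B₁) * z.2 - (C₁ * A₂ - A₁ * C₂)| ≤ R ^ wY := by
    convert hY using 2; ring
  rw [← hwZ', ← hwX'] at hb₁
  rw [← hwZ', ← hwY'] at hb₂
  rw [← hwZ'] at hb₃
  rw [← hwX'] at hwX
  rw [← hwY'] at hwY
  have small : ∀ {k : ℤ} {w : ℝ}, |(k : ℝ)| ≤ R ^ w → w < 0 → k = 0 := by
    intro k w hk hw
    have h1 : |(k : ℝ)| < 1 := hk.trans_lt (Real.rpow_lt_one_of_one_lt_of_neg hR1 hw)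
    have h2 : |k| < 1 := by exact_mod_cast h1
    exact Int.abs_lt_one_iff.mp h2
  by_cases hZ0 : A₁ * B₂ - A₂ * B₁ = 0
  · have hZ0' : (A₁ : ℝ) * B₂ - A₂ * B₁ = 0 := by exact_mod_cast hZ0
    rw [hZ0', zero_mul, zero_sub, abs_neg] at hX' hY'
    exact ⟨hZ0, small (by exact_mod_cast hX') hwX, small (by exact_mod_cast hY') hwY⟩
  exfalso
  -- the intersection point of the two lines
  obtain ⟨q, hq⟩ : ∃ q, q = (A₁ * B₂ - A₂ * B₁).natAbs := ⟨_, rfl⟩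
  have hq0 : 0 < q := hq ▸ Int.natAbs_pos.mpr hZ0
  have hqR : (q : ℝ) ≤ R ^ wZ := by
    have : (q : ℝ) = |(A₁ : ℝ) * B₂ - A₂ * B₁| := by
      rw [hq, Nat.cast_natAbs]; push_cast; rfl
    rw [this]; exact hZ
  have hpow : ∀ {w : ℝ}, 0 ≤ w → (q : ℝ) ^ w ≤ R ^ (wZ * w) := by
    intro w hw
    rw [Real.rpow_mul hR0.le]
    exact Real.rpow_le_rpow (by positivity) hqR hw
  have hc : R ^ (-γ - 1) ≤ R ^ (-γ) / 2 := by
    rw [Real.rpow_sub hR0, Real.rpow_one]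
    gcongr
  have box : ∀ {w u a : ℝ}, 0 ≤ w → |a| ≤ R ^ u → wZ * w + u < -γ - 1 →
      (q : ℝ) ^ w * |a| < R ^ (-γ) / 2 := by
    intro w u a hw ha hlt
    calc (q : ℝ) ^ w * |a| ≤ R ^ (wZ * w) * R ^ u := by
          gcongr
          exact hpow hw
      _ = R ^ (wZ * w + u) := (Real.rpow_add hR0 _ _).symm
      _ < R ^ (-γ - 1) := Real.rpow_lt_rpow_of_exponent_lt hR1 hlt
      _ ≤ _ := hc
  have hs0 : 0 ≤ s := by linarith
  have hq1 : (q : ℝ) ^ (1 + s) ≤ R ^ (n - ℓ - γ) :=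
    (hpow (by linarith)).trans (Real.rpow_le_rpow_of_exponent_le hR1.le hb₃)
  rcases Int.natAbs_eq (A₁ * B₂ - A₂ * B₁) with hcase | hcase <;> rw [← hq] at hcase
  · have hcast : (A₁ : ℝ) * B₂ - A₂ * B₁ = q := by exact_mod_cast hcase
    rw [hcast] at hX' hY'
    refine hz (B₁ * C₂ - C₁ * B₂) (C₁ * A₂ - A₁ * C₂) q hq0 hq1
      ⟨box hs0 ?_ hb₁, box ht ?_ hb₂⟩
    · push_cast; exact hX'
    · push_cast; exact hY'
  · have hcast : (A₁ : ℝ) * B₂ - A₂ * B₁ = -q := by exact_mod_cast hcase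
    rw [hcast, ← abs_neg] at hX' hY'
    refine hz (-(B₁ * C₂ - C₁ * B₂)) (-(C₁ * A₂ - A₁ * C₂)) q hq0 hq1
      ⟨box hs0 ?_ hb₁, box ht ?_ hb₂⟩
    · push_cast
      convert hX' using 2; ring
    · push_cast
      convert hY' using 2; ring

/-- A box around `(p / q, r / q)` is contained in a thin strip around any line with small
coefficients through that point; more precisely, this bounds the difference of the values of
`q (A x + B y + C)` at a point of the box and at `(p / q, r / q)`. -/
lemma abs_sub_le_of_mem_dangerBox {s t c A B C : ℝ} {p r : ℤ} {q : ℕ}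
    (hA : |A| ≤ (q : ℝ) ^ s) (hB : |B| ≤ (q : ℝ) ^ t) {z : ℝ × ℝ}
    (hz : z ∈ dangerBox s t c p r q) :
    |q * (A * z.1 + B * z.2 + C) - (A * p + B * r + C * q)| ≤ 2 * c := by
  have h1 : |A * (q * z.1 - p)| ≤ c := by
    rw [abs_mul]
    exact (mul_le_mul_of_nonneg_right hA (abs_nonneg _)).trans hz.1.le
  have h2 : |B * (q * z.2 - r)| ≤ c := by
    rw [abs_mul]
    exact (mul_le_mul_of_nonneg_right hB (abs_nonneg _)).trans hz.2.le
  calc _ = |A * (q * z.1 - p) + B * (q * z.2 - r)| := by congr 1; ring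
    _ ≤ _ := abs_add_le _ _
    _ ≤ 2 * c := by linarith

/-- The complement of `S` is covered by sets `Δ i`, each carrying a level and a lag of at least
`N`, in such a way that inside a set `D` of diameter `R ^ (-a)` which avoids the `Δ i` of level at
most `a`, all `Δ i` of level `a + ℓ` and lag `ℓ` are contained in one strip of width about
`R ^ (-(a + ℓ))`. -/
def StripControlled (R : ℝ) (N : ℕ) (S : Set (ℝ × ℝ)) : Prop :=
  ∃ (ι : Type) (Δ : ι → Set (ℝ × ℝ)) (lev lag : ι → ℕ),
    (∀ i, N ≤ lag i ∧ lag i ≤ lev i) ∧ (∀ z, (∀ i, z ∉ Δ i) → z ∈ S) ∧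
    ∀ (a ℓ : ℕ) (D : Set (ℝ × ℝ)), (∀ z ∈ D, ∀ w ∈ D, dist z w ≤ 1 / R ^ a) →
      (∀ i, lev i ≤ a → Disjoint D (Δ i)) →
      ∃ A B C : ℝ, 0 < max |A| |B| ∧ ∀ i, lev i = a + ℓ → lag i = ℓ → ∀ z ∈ D ∩ Δ i,
        |A * z.1 + B * z.2 + C| ≤ max |A| |B| / R ^ (a + ℓ)

lemma StripControlled.preimage_swap {R : ℝ} {N : ℕ} {S : Set (ℝ × ℝ)}
    (h : StripControlled R N S) : StripControlled R N (Prod.swap ⁻¹' S) := by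
  obtain ⟨ι, Δ, lev, lag, h1, h2, h3⟩ := h
  refine ⟨ι, fun i => Prod.swap ⁻¹' Δ i, lev, lag, h1, fun z hz => h2 _ hz, ?_⟩
  intro a ℓ D hD hdisj
  obtain ⟨A, B, C, hAB, hstrip⟩ := h3 a ℓ (Prod.swap ⁻¹' D) (by
      intro z hz w hw
      have := hD _ hz _ hw
      rwa [Prod.dist_eq, max_comm] at this) (by
      intro i hi
      have := (hdisj i hi).preimage Prod.swap
      rwa [← Set.preimage_comp, Prod.swap_swap_eq, Set.preimage_id] at this)
  refine ⟨B, A, C, max_comm |A| |B| ▸ hAB, fun i hi hi' z hz => ?_⟩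
  have := hstrip i hi hi' z.swap ⟨by simpa using hz.1, hz.2⟩
  rw [max_comm]
  convert this using 2
  simp only [Prod.fst_swap, Prod.snd_swap]
  ring

lemma stripControlled_badPair_of_half_le {R s t : ℝ} (hR : 2 ≤ R) (hs : 1 / 2 ≤ s) (ht : 0 ≤ t)
    (hst : s + t = 1) (N : ℕ) : StripControlled R N (badPair s t) := by
  have hR0 : 0 < R := by linarith
  have hR1 : 1 < R := by linarith
  have hs0 : 0 < s := by linarith
  choose A B C hne hL hA hB using
    fun P : ℤ × ℤ × ℕ+ => exists_int_line hst P.1 P.2.1 P.2.2.pos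
  let q : ℤ × ℤ × ℕ+ → ℝ := fun P => ((P.2.2 : ℕ) : ℝ)
  have hq1 : ∀ P, 1 ≤ q P := fun P => Nat.one_le_cast.mpr P.2.2.pos
  have hq0 : ∀ P, 0 < q P := fun P => zero_lt_one.trans_le (hq1 P)
  let M : ℤ × ℤ × ℕ+ → ℝ := fun P => max |(A P : ℝ)| |(B P : ℝ)|
  have hM1 : ∀ P, 1 ≤ M P := by
    intro P
    rcases hne P with h | h
    · exact le_max_of_le_left (by exact_mod_cast Int.one_le_abs h)
    · exact le_max_of_le_right (by exact_mod_cast Int.one_le_abs h)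
  have hM0 : ∀ P, 0 < M P := fun P => zero_lt_one.trans_le (hM1 P)
  let x : ℤ × ℤ × ℕ+ → ℝ := fun P => Real.logb R (q P)
  let y : ℤ × ℤ × ℕ+ → ℝ := fun P => Real.logb R (M P)
  have hx0 : ∀ P, 0 ≤ x P := fun P => Real.logb_nonneg hR1 (hq1 P)
  have hy0 : ∀ P, 0 ≤ y P := fun P => Real.logb_nonneg hR1 (hM1 P)
  have hqx : ∀ P, q P = R ^ x P := fun P => (Real.rpow_logb hR0 hR1.ne' (hq0 P)).symm
  have hMy : ∀ P, M P = R ^ y P := fun P => (Real.rpow_logb hR0 hR1.ne' (hM0 P)).symm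
  have hyx : ∀ P, y P ≤ s * x P := by
    intro P
    rw [← Real.rpow_le_rpow_left_iff hR1, ← hMy, mul_comm, Real.rpow_mul hR0.le, ← hqx]
    exact max_le (hA P) ((hB P).trans (Real.rpow_le_rpow_of_exponent_le (hq1 P) (by linarith)))
  have hBx : ∀ P, |(B P : ℝ)| ≤ R ^ (t * x P) := by
    intro P
    rw [mul_comm, Real.rpow_mul hR0.le, ← hqx]
    exact hB P
  let γ : ℝ := 3 * N + 40
  have hN0 : (0 : ℝ) ≤ N := by positivity
  have hγ : γ = 3 * N + 40 := rfl
  let lev : ℤ × ℤ × ℕ+ → ℕ := fun P => ⌊x P + y P + γ⌋₊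
  have hlev : ∀ P, lev P ≤ x P + y P + γ := fun P =>
    Nat.floor_le (by linarith [hx0 P, hy0 P])
  have hlev' : ∀ P, x P + y P + γ < lev P + 1 := fun P => Nat.lt_floor_add_one _
  let κ : ℤ × ℤ × ℕ+ → ℝ := fun P => s * ((1 + s) * x P - (lev P - γ))
  have hκ0 : ∀ P, 0 ≤ κ P := fun P =>
    mul_nonneg hs0.le (by linarith [hyx P, hlev P])
  let m : ℤ × ℤ × ℕ+ → ℕ := fun P => ⌊κ P⌋₊
  have hm : ∀ P, m P ≤ κ P := fun P => Nat.floor_le (hκ0 P)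
  have hm' : ∀ P, κ P < m P + 1 := fun P => Nat.lt_floor_add_one _
  let lag : ℤ × ℤ × ℕ+ → ℕ := fun P => max N (m P - 16)
  let c : ℝ := R ^ (-γ) / 2
  have hc0 : 0 < c := by positivity
  have h2c : 2 * c = R ^ (-γ) := by ring
  refine ⟨ℤ × ℤ × ℕ+, fun P => dangerBox s t c P.1 P.2.1 P.2.2, lev, lag, ?_, ?_, ?_⟩
  · refine fun P => ⟨le_max_left _ _, max_le ?_ ?_⟩
    · have : (N : ℝ) < lev P + 1 := by linarith [hlev' P, hx0 P, hy0 P]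
      exact Nat.lt_succ_iff.mp (by exact_mod_cast this)
    · rcases le_total (m P) 16 with h | h
      · simp [Nat.sub_eq_zero_of_le h]
      · have hcast : ((m P - 16 : ℕ) : ℝ) = m P - 16 := by push_cast [h]; ring
        obtain ⟨-, -, -, h1, -⟩ := cross_exponents (x₂ := x P) hs ht hst (by linarith : 0 ≤ γ)
          (by rw [hcast]; linarith : ((m P - 16 : ℕ) : ℝ) + 16 ≤ m P) (by positivity) (hx0 P)
          (hy0 P) (by linarith [hlev' P] : x P + y P ≤ lev P - γ + 1) (hm P) (hm' P) (hm P) (hm' P)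
        have h2 : s * x P ≤ 1 * x P := by gcongr; exacts [hx0 P, by linarith]
        have : ((m P - 16 : ℕ) : ℝ) ≤ lev P := by linarith [hlev' P, hy0 P]
        exact_mod_cast this
  · exact fun z hz => mem_badPair_of_forall_notMem_dangerBox hc0
      fun p r k hk => hz (p, r, ⟨k, hk⟩)
  intro a ℓ D hD hdisj
  -- the strip around an attached line which contains the box
  have hstrip : ∀ P, ∀ z ∈ dangerBox s t c P.1 P.2.1 P.2.2, ∀ P',
      (A P' : ℝ) * P.1 + B P' * P.2.1 + C P' * q P = 0 → x P' ≤ x P →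
      |A P' * z.1 + B P' * z.2 + C P'| ≤ M P' / R ^ lev P' := by
    intro P z hz P' h0 hxx
    have hqq : q P' ≤ q P := by
      rw [hqx, hqx]; exact Real.rpow_le_rpow_of_exponent_le hR1.le hxx
    have h1 := abs_sub_le_of_mem_dangerBox (C := C P')
      ((hA P').trans (Real.rpow_le_rpow (hq0 P').le hqq hs0.le))
      ((hB P').trans (Real.rpow_le_rpow (hq0 P').le hqq ht)) hz
    have h0' : (A P' : ℝ) * P.1 + B P' * P.2.1 + C P' * ((P.2.2 : ℕ) : ℝ) = 0 := h0
    rw [h0', sub_zero, abs_mul, abs_of_pos (hq0 P), h2c] at h1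
    calc |A P' * z.1 + B P' * z.2 + C P'| ≤ R ^ (-γ) / q P := by
          rw [le_div_iff₀ (hq0 P), mul_comm]; exact h1
      _ ≤ R ^ (-γ) / q P' := by
          have := hq0 P'
          gcongr
      _ = R ^ (-γ - x P') := by rw [hqx, Real.rpow_sub hR0]
      _ ≤ R ^ (y P' - lev P') :=
          Real.rpow_le_rpow_of_exponent_le hR1.le (by linarith [hlev P'])
      _ = M P' / R ^ lev P' := by rw [Real.rpow_sub hR0, hMy, Real.rpow_natCast]
  have hself : ∀ P, (A P : ℝ) * P.1 + B P * P.2.1 + C P * q P = 0 := fun P => by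
    simp only [q]
    exact_mod_cast hL P
  have hnear : ∀ P, lev P = a + ℓ → ∀ w ∈ D ∩ dangerBox s t c P.1 P.2.1 P.2.2, ∀ z ∈ D,
      |A P * z.1 + B P * z.2 + C P| ≤ R ^ (y P + 2 + ℓ - lev P) := by
    intro P hP w hw z hz
    have h1 := hstrip P w hw.2 P (hself P) le_rfl
    have h2 : dist z w ≤ 1 / R ^ a := hD z hz w hw.1
    rw [Prod.dist_eq, max_le_iff, Real.dist_eq, Real.dist_eq] at h2
    have hpow : R ^ a ≤ R ^ lev P := pow_le_pow_right₀ hR1.le (by omega)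
    have hpa : 0 < R ^ a := by positivity
    have h3 : |(A P : ℝ)| * |z.1 - w.1| ≤ M P * (1 / R ^ a) :=
      mul_le_mul (le_max_left _ _) h2.1 (abs_nonneg _) (hM0 P).le
    have h4 : |(B P : ℝ)| * |z.2 - w.2| ≤ M P * (1 / R ^ a) :=
      mul_le_mul (le_max_right _ _) h2.2 (abs_nonneg _) (hM0 P).le
    have h5 : M P / R ^ lev P ≤ M P * (1 / R ^ a) := by
      rw [mul_one_div]
      have := hM0 P
      gcongr
    calc |A P * z.1 + B P * z.2 + C P|
        = |(A P * w.1 + B P * w.2 + C P) + A P * (z.1 - w.1) + B P * (z.2 - w.2)| := by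
          congr 1; ring
      _ ≤ |A P * w.1 + B P * w.2 + C P| + |A P * (z.1 - w.1)| + |B P * (z.2 - w.2)| :=
          abs_add_three _ _ _
      _ ≤ M P * (1 / R ^ a) + M P * (1 / R ^ a) + M P * (1 / R ^ a) := by
          rw [abs_mul, abs_mul]; linarith
      _ = 3 * (M P / R ^ a) := by ring
      _ ≤ R ^ 2 * (M P / R ^ a) := by
          have := hM0 P
          gcongr
          nlinarith
      _ = R ^ (y P + 2 + ℓ - lev P) := by
          rw [hP, hMy]
          push_cast
          rw [show y P + 2 + ℓ - ((a : ℝ) + ℓ) = y P + 2 - a by ring, Real.rpow_sub hR0,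
            Real.rpow_add hR0, Real.rpow_natCast, Real.rpow_two]
          ring
  -- we pick the point of least denominator
  by_cases hex : ∃ k : ℕ, ∃ P : ℤ × ℤ × ℕ+, P.2.2 = k ∧ lev P = a + ℓ ∧ lag P = ℓ ∧
      (D ∩ dangerBox s t c P.1 P.2.1 P.2.2).Nonempty
  swap
  · refine ⟨1, 0, 0, by simp, fun P h1 h2 z hz => ?_⟩
    exact absurd ⟨P.2.2, P, rfl, h1, h2, z, hz⟩ hex
  classical
  obtain ⟨P₁, hP₁, hlev₁, hlag₁, w₁, hw₁⟩ := Nat.find_spec hex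
  have hmin : ∀ P : ℤ × ℤ × ℕ+, lev P = a + ℓ → lag P = ℓ →
      (D ∩ dangerBox s t c P.1 P.2.1 P.2.2).Nonempty → x P₁ ≤ x P := by
    intro P h1 h2 h3
    have h4 : (P₁.2.2 : ℕ) ≤ P.2.2 := hP₁ ▸ Nat.find_min' hex ⟨P, rfl, h1, h2, h3⟩
    exact Real.logb_le_logb_of_le hR1 (hq0 P₁) (Nat.cast_le.mpr h4)
  refine ⟨A P₁, B P₁, C P₁, hM0 P₁, ?_⟩
  intro P hlevP hlagP z hz
  have hxx := hmin P hlevP hlagP ⟨z, hz⟩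
  have hn₁ : (lev P₁ : ℝ) = lev P := by rw [hlev₁, hlevP]
  rw [← hlev₁]
  rcases eq_or_lt_of_le (hlag₁ ▸ le_max_left N (m P₁ - 16) : N ≤ ℓ) with hNℓ | hNℓ
  · -- small lag: the line of least denominator passes through all points
    refine hstrip P z hz.2 P₁ ?_ hxx
    have hqq : q P₁ ≤ q P := by
      rw [hqx, hqx]; exact Real.rpow_le_rpow_of_exponent_le hR1.le hxx
    have h1 := abs_sub_le_of_mem_dangerBox (C := C P₁)
      ((hA P₁).trans (Real.rpow_le_rpow (hq0 P₁).le hqq hs0.le))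
      ((hB P₁).trans (Real.rpow_le_rpow (hq0 P₁).le hqq ht)) hz.2
    have h2 := hnear P₁ hlev₁ w₁ hw₁ z hz.1
    have hmP : (m P : ℝ) ≤ N + 16 := by
      have : m P - 16 ≤ N := by
        rw [hNℓ, ← hlagP]; exact le_max_right _ _
      exact_mod_cast (by omega : m P ≤ N + 16)
    have hxdiff : x P - x P₁ ≤ 2 * (N + 17) := by
      have h3 := hm' P
      have h4 := hyx P₁
      have h5 := hlev P₁
      have h6 : (1 + s) * x P - (lev P - γ) < 2 * (N + 17) := by
        by_contra! hcon
        have : 1 / 2 * (2 * ((N : ℝ) + 17)) ≤ s * ((1 + s) * x P - (lev P - γ)) := by gcongr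
        change s * ((1 + s) * x P - (lev P - γ)) < m P + 1 at h3
        linarith
      nlinarith
    have h3 : q P * |A P₁ * z.1 + B P₁ * z.2 + C P₁| ≤ R ^ (-2 : ℝ) := by
      calc q P * |A P₁ * z.1 + B P₁ * z.2 + C P₁|
          ≤ R ^ x P * R ^ (y P₁ + 2 + ℓ - lev P₁) := by rw [hqx]; gcongr
        _ = R ^ (x P + (y P₁ + 2 + ℓ - lev P₁)) := (Real.rpow_add hR0 _ _).symm
        _ ≤ R ^ (-2 : ℝ) := by
          refine Real.rpow_le_rpow_of_exponent_le hR1.le ?_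
          rw [← hNℓ]
          linarith [hlev' P₁]
    have h4 : 2 * c ≤ R ^ (-2 : ℝ) := by
      rw [h2c]; exact Real.rpow_le_rpow_of_exponent_le hR1.le (by linarith)
    have h5 : R ^ (-2 : ℝ) ≤ 1 / 4 := by
      rw [Real.rpow_neg hR0.le, Real.rpow_two, one_div]
      gcongr
      nlinarith
    have h6 : |(A P₁ : ℝ) * P.1 + B P₁ * P.2.1 + C P₁ * q P| < 1 := by
      have h7 : |(A P₁ : ℝ) * P.1 + B P₁ * P.2.1 + C P₁ * q P| ≤
          |q P * (A P₁ * z.1 + B P₁ * z.2 + C P₁)| +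
          |q P * (A P₁ * z.1 + B P₁ * z.2 + C P₁) - (A P₁ * P.1 + B P₁ * P.2.1 + C P₁ * q P)| := by
        refine le_trans (le_of_eq ?_) (abs_sub _ _)
        congr 1; ring
      rw [abs_mul, abs_of_pos (hq0 P)] at h7
      have h1' : |q P * (A P₁ * z.1 + B P₁ * z.2 + C P₁) -
        (A P₁ * P.1 + B P₁ * P.2.1 + C P₁ * q P)| ≤ 2 * c := h1
      linarith
    have h7 : |A P₁ * P.1 + B P₁ * P.2.1 + C P₁ * (P.2.2 : ℕ)| < 1 := by
      simp only [q] at h6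
      exact_mod_cast h6
    simp only [q]
    exact_mod_cast Int.abs_lt_one_iff.mp h7
  · -- large lag: all lines coincide
    have hmℓ : ∀ P, lag P = ℓ → m P = ℓ + 16 := by
      intro P hP
      have h1 : max N (m P - 16) = ℓ := hP
      omega
    have hm₁ := hmℓ P₁ hlag₁
    have hm₂ := hmℓ P hlagP
    have hℓ0 : (0 : ℝ) ≤ ℓ := by positivity
    have hnear₂ := hnear P hlevP z hz z hz.1
    have hl₁ := hm P₁
    have hu₁ := hm' P₁
    have hl₂ := hm P
    have hu₂ := hm' P
    rw [hm₁] at hl₁ hu₁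
    rw [hm₂] at hl₂ hu₂
    simp only [κ] at hl₁ hu₁ hl₂ hu₂
    rw [← hn₁] at hl₂ hu₂ hnear₂
    obtain ⟨hZ, hX, hY⟩ := cross_eq_zero hR hs ht hst (by linarith : 0 ≤ γ)
      (by push_cast; rfl : (ℓ : ℝ) + 16 ≤ ((ℓ + 16 : ℕ) : ℝ)) hℓ0 (hx0 P₁) (hy0 P₁)
      (by linarith [hlev' P₁]) (by linarith [hlev' P]) hl₁ hu₁ hl₂ hu₂
      (hMy P₁ ▸ le_max_left _ _) (hMy P ▸ le_max_left _ _)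
      (hBx P₁) (hBx P)
      (hnear P₁ hlev₁ w₁ hw₁ z hz.1) hnear₂ (by
        intro p r k hk hkR hmem
        refine Set.disjoint_left.mp (hdisj (p, r, ⟨k, hk⟩) ?_) hz.1 hmem
        set P' : ℤ × ℤ × ℕ+ := (p, r, ⟨k, hk⟩)
        have h1 : (k : ℝ) = R ^ x P' := hqx P'
        rw [h1, ← Real.rpow_mul hR0.le, Real.rpow_le_rpow_left_iff hR1, hlev₁] at hkR
        push_cast at hkR
        exact Nat.floor_le_of_le (by linarith [hyx P']))
    have hZ' : (A P₁ : ℝ) * B P - A P * B P₁ = 0 := by exact_mod_cast hZ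
    have hX' : (B P₁ : ℝ) * C P - C P₁ * B P = 0 := by exact_mod_cast hX
    have hY' : (C P₁ : ℝ) * A P - A P₁ * C P = 0 := by exact_mod_cast hY
    have hAA : (A P : ℝ) * (A P₁ * z.1 + B P₁ * z.2 + C P₁) =
        A P₁ * (A P * z.1 + B P * z.2 + C P) := by
      linear_combination (-z.2) * hZ' + hY'
    have hBB : (B P : ℝ) * (A P₁ * z.1 + B P₁ * z.2 + C P₁) =
        B P₁ * (A P * z.1 + B P * z.2 + C P) := by
      linear_combination z.1 * hZ' - hX'
    have hprop : M P * |A P₁ * z.1 + B P₁ * z.2 + C P₁| =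
        M P₁ * |A P * z.1 + B P * z.2 + C P| := by
      simp only [M]
      rw [max_mul_of_nonneg _ _ (abs_nonneg _), max_mul_of_nonneg _ _ (abs_nonneg _),
        ← abs_mul, ← abs_mul, ← abs_mul, ← abs_mul, hAA, hBB]
    have h1 := hstrip P z hz.2 P (hself P) le_rfl
    rw [hlevP, ← hlev₁] at h1
    refine le_of_mul_le_mul_left ?_ (hM0 P)
    calc M P * |A P₁ * z.1 + B P₁ * z.2 + C P₁|
        = M P₁ * |A P * z.1 + B P * z.2 + C P| := hprop
      _ ≤ M P₁ * (M P / R ^ lev P₁) := mul_le_mul_of_nonneg_left h1 (hM0 P₁).le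
      _ = M P * (M P₁ / R ^ lev P₁) := by ring

lemma stripControlled_badPair {R s t : ℝ} (hR : 2 ≤ R) (hs : 0 ≤ s) (ht : 0 ≤ t)
    (hst : s + t = 1) (N : ℕ) : StripControlled R N (badPair s t) := by
  rcases le_total (1 / 2) s with h | h
  · exact stripControlled_badPair_of_half_le hR h ht hst N
  · have h1 := (stripControlled_badPair_of_half_le (t := s) hR (by linarith : 1 / 2 ≤ t) hs
      (by linarith) N).preimage_swap
    have h2 : Prod.swap ⁻¹' badPair t s = badPair s t := by
      ext z
      simp only [badPair, Set.mem_preimage, Set.mem_ofPred_eq, Prod.fst_swap, Prod.snd_swap,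
        max_comm]
    rwa [h2] at h1

open scoped ENNReal in
open Classical in
/-- A potential argument on the tree of words over `α`, whose children are obtained by prepending
letters. If the words in `Rem ℓ`, which lie `ℓ` levels below the vertices causing their removal, are
sparse in a weighted sense, then there is a subtree avoiding all removed words in which every
vertex has at least `K` children. -/
lemma exists_subtree_avoiding {α : Type*} [Fintype α] {K : ℕ} (hK : 0 < K)
    (hcard : 3 * K ≤ Fintype.card α) (Rem : ℕ → Set (List α))
    (hlen : ∀ ℓ, ∀ w ∈ Rem ℓ, ℓ ≤ w.length)
    (hβ : ∀ v : List α, ∑' (ℓ : ℕ) (w : List α),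
      (if w.length = ℓ ∧ w ++ v ∈ Rem ℓ then ((K : ℝ≥0∞)⁻¹) ^ ℓ else 0) ≤ 4⁻¹) :
    ∃ G : Set (List α), [] ∈ G ∧ (∀ v ∈ G, ∀ ℓ, v ∉ Rem ℓ) ∧
      ∀ v ∈ G, ∃ f : Fin K → α, Function.Injective f ∧ ∀ k, f k :: v ∈ G := by
  have hK0 : (K : ℝ≥0∞) ≠ 0 := by exact_mod_cast hK.ne'
  have hKtop : (K : ℝ≥0∞) ≠ ∞ := ENNReal.natCast_ne_top K
  let ψ : List α → ℝ≥0∞ := fun v => ∑' (ℓ : ℕ) (w : List α),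
    if w.length < ℓ ∧ w ++ v ∈ Rem ℓ then ((K : ℝ≥0∞)⁻¹) ^ w.length else 0
  let φ : List α → ℝ≥0∞ := fun v => ∑' (ℓ : ℕ) (w : List α),
    if w.length ≤ ℓ ∧ w ++ v ∈ Rem ℓ then ((K : ℝ≥0∞)⁻¹) ^ w.length else 0
  have hφψ : ∀ v, φ v ≤ ψ v + 4⁻¹ := by
    intro v
    refine le_trans ?_ (add_le_add_right (hβ v) (ψ v))
    simp only [φ, ψ]
    rw [← ENNReal.tsum_add]
    refine ENNReal.tsum_le_tsum fun ℓ => ?_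
    rw [← ENNReal.tsum_add]
    refine ENNReal.tsum_le_tsum fun w => ?_
    by_cases hw : w ++ v ∈ Rem ℓ
    · rcases lt_trichotomy w.length ℓ with h | h | h
      · simp [hw, h, h.le]
      · simp [hw, h]
      · simp [h.not_ge]
    · simp [hw]
  have hsum : ∀ v, ∑ u, ψ (u :: v) ≤ K * φ v := by
    intro v
    simp only [φ, ψ]
    rw [← tsum_fintype (L := .unconditional _), ENNReal.tsum_comm, ← ENNReal.tsum_mul_left]
    refine ENNReal.tsum_le_tsum fun ℓ => ?_
    rw [← ENNReal.tsum_prod, ← ENNReal.tsum_mul_left]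
    have hinj : Function.Injective fun p : α × List α => p.2 ++ [p.1] := by
      rintro ⟨u, w⟩ ⟨u', w'⟩ h
      have := List.append_inj' h rfl
      simp_all
    refine le_trans (ENNReal.tsum_le_tsum fun p => ?_)
      (ENNReal.tsum_comp_le_tsum_of_injective hinj _)
    simp only [List.length_append, List.length_singleton, List.append_assoc, List.singleton_append,
      Nat.lt_iff_add_one_le]
    split_ifs
    · rw [pow_succ', ← mul_assoc, ENNReal.mul_inv_cancel hK0 hKtop, one_mul]
    · simp
  refine ⟨{v | ψ v ≤ 4⁻¹}, ?_, ?_, ?_⟩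
  · have : ψ [] = 0 := by
      simp only [ψ, ENNReal.tsum_eq_zero, List.append_nil, ite_eq_right_iff, and_imp]
      intro ℓ w h1 h2
      exact absurd (hlen ℓ w h2) h1.not_ge
    simp [this]
  · intro v hv ℓ hvℓ
    have h1 : (1 : ℝ≥0∞) ≤ φ v := by
      refine le_trans ?_ (ENNReal.le_tsum ℓ)
      refine le_trans ?_ (ENNReal.le_tsum [])
      simp [hvℓ]
    have h2 : φ v ≤ 4⁻¹ + 4⁻¹ := (hφψ v).trans (add_le_add_left hv _)
    have h3 : (4⁻¹ + 4⁻¹ : ℝ≥0∞) < 1 := by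
      rw [← ENNReal.toReal_lt_toReal (by simp) (by simp), ENNReal.toReal_add (by simp) (by simp)]
      norm_num
    exact absurd (h1.trans h2) h3.not_ge
  · intro v hv
    let bad : Finset α := Finset.univ.filter fun u => 4⁻¹ < ψ (u :: v)
    have hbad : bad.card ≤ 2 * K := by
      have h1 : bad.card • (4⁻¹ : ℝ≥0∞) ≤ ∑ u ∈ bad, ψ (u :: v) :=
        Finset.card_nsmul_le_sum _ _ _ fun u hu => (Finset.mem_filter.mp hu).2.le
      have h2 : ∑ u ∈ bad, ψ (u :: v) ≤ ∑ u, ψ (u :: v) :=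
        Finset.sum_le_sum_of_subset (Finset.subset_univ _)
      have h3 : bad.card • (4⁻¹ : ℝ≥0∞) ≤ K * (4⁻¹ + 4⁻¹) := by
        refine h1.trans (h2.trans ((hsum v).trans ?_))
        gcongr
        exact (hφψ v).trans (add_le_add_left hv _)
      rw [nsmul_eq_mul, ← ENNReal.toReal_le_toReal (by simp [ENNReal.mul_eq_top])
        (by simp [ENNReal.mul_eq_top]), ENNReal.toReal_mul, ENNReal.toReal_mul,
        ENNReal.toReal_add (by simp) (by simp)] at h3
      simp only [ENNReal.toReal_natCast, ENNReal.toReal_inv, ENNReal.toReal_ofNat] at h3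
      have : (bad.card : ℝ) ≤ 2 * K := by linarith
      exact_mod_cast this
    have hgood : K ≤ badᶜ.card := by
      rw [Finset.card_compl]
      omega
    obtain ⟨e⟩ := Function.Embedding.nonempty_of_card_le (α := Fin K) (β := (badᶜ : Finset α))
      (by rw [Fintype.card_fin, Fintype.card_coe]; exact hgood)
    refine ⟨fun k => e k, Subtype.val_injective.comp e.injective, fun k => ?_⟩
    have := (e k).2
    simpa [bad] using this

/-- The position in `[0, 1]` encoded by a word over `{0, …, b - 1}`, the last digit coming first:
its expansion in base `2 b` has the digits `0, 2, …, 2 (b - 1)`. -/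
noncomputable def cantorPos {b : ℕ} : List (Fin b) → ℝ
  | [] => 0
  | u :: v => cantorPos v + 2 * (u : ℕ) / (2 * (b : ℝ)) ^ (v.length + 1)

lemma cantorPos_cons_add_le {b : ℕ} (u : Fin b) (v : List (Fin b)) :
    2 * ((u : ℕ) : ℝ) / (2 * (b : ℝ)) ^ (v.length + 1) + 2 / (2 * (b : ℝ)) ^ (v.length + 1) ≤
      1 / (2 * (b : ℝ)) ^ v.length := by
  have hb : 0 < b := u.pos
  have hb0 : (0 : ℝ) < b := by exact_mod_cast hb
  have h1 : ((u : ℕ) : ℝ) + 1 ≤ b := by exact_mod_cast u.isLt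
  rw [← add_div, pow_succ, div_le_div_iff₀ (by positivity) (by positivity)]
  have : (0 : ℝ) < (2 * (b : ℝ)) ^ v.length := by positivity
  nlinarith

lemma two_div_le_abs_cantorPos_sub {b : ℕ} {v w : List (Fin b)} (hlen : v.length = w.length)
    (hne : v ≠ w) : 2 / (2 * (b : ℝ)) ^ v.length ≤ |cantorPos v - cantorPos w| := by
  induction v generalizing w with
  | nil =>
    rw [List.length_nil, eq_comm, List.length_eq_zero_iff] at hlen
    exact absurd hlen.symm hne
  | cons u v ih =>
    obtain _ | ⟨u', w⟩ := w
    · simp at hlen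
    have hb : 0 < b := u.pos
    have hb0 : (0 : ℝ) < b := by exact_mod_cast hb
    have hl : v.length = w.length := by simpa using hlen
    have hr : (0 : ℝ) < (2 * (b : ℝ)) ^ (v.length + 1) := by positivity
    simp only [cantorPos, List.length_cons, ← hl]
    by_cases hvw : v = w
    · subst hvw
      have hu : u ≠ u' := fun h => hne (by rw [h])
      have h1 : (1 : ℝ) ≤ |((u : ℕ) : ℝ) - ((u' : ℕ) : ℝ)| := by
        have : (1 : ℤ) ≤ |((u : ℕ) : ℤ) - ((u' : ℕ) : ℤ)| := by
          apply Int.one_le_abs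
          rw [sub_ne_zero]
          exact_mod_cast fun h => hu (Fin.ext h)
        exact_mod_cast this
      have h2 : cantorPos v + 2 * ((u : ℕ) : ℝ) / (2 * (b : ℝ)) ^ (v.length + 1) -
          (cantorPos v + 2 * ((u' : ℕ) : ℝ) / (2 * (b : ℝ)) ^ (v.length + 1)) =
          2 * (((u : ℕ) : ℝ) - ((u' : ℕ) : ℝ)) / (2 * (b : ℝ)) ^ (v.length + 1) := by ring
      rw [h2, abs_div, abs_mul, abs_of_pos hr, abs_two]
      gcongr
      linarith
    · have h1 := ih hl hvw
      have h2 := cantorPos_cons_add_le u v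
      have h3 := cantorPos_cons_add_le u' w
      rw [← hl] at h3
      have h4 : 0 ≤ 2 * ((u : ℕ) : ℝ) / (2 * (b : ℝ)) ^ (v.length + 1) := by positivity
      have h5 : 0 ≤ 2 * ((u' : ℕ) : ℝ) / (2 * (b : ℝ)) ^ (v.length + 1) := by positivity
      have h6 : 2 / (2 * (b : ℝ)) ^ v.length = 2 * (1 / (2 * (b : ℝ)) ^ v.length) := by ring
      have h7 : 0 ≤ 1 / (2 * (b : ℝ)) ^ v.length := by positivity
      rw [le_abs] at h1 ⊢
      rcases h1 with h1 | h1
      · left; linarith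
      · right; linarith

/-- The square of side `(2 b) ^ (-n)` attached to a word of length `n` of pairs of digits. -/
def cantorSquare {b : ℕ} (v : List (Fin b × Fin b)) : Set (ℝ × ℝ) :=
  Set.Icc (cantorPos (v.map Prod.fst)) (cantorPos (v.map Prod.fst) + 1 / (2 * (b : ℝ)) ^ v.length) ×ˢ
  Set.Icc (cantorPos (v.map Prod.snd)) (cantorPos (v.map Prod.snd) + 1 / (2 * (b : ℝ)) ^ v.length)

lemma cantorSquare_cons_subset {b : ℕ} (u : Fin b × Fin b) (v : List (Fin b × Fin b)) :
    cantorSquare (u :: v) ⊆ cantorSquare v := by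
  have key : ∀ u : Fin b, ∀ v : List (Fin b),
      Set.Icc (cantorPos (u :: v)) (cantorPos (u :: v) + 1 / (2 * (b : ℝ)) ^ (v.length + 1)) ⊆
      Set.Icc (cantorPos v) (cantorPos v + 1 / (2 * (b : ℝ)) ^ v.length) := by
    intro u v
    have hb : 0 < b := u.pos
    have hb0 : (0 : ℝ) < b := by exact_mod_cast hb
    have h2 := cantorPos_cons_add_le u v
    have h4 : 0 ≤ 2 * ((u : ℕ) : ℝ) / (2 * (b : ℝ)) ^ (v.length + 1) := by positivity
    have h5 : 0 ≤ 1 / (2 * (b : ℝ)) ^ (v.length + 1) := by positivity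
    have h6 : 2 / (2 * (b : ℝ)) ^ (v.length + 1) = 2 * (1 / (2 * (b : ℝ)) ^ (v.length + 1)) := by
      ring
    simp only [cantorPos]
    apply Set.Icc_subset_Icc <;> linarith
  have h1 := key u.1 (v.map Prod.fst)
  have h2 := key u.2 (v.map Prod.snd)
  simp only [List.length_map] at h1 h2
  exact Set.prod_mono h1 h2

lemma cantorSquare_append_subset {b : ℕ} (w v : List (Fin b × Fin b)) :
    cantorSquare (w ++ v) ⊆ cantorSquare v := by
  induction w with
  | nil => exact subset_rfl
  | cons u w ih => exact (cantorSquare_cons_subset u (w ++ v)).trans ih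

lemma dist_le_of_mem_cantorSquare {b : ℕ} {v : List (Fin b × Fin b)} {z w : ℝ × ℝ}
    (hz : z ∈ cantorSquare v) (hw : w ∈ cantorSquare v) :
    dist z w ≤ 1 / (2 * (b : ℝ)) ^ v.length := by
  rw [Prod.dist_eq, Real.dist_eq, Real.dist_eq]
  obtain ⟨⟨h1, h2⟩, h3, h4⟩ := hz
  obtain ⟨⟨h5, h6⟩, h7, h8⟩ := hw
  refine max_le ?_ ?_ <;> rw [abs_le] <;> constructor <;> linarith

lemma le_dist_of_mem_cantorSquare {b : ℕ} {v w : List (Fin b × Fin b)}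
    (hlen : v.length = w.length) (hne : v ≠ w) {z z' : ℝ × ℝ}
    (hz : z ∈ cantorSquare v) (hz' : z' ∈ cantorSquare w) :
    1 / (2 * (b : ℝ)) ^ v.length ≤ dist z z' := by
  have key : ∀ {v w : List (Fin b)} {x x' : ℝ}, v.length = w.length → v ≠ w →
      x ∈ Set.Icc (cantorPos v) (cantorPos v + 1 / (2 * (b : ℝ)) ^ v.length) →
      x' ∈ Set.Icc (cantorPos w) (cantorPos w + 1 / (2 * (b : ℝ)) ^ v.length) →
      1 / (2 * (b : ℝ)) ^ v.length ≤ |x - x'| := by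
    intro v w x x' hl hne hx hx'
    have h1 := two_div_le_abs_cantorPos_sub hl hne
    have h6 : 2 / (2 * (b : ℝ)) ^ v.length = 2 * (1 / (2 * (b : ℝ)) ^ v.length) := by ring
    obtain ⟨h2, h3⟩ := hx
    obtain ⟨h4, h5⟩ := hx'
    rw [le_abs] at h1 ⊢
    rcases h1 with h1 | h1
    · left; linarith
    · right; linarith
  rw [Prod.dist_eq, Real.dist_eq, Real.dist_eq]
  obtain ⟨h1, h2⟩ := hz
  obtain ⟨h3, h4⟩ := hz'
  rw [← hlen] at h3 h4
  by_cases hfst : v.map Prod.fst = w.map Prod.fst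
  · have hsnd : v.map Prod.snd ≠ w.map Prod.snd := by
      intro hsnd
      apply hne
      rw [List.zip_of_prod hfst hsnd]
      exact (List.zip_of_prod rfl rfl).symm
    refine le_max_of_le_right ?_
    simpa using key (by simpa using hlen) hsnd (by simpa using h2) (by simpa using h4)
  · refine le_max_of_le_left ?_
    simpa using key (by simpa using hlen) hfst (by simpa using h1) (by simpa using h3)

lemma encard_setOf_length_eq (b ℓ : ℕ) :
    {xs : List (Fin b) | xs.length = ℓ}.encard = (b : ℕ∞) ^ ℓ := by
  have h : ENat.card (List.Vector (Fin b) ℓ) = ((b ^ ℓ : ℕ) : ℕ∞) := by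
    rw [ENat.card_eq_coe_fintype_card, card_vector, Fintype.card_fin]
  rw [Nat.cast_pow] at h
  exact h

/-- If the second coordinates, read off by `g`, are confined to a window of comparable size around
a point determined by the first coordinates, read off by `f`, then there are few words. -/
lemma encard_le_of_abs_cantorPos_le {b : ℕ} (hb : 0 < b) (v : List (Fin b × Fin b)) (ℓ : ℕ)
    (f g : Fin b × Fin b → Fin b)
    (hfg : ∀ w w' : List (Fin b × Fin b), w.map f = w'.map f → w.map g = w'.map g → w = w')
    {A B C : ℝ} (hB : B ≠ 0) {S : Set (List (Fin b × Fin b))}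
    (hS : ∀ w ∈ S, w.length = ℓ ∧
      |A * cantorPos ((w ++ v).map f) + B * cantorPos ((w ++ v).map g) + C| ≤
        3 * |B| / (2 * (b : ℝ)) ^ (v.length + ℓ)) :
    S.encard ≤ (b : ℕ∞) ^ ℓ * 7 := by
  have hb0 : (0 : ℝ) < b := by exact_mod_cast hb
  set r : ℝ := (2 * (b : ℝ)) ^ (v.length + ℓ) with hr
  have hr0 : 0 < r := by positivity
  have hB0 : 0 < |B| := abs_pos.mpr hB
  let val : List (Fin b × Fin b) → ℝ := fun w =>
    (A * cantorPos ((w ++ v).map f) + B * cantorPos ((w ++ v).map g) + C) / B * r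
  have hval : ∀ w ∈ S, |val w| ≤ 3 := by
    intro w hw
    have h1 := (hS w hw).2
    simp only [val]
    rw [abs_mul, abs_div, abs_of_pos hr0, div_mul_eq_mul_div, div_le_iff₀ hB0]
    rwa [le_div_iff₀ hr0] at h1
  let F : List (Fin b × Fin b) → List (Fin b) × ℤ := fun w => (w.map f, ⌊val w⌋)
  have hmaps : Set.MapsTo F S ({xs | xs.length = ℓ} ×ˢ Set.Icc (-3) 3) := by
    intro w hw
    have h1 := abs_le.mp (hval w hw)
    refine ⟨?_, ?_, ?_⟩
    · simpa [F] using (hS w hw).1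
    · simp only [F]
      rw [Int.le_floor]
      push_cast
      exact h1.1
    · simp only [F]
      rw [← Int.lt_add_one_iff, Int.floor_lt]
      push_cast
      linarith [h1.2]
  have hinj : Set.InjOn F S := by
    intro w hw w' hw' h
    simp only [F, Prod.mk.injEq] at h
    obtain ⟨h1, h2⟩ := h
    refine hfg w w' h1 ?_
    by_contra hne
    have h3 := Int.abs_sub_lt_one_of_floor_eq_floor h2
    have h4 : val w - val w' =
        (cantorPos ((w ++ v).map g) - cantorPos ((w' ++ v).map g)) * r := by
      simp only [val, List.map_append, h1]
      field_simp
      ring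
    have hl : ((w ++ v).map g).length = ((w' ++ v).map g).length := by
      simp [(hS w hw).1, (hS w' hw').1]
    have h5 := two_div_le_abs_cantorPos_sub hl (by simpa using hne)
    have h6 : ((w ++ v).map g).length = v.length + ℓ := by
      simp [(hS w hw).1, add_comm]
    rw [h6, ← hr, div_le_iff₀ hr0] at h5
    rw [h4, abs_mul, abs_of_pos hr0] at h3
    linarith
  refine (Set.encard_le_encard_of_injOn hmaps hinj).trans ?_
  rw [Set.encard_prod, encard_setOf_length_eq]
  gcongr
  rw [← Finset.coe_Icc, Set.encard_coe_eq_coe_finsetCard]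
  rfl

lemma abs_le_of_mem_cantorSquare {b : ℕ} {w : List (Fin b × Fin b)} {A B C : ℝ} {z : ℝ × ℝ}
    (hz : z ∈ cantorSquare w)
    (h : |A * z.1 + B * z.2 + C| ≤ max |A| |B| / (2 * (b : ℝ)) ^ w.length) :
    |A * cantorPos (w.map Prod.fst) + B * cantorPos (w.map Prod.snd) + C| ≤
      3 * max |A| |B| / (2 * (b : ℝ)) ^ w.length := by
  obtain ⟨⟨h1, h2⟩, h3, h4⟩ := hz
  set x := cantorPos (w.map Prod.fst)
  set y := cantorPos (w.map Prod.snd)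
  set M := max |A| |B|
  set δ := 1 / (2 * (b : ℝ)) ^ w.length with hδ
  have e1 : A * x + B * y + C = (A * z.1 + B * z.2 + C) + (A * (x - z.1) + B * (y - z.2)) := by ring
  have hx : |x - z.1| ≤ δ := abs_le.mpr ⟨by linarith, by linarith⟩
  have hy : |y - z.2| ≤ δ := abs_le.mpr ⟨by linarith, by linarith⟩
  have hA : |A * (x - z.1)| ≤ M * δ := by
    rw [abs_mul]
    exact mul_le_mul (le_max_left _ _) hx (abs_nonneg _) ((abs_nonneg _).trans (le_max_left _ _))
  have hB : |B * (y - z.2)| ≤ M * δ := by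
    rw [abs_mul]
    exact mul_le_mul (le_max_right _ _) hy (abs_nonneg _) ((abs_nonneg _).trans (le_max_left _ _))
  have e2 : M / (2 * (b : ℝ)) ^ w.length = M * δ := by rw [hδ]; ring
  have e3 : 3 * M / (2 * (b : ℝ)) ^ w.length = 3 * (M * δ) := by rw [hδ]; ring
  rw [e2] at h
  rw [e1, e3]
  have := abs_add_le (A * z.1 + B * z.2 + C) (A * (x - z.1) + B * (y - z.2))
  have := abs_add_le (A * (x - z.1)) (B * (y - z.2))
  linarith

/-- A strip of width comparable to the side of the squares of level `v.length + ℓ` meets at most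
`7 b ^ ℓ` of those inside the square of `v`. -/
lemma encard_setOf_cantorSquare_meets_strip_le {b : ℕ} (hb : 0 < b) (v : List (Fin b × Fin b))
    (ℓ : ℕ) {A B : ℝ} (C : ℝ) (hAB : 0 < max |A| |B|) :
    {w : List (Fin b × Fin b) | w.length = ℓ ∧ ∃ z ∈ cantorSquare (w ++ v),
      |A * z.1 + B * z.2 + C| ≤ max |A| |B| / (2 * (b : ℝ)) ^ (v.length + ℓ)}.encard ≤
      (b : ℕ∞) ^ ℓ * 7 := by
  have key : ∀ w : List (Fin b × Fin b), w.length = ℓ → (∃ z ∈ cantorSquare (w ++ v),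
      |A * z.1 + B * z.2 + C| ≤ max |A| |B| / (2 * (b : ℝ)) ^ (v.length + ℓ)) →
      |A * cantorPos ((w ++ v).map Prod.fst) + B * cantorPos ((w ++ v).map Prod.snd) + C| ≤
      3 * max |A| |B| / (2 * (b : ℝ)) ^ (v.length + ℓ) := by
    rintro w hw ⟨z, hz, h⟩
    have hl : (w ++ v).length = v.length + ℓ := by rw [List.length_append, hw, add_comm]
    rw [← hl] at h ⊢
    exact abs_le_of_mem_cantorSquare hz h
  rcases le_total |A| |B| with hM | hM
  · rw [max_eq_right hM] at key hAB ⊢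
    refine encard_le_of_abs_cantorPos_le hb v ℓ Prod.fst Prod.snd (fun w w' h h' => ?_)
      (abs_pos.mp hAB) (fun w hw => ⟨hw.1, key w hw.1 hw.2⟩)
    rw [List.zip_of_prod h h']
    exact (List.zip_of_prod rfl rfl).symm
  · rw [max_eq_left hM] at key hAB ⊢
    refine encard_le_of_abs_cantorPos_le (A := B) (C := C) hb v ℓ Prod.snd Prod.fst
      (fun w w' h h' => ?_) (abs_pos.mp hAB) (fun w hw => ⟨hw.1, ?_⟩)
    · rw [List.zip_of_prod h' h]
      exact (List.zip_of_prod rfl rfl).symm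
    · rw [add_comm (B * _)]
      exact key w hw.1 hw.2

open scoped ENNReal in
lemma natCast_mul_inv_pow_le {b K : ℕ} (hb : 0 < b) (hbK : 224 * b ≤ K) (ℓ : ℕ) :
    ((ℓ * (b ^ ℓ * 7) : ℕ) : ℝ≥0∞) * ((K : ℝ≥0∞)⁻¹) ^ ℓ ≤ 8⁻¹ * 2⁻¹ ^ ℓ := by
  have hnat : (ℓ * (b ^ ℓ * 7)) * (8 * 2 ^ ℓ) ≤ K ^ ℓ := by
    rcases Nat.eq_zero_or_pos ℓ with rfl | hℓ
    · simp
    calc (ℓ * (b ^ ℓ * 7)) * (8 * 2 ^ ℓ) = 56 * (ℓ * 2 ^ ℓ) * b ^ ℓ := by ring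
      _ ≤ 56 ^ ℓ * (2 ^ ℓ * 2 ^ ℓ) * b ^ ℓ := by
        gcongr
        · exact Nat.le_self_pow hℓ.ne' 56
        · exact Nat.lt_two_pow_self.le
      _ = (224 * b) ^ ℓ := by
        rw [← mul_pow, ← mul_pow, ← mul_pow]
        norm_num
      _ ≤ K ^ ℓ := by gcongr
  have hK : K ≠ 0 := by omega
  have h8 : (8⁻¹ * 2⁻¹ ^ ℓ : ℝ≥0∞) = ((8 * 2 ^ ℓ : ℕ) : ℝ≥0∞)⁻¹ := by
    push_cast
    rw [ENNReal.mul_inv (by simp) (by simp), ENNReal.inv_pow]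
  rw [h8, ← ENNReal.inv_pow, ← div_eq_mul_inv]
  refine ENNReal.div_le_of_le_mul ?_
  rw [mul_comm _⁻¹, ← div_eq_mul_inv, ENNReal.le_div_iff_mul_le (by simp) (by simp)]
  exact_mod_cast hnat

/-- Sets controlled by strips simultaneously contain the limit points of a subtree of the Cantor
construction in which every vertex has at least `K` children. -/
lemma exists_subtree_cantorSquare {b K : ℕ} (hb : 0 < b) (hbK : 224 * b ≤ K)
    (hKb : 3 * K ≤ b * b) (S : ℕ → Set (ℝ × ℝ))
    (hS : ∀ i, StripControlled (2 * (b : ℝ)) (i + 1) (S i)) :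
    ∃ G : Set (List (Fin b × Fin b)), [] ∈ G ∧
      (∀ v ∈ G, ∃ f : Fin K → Fin b × Fin b, Function.Injective f ∧ ∀ k, f k :: v ∈ G) ∧
      ∀ w : ℕ → List (Fin b × Fin b), w 0 = [] → (∀ n, w n ∈ G) →
        (∀ n, ∃ u, w (n + 1) = u :: w n) → ∀ z, (∀ n, z ∈ cantorSquare (w n)) → z ∈ ⋂ i, S i := by
  classical
  choose ι Δ lev lag hlag hΔ hstrip using hS
  let Rem : ℕ → Set (List (Fin b × Fin b)) := fun ℓ =>
    {w | ℓ ≤ w.length ∧ ∃ i j, lev i j = w.length ∧ lag i j = ℓ ∧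
      (cantorSquare w ∩ Δ i j).Nonempty ∧
      ∀ j', lev i j' ≤ w.length - ℓ → Disjoint (cantorSquare (w.drop ℓ)) (Δ i j')}
  have hcount : ∀ v ℓ, {w | w.length = ℓ ∧ w ++ v ∈ Rem ℓ}.encard ≤
      ((ℓ * (b ^ ℓ * 7) : ℕ) : ℕ∞) := by
    intro v ℓ
    let T : ℕ → Set (List (Fin b × Fin b)) := fun i => {w | w.length = ℓ ∧
      ∃ j, lev i j = v.length + ℓ ∧ lag i j = ℓ ∧ (cantorSquare (w ++ v) ∩ Δ i j).Nonempty ∧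
      ∀ j', lev i j' ≤ v.length → Disjoint (cantorSquare v) (Δ i j')}
    have hT : ∀ i, (T i).encard ≤ (b : ℕ∞) ^ ℓ * 7 := by
      intro i
      by_cases hdis : ∀ j', lev i j' ≤ v.length → Disjoint (cantorSquare v) (Δ i j')
      · obtain ⟨A, B, C, hAB, h⟩ := hstrip i v.length ℓ (cantorSquare v)
          (fun z hz w hw => dist_le_of_mem_cantorSquare hz hw) hdis
        refine le_trans (Set.encard_le_encard ?_)
          (encard_setOf_cantorSquare_meets_strip_le hb v ℓ C hAB)
        rintro w ⟨hw, j, h1, h2, ⟨z, hz, hz'⟩, -⟩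
        exact ⟨hw, z, hz, h j h1 h2 z ⟨cantorSquare_append_subset w v hz, hz'⟩⟩
      · have : T i = ∅ := by
          ext w
          simp only [T, Set.mem_empty_iff_false, iff_false]
          rintro ⟨-, j, -, -, -, h⟩
          exact hdis h
        simp [this]
    have hsub : {w | w.length = ℓ ∧ w ++ v ∈ Rem ℓ} ⊆ ⋃ i ∈ Finset.range ℓ, T i := by
      rintro w ⟨hw, -, i, j, h1, h2, h3, h4⟩
      have hl : (w ++ v).length = v.length + ℓ := by rw [List.length_append, hw, add_comm]
      rw [hl] at h1 h4
      rw [← hw, List.drop_left, hw, Nat.add_sub_cancel] at h4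
      simp only [Set.mem_iUnion, Finset.mem_range]
      refine ⟨i, ?_, hw, j, h1, h2, h3, h4⟩
      have := (hlag i j).1
      omega
    refine (Set.encard_le_encard hsub).trans ?_
    refine (Finset.set_encard_biUnion_le _ _).trans ?_
    refine (Finset.sum_le_card_nsmul _ _ _ fun i _ => hT i).trans ?_
    simp
  obtain ⟨G, hG0, hGRem, hGf⟩ := exists_subtree_avoiding (K := K) (by omega)
    (by simpa using hKb) Rem (fun ℓ w hw => hw.1) (by
      intro v
      have h1 : ∀ ℓ, ∑' w : List (Fin b × Fin b),
          (if w.length = ℓ ∧ w ++ v ∈ Rem ℓ then ((K : ENNReal)⁻¹) ^ ℓ else 0) ≤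
          8⁻¹ * 2⁻¹ ^ ℓ := by
        intro ℓ
        have h2 := tsum_subtype {w | w.length = ℓ ∧ w ++ v ∈ Rem ℓ}
          (fun _ => ((K : ENNReal)⁻¹) ^ ℓ)
        rw [ENNReal.tsum_set_const] at h2
        simp only [Set.indicator_apply, Set.mem_ofPred_eq] at h2
        refine le_trans (le_of_eq ?_) (le_trans (mul_le_mul_left
          (ENat.toENNReal_le.mpr (hcount v ℓ)) _) (natCast_mul_inv_pow_le hb hbK ℓ))
        rw [h2]
      have h2 := (ENNReal.tsum_le_tsum h1).trans_eq (c := (4 : ENNReal)⁻¹) (by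
        rw [ENNReal.tsum_mul_left, ENNReal.tsum_geometric_two,
          ← ENNReal.toReal_eq_toReal_iff' (by simp [ENNReal.mul_eq_top]) (by simp)]
        norm_num)
      convert h2)
  refine ⟨G, hG0, hGf, ?_⟩
  intro w hw0 hwG hw z hz
  have hlen : ∀ n, (w n).length = n := by
    intro n
    induction n with
    | zero => simp [hw0]
    | succ n ih =>
      obtain ⟨u, hu⟩ := hw n
      rw [hu, List.length_cons, ih]
  have hdrop : ∀ ℓ m, (w (m + ℓ)).drop ℓ = w m := by
    intro ℓ
    induction ℓ with
    | zero => simp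
    | succ ℓ ih =>
      intro m
      obtain ⟨u, hu⟩ := hw (m + ℓ)
      rw [← add_assoc, hu, List.drop_succ_cons, ih]
  have hdisj : ∀ n i j, lev i j ≤ n → Disjoint (cantorSquare (w n)) (Δ i j) := by
    intro n
    induction n using Nat.strong_induction_on with
    | _ n ih =>
      intro i j hj
      rcases hj.lt_or_eq with hlt | heq
      · obtain ⟨m, rfl⟩ : ∃ m, n = m + 1 := ⟨n - 1, by omega⟩
        obtain ⟨u, hu⟩ := hw m
        rw [hu]
        exact (ih m (by omega) i j (by omega)).mono_left (cantorSquare_cons_subset u _)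
      · by_contra hnot
        rw [Set.not_disjoint_iff_nonempty_inter] at hnot
        have hl := hlag i j
        refine hGRem (w n) (hwG n) (lag i j) ⟨by rw [hlen]; omega, i, j, by rw [hlen]; exact heq,
          rfl, hnot, fun j' hj' => ?_⟩
        rw [hlen] at hj'
        obtain ⟨m, rfl⟩ : ∃ m, n = m + lag i j := ⟨n - lag i j, by omega⟩
        rw [hdrop]
        exact ih m (by omega) i j' (by omega)
  rw [Set.mem_iInter]
  intro i
  refine hΔ i z fun j hj => ?_
  exact Set.disjoint_left.mp (hdisj (lev i j) i j le_rfl) (hz _) hj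

lemma isClosed_cantorSquare {b : ℕ} (v : List (Fin b × Fin b)) : IsClosed (cantorSquare v) :=
  isClosed_Icc.prod isClosed_Icc

lemma isCompact_cantorSquare {b : ℕ} (v : List (Fin b × Fin b)) : IsCompact (cantorSquare v) :=
  isCompact_Icc.prod isCompact_Icc

lemma nonempty_cantorSquare {b : ℕ} (v : List (Fin b × Fin b)) : (cantorSquare v).Nonempty :=
  (Set.nonempty_Icc.mpr (by simp only [le_add_iff_nonneg_right]; positivity)).prod
    (Set.nonempty_Icc.mpr (by simp only [le_add_iff_nonneg_right]; positivity))

/-- Mass distribution on a subtree of the Cantor construction, phrased through a Hölder map onto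
the unit interval. -/
lemma le_dimH_of_subtree_cantorSquare {b K : ℕ} (hb : 0 < b) (hK : 1 < K) {r : NNReal}
    (hr : 0 < r) (hrK : (2 * (b : ℝ)) ^ (r : ℝ) ≤ K) {G : Set (List (Fin b × Fin b))}
    (hG0 : [] ∈ G)
    (hG : ∀ v ∈ G, ∃ f : Fin K → Fin b × Fin b, Function.Injective f ∧ ∀ k, f k :: v ∈ G)
    {T : Set (ℝ × ℝ)}
    (hT : ∀ w : ℕ → List (Fin b × Fin b), w 0 = [] → (∀ n, w n ∈ G) →
      (∀ n, ∃ u, w (n + 1) = u :: w n) → ∀ z, (∀ n, z ∈ cantorSquare (w n)) → z ∈ T) :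
    (r : ENNReal) ≤ dimH T := by
  have : NeZero b := ⟨hb.ne'⟩
  have : NeZero K := ⟨by omega⟩
  have hb0 : (0 : ℝ) < b := by exact_mod_cast hb
  have hK0 : (0 : ℝ) < K := by exact_mod_cast (by omega : 0 < K)
  choose! f hfinj hfG using hG
  obtain ⟨node, hzero, hsucc⟩ : ∃ node : (ℕ → Fin K) → ℕ → List (Fin b × Fin b),
      (∀ σ, node σ 0 = []) ∧ ∀ σ n, node σ (n + 1) = f (node σ n) (σ n) :: node σ n :=
    ⟨fun σ n => Nat.rec [] (fun n v => f v (σ n) :: v) n, fun _ => rfl, fun _ _ => rfl⟩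
  have hnodeG : ∀ σ n, node σ n ∈ G := by
    intro σ n
    induction n with
    | zero => rw [hzero]; exact hG0
    | succ n ih => rw [hsucc]; exact hfG _ ih _
  have hlen : ∀ σ n, (node σ n).length = n := by
    intro σ n
    induction n with
    | zero => rw [hzero, List.length_nil]
    | succ n ih => rw [hsucc, List.length_cons, ih]
  have hcongr : ∀ σ τ n, (∀ i < n, σ i = τ i) → node σ n = node τ n := by
    intro σ τ n
    induction n with
    | zero => intro _; rw [hzero, hzero]
    | succ n ih =>
      intro h
      rw [hsucc, hsucc, ih fun i hi => h i (by omega), h n (by omega)]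
  have hlim : ∀ σ, ∃ z, ∀ n, z ∈ cantorSquare (node σ n) := by
    intro σ
    obtain ⟨z, hz⟩ := IsCompact.nonempty_iInter_of_sequence_nonempty_isCompact_isClosed
      (fun n => cantorSquare (node σ n)) (fun n => hsucc σ n ▸ cantorSquare_cons_subset _ _)
      (fun n => nonempty_cantorSquare _) (isCompact_cantorSquare _)
      (fun n => isClosed_cantorSquare _)
    exact ⟨z, Set.mem_iInter.mp hz⟩
  choose z hz using hlim
  have hzT : Set.range z ⊆ T := by
    rintro _ ⟨σ, rfl⟩
    exact hT (node σ) (hzero σ) (hnodeG σ) (fun n => ⟨_, hsucc σ n⟩) _ (hz σ)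
  have hhold : ∀ σ τ, |Real.ofDigits σ - Real.ofDigits τ| ≤ K * dist (z σ) (z τ) ^ (r : ℝ) ∧
      (z σ = z τ → σ = τ) := by
    intro σ τ
    by_cases hστ : σ = τ
    · subst hστ
      exact ⟨by simp only [sub_self, abs_zero]; positivity, fun _ => rfl⟩
    have hex : ∃ n, σ n ≠ τ n := Function.ne_iff.mp hστ
    classical
    set m := Nat.find hex with hm
    have hmne : σ m ≠ τ m := Nat.find_spec hex
    have hlt : ∀ i < m, σ i = τ i := fun i hi => not_not.mp (Nat.find_min hex hi)
    have hnode := hcongr σ τ m hlt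
    have hne : node σ (m + 1) ≠ node τ (m + 1) := by
      rw [hsucc, hsucc, ← hnode]
      intro h
      exact hmne (hfinj _ (hnodeG σ m) (List.cons.inj h).1)
    have hdist := le_dist_of_mem_cantorSquare (by rw [hlen, hlen]) hne (hz σ (m + 1)) (hz τ (m + 1))
    rw [hlen] at hdist
    have hpos : 0 < 1 / (2 * (b : ℝ)) ^ (m + 1) := by positivity
    refine ⟨?_, fun h => ?_⟩
    · calc |Real.ofDigits σ - Real.ofDigits τ| ≤ ((K : ℝ) ^ m)⁻¹ :=
            Real.abs_ofDigits_sub_ofDigits_le hlt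
        _ = K * (1 / (K : ℝ) ^ (m + 1)) := by field_simp; ring
        _ ≤ K * (1 / ((2 * (b : ℝ)) ^ (r : ℝ)) ^ (m + 1)) := by gcongr
        _ = K * (1 / (2 * (b : ℝ)) ^ (m + 1)) ^ (r : ℝ) := by
          rw [Real.div_rpow zero_le_one (by positivity), Real.one_rpow, ← Real.rpow_natCast,
            ← Real.rpow_natCast, ← Real.rpow_mul (by positivity), ← Real.rpow_mul (by positivity),
            mul_comm (r : ℝ)]
        _ ≤ K * dist (z σ) (z τ) ^ (r : ℝ) := by gcongr
    · rw [h, dist_self] at hdist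
      exact absurd hdist hpos.not_ge
  have hinj : Function.Injective z := fun σ τ h => (hhold σ τ).2 h
  let φ : ℝ × ℝ → ℝ := fun p => Real.ofDigits (Function.invFun z p)
  have hφ : ∀ σ, φ (z σ) = Real.ofDigits σ := fun σ => by
    simp only [φ, Function.leftInverse_invFun hinj σ]
  have hholder : HolderOnWith (K : NNReal) r φ (Set.range z) := by
    rintro _ ⟨σ, rfl⟩ _ ⟨τ, rfl⟩
    rw [hφ, hφ, edist_dist, edist_dist, Real.dist_eq,
      ENNReal.ofReal_rpow_of_nonneg dist_nonneg r.coe_nonneg]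
    have := ENNReal.ofReal_le_ofReal (hhold σ τ).1
    rwa [ENNReal.ofReal_mul hK0.le, ENNReal.ofReal_natCast] at this
  have himage : Set.Ico (0 : ℝ) 1 ⊆ φ '' Set.range z := by
    intro x hx
    exact ⟨_, ⟨x.digits K, rfl⟩, by rw [hφ, Real.ofDigits_digits hK hx]⟩
  have hone : (1 : ENNReal) ≤ dimH (φ '' Set.range z) := by
    refine le_trans ?_ (dimH_mono himage)
    rw [Real.dimH_of_nonempty_interior (by rw [interior_Ico]; exact Set.nonempty_Ioo.mpr one_pos)]
    simp
  have hle := hone.trans (hholder.dimH_image_le hr)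
  rw [ENNReal.le_div_iff_mul_le (by simp [hr.ne']) (by simp), one_mul] at hle
  exact hle.trans (dimH_mono hzT)

lemma exists_rpow_le_three_mul_sq {r : ℝ} (hr : r < 2) :
    ∃ d : ℕ, 224 ≤ d ∧ (2 * ((3 * d : ℕ) : ℝ)) ^ r ≤ (3 * d ^ 2 : ℕ) := by
  have h : Tendsto (fun d : ℕ => (d : ℝ) ^ (2 - r)) atTop atTop :=
    (tendsto_rpow_atTop (by linarith)).comp tendsto_natCast_atTop_atTop
  obtain ⟨d, h1, h2⟩ := ((h.eventually_ge_atTop 12).and (eventually_ge_atTop 224)).exists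
  refine ⟨d, h2, ?_⟩
  have hd : (0 : ℝ) < d := by exact_mod_cast (by omega : 0 < d)
  have h6 : (6 : ℝ) ^ r ≤ 36 := by
    calc (6 : ℝ) ^ r ≤ 6 ^ (2 : ℝ) := Real.rpow_le_rpow_of_exponent_le (by norm_num) hr.le
      _ = 36 := by norm_num
  have hsplit : (d : ℝ) ^ (2 - r) * (d : ℝ) ^ r = (d : ℝ) ^ 2 := by
    rw [← Real.rpow_add hd, sub_add_cancel]
    exact Real.rpow_two _
  have hdr : 0 < (d : ℝ) ^ r := Real.rpow_pos_of_pos hd r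
  calc (2 * ((3 * d : ℕ) : ℝ)) ^ r = (6 * (d : ℝ)) ^ r := by push_cast; ring_nf
    _ = 6 ^ r * (d : ℝ) ^ r := Real.mul_rpow (by norm_num) hd.le
    _ ≤ 36 * (d : ℝ) ^ r := by gcongr
    _ ≤ 3 * ((d : ℝ) ^ (2 - r) * (d : ℝ) ^ r) := by nlinarith
    _ = (3 * d ^ 2 : ℕ) := by rw [hsplit]; push_cast; ring

/-- For any countable collection of pairs `(sₙ, tₙ)` with `sₙ, tₙ ≥ 0` and `sₙ + tₙ = 1`,
the intersection `⋂ₙ Bad(sₙ, tₙ)` has full Hausdorff dimension in ℝ². -/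
theorem dimH_iInter_badPair (st : ℕ → ℝ × ℝ)
    (h : ∀ n : ℕ, 0 ≤ (st n).1 ∧ 0 ≤ (st n).2 ∧ (st n).1 + (st n).2 = 1) :
    dimH (⋂ n : ℕ, badPair (st n).1 (st n).2) = 2 := by
  apply le_antisymm
  · refine (dimH_mono (Set.subset_univ _)).trans ?_
    rw [Real.dimH_univ_eq_finrank]
    simp
  · refine ENNReal.le_of_forall_nnreal_lt fun r hr => ?_
    rcases eq_zero_or_pos r with rfl | hr0
    · simp
    have hr2 : (r : ℝ) < 2 := by exact_mod_cast hr
    obtain ⟨d, hd, hdr⟩ := exists_rpow_le_three_mul_sq hr2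
    have hb : 0 < 3 * d := by omega
    have hR : (2 : ℝ) ≤ 2 * ((3 * d : ℕ) : ℝ) := by
      have : (1 : ℝ) ≤ ((3 * d : ℕ) : ℝ) := by exact_mod_cast hb
      linarith
    obtain ⟨G, hG0, hG, hlim⟩ := exists_subtree_cantorSquare (b := 3 * d) (K := 3 * d ^ 2) hb
      (by nlinarith) (by nlinarith) (fun n => badPair (st n).1 (st n).2)
      (fun n => stripControlled_badPair hR (h n).1 (h n).2.1 (h n).2.2 (n + 1))
    exact le_dimH_of_subtree_cantorSquare hb (by nlinarith) hr0 hdr hG0 hG hlim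
end
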